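/- Every triangle-free graph drawn in the torus with representativity at most 1 is 3-colorable. -/

import Mathlib

open Set Topology

noncomputable section

/-- The circle `ℝ/ℤ`. -/
abbrev Circle1 : Type := AddCircle (1 : ℝ)

/-- The torus `(ℝ/ℤ) × (ℝ/ℤ)`. -/
abbrev Torus : Type := Circle1 × Circle1

/-- A set is an arc if it is homeomorphic to the open unit interval. -/
def IsArc {S : Type} [TopologicalSpace S] (A : Set S) : Prop :=
  Nonempty ((Set.Ioo (0 : ℝ) 1) ≃ₜ A)

/-- A drawing, in the space `S`, of a multigraph whose edges `E` have endpoints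
given by `ends`.  Vertices are drawn as distinct points, edges as arcs whose closure
adds exactly the endpoint vertices; arcs are pairwise disjoint and avoid all
vertex points. -/
structure MDrawing {V E : Type} (ends : E → Sym2 V) (S : Type) [TopologicalSpace S] where
  vmap : V → S
  vinj : Function.Injective vmap
  emap : E → Set S
  arc : ∀ e, IsArc (emap e)
  closure_emap : ∀ (e : E) (u w : V), ends e = s(u, w) →
    closure (emap e) = emap e ∪ {vmap u, vmap w}
  vertex_notin : ∀ (e : E) (x : V), vmap x ∉ emap e
  edges_disj : ∀ e f : E, e ≠ f → emap e ∩ emap f = ∅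

namespace MDrawing

variable {V E S : Type} [TopologicalSpace S] {ends : E → Sym2 V}

/-- The point set `|G|` of the drawing. -/
def image (d : MDrawing ends S) : Set S :=
  Set.range d.vmap ∪ ⋃ e, d.emap e

/-- A face: a connected component of the complement of the drawing. -/
def IsFace (d : MDrawing ends S) (f : Set S) : Prop :=
  ∃ x ∈ (d.image)ᶜ, f = connectedComponentIn (d.image)ᶜ x

/-- The length of a face: each edge drawn in the frontier of `g` contributes `2`
if `g` is the unique face whose frontier contains the arc, and `1` otherwise. -/
def faceLen (d : MDrawing ends S) (g : Set S) : ℕ :=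
  2 * {e : E | d.emap e ⊆ frontier g ∧
        (∀ g', d.IsFace g' → d.emap e ⊆ frontier g' → g' = g)}.ncard +
    {e : E | d.emap e ⊆ frontier g ∧
        ¬ (∀ g', d.IsFace g' → d.emap e ⊆ frontier g' → g' = g)}.ncard

end MDrawing

/-- A drawing of a simple graph `G`: a drawing of the multigraph whose edge set is
the edge set of `G`. -/
abbrev Drawing {V : Type} (G : SimpleGraph V) (S : Type) [TopologicalSpace S] :=
  MDrawing (fun e : G.edgeSet => (e : Sym2 V)) S

/-- The point set of (the drawing of) a walk: the vertex points of its support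
together with the arcs of its edges. -/
def walkImage {V S : Type} [TopologicalSpace S] {G : SimpleGraph V} (d : Drawing G S)
    {a b : V} (w : G.Walk a b) : Set S :=
  (⋃ v ∈ w.support, {d.vmap v}) ∪
    ⋃ (e : G.edgeSet) (_ : (e : Sym2 V) ∈ w.edges), d.emap e

/-- A closed curve is null-homotopic if it is homotopic to a constant map. -/
def NullHomotopic {S : Type} [TopologicalSpace S] (γ : C(Circle1, S)) : Prop :=
  ∃ c : S, ContinuousMap.Homotopic γ (ContinuousMap.const Circle1 c)

/-- A set is a contractible simple closed curve if it is the range of an injective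
closed curve which is null-homotopic. -/
def ContractibleSet {S : Type} [TopologicalSpace S] (A : Set S) : Prop :=
  ∃ γ : C(Circle1, S), Function.Injective γ ∧ Set.range γ = A ∧ NullHomotopic γ

/-- A cycle (given as a closed walk) is contractible if the closed curve tracing
its drawing is null-homotopic. -/
def ContractibleWalk {V S : Type} [TopologicalSpace S] {G : SimpleGraph V}
    (d : Drawing G S) {a : V} (w : G.Walk a a) : Prop :=
  ContractibleSet (walkImage d w)

/-- A graph is 4-critical if its chromatic number is `4` and every proper subgraph
has chromatic number at most `3`. -/
def FourCritical {V : Type} (G : SimpleGraph V) : Prop :=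
  G.chromaticNumber = 4 ∧
    ∀ H : G.Subgraph, H ≠ ⊤ → H.coe.chromaticNumber ≤ 3

/-- A graph is triangle-free if it contains no 3-cycle. -/
def TriangleFree {V : Type} (G : SimpleGraph V) : Prop :=
  ∀ (a : V) (w : G.Walk a a), w.IsCycle → w.length ≠ 3

/-- `f` is a `k`-face: a face bounded by a cycle of length `k`. -/
def IsKFace {V S : Type} [TopologicalSpace S] {G : SimpleGraph V} (d : Drawing G S)
    (f : Set S) (k : ℕ) : Prop :=
  d.IsFace f ∧ ∃ (a : V) (w : G.Walk a a), w.IsCycle ∧ w.length = k ∧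
    frontier f = walkImage d w

/-- `f` is a face bounded by the 4-cycle `v1 v2 v3 v4`. -/
def IsQuadFace {V S : Type} [TopologicalSpace S] {G : SimpleGraph V} (d : Drawing G S)
    (f : Set S) (v1 v2 v3 v4 : V) : Prop :=
  d.IsFace f ∧ ∃ w : G.Walk v1 v1, w.IsCycle ∧
    w.support = [v1, v2, v3, v4, v1] ∧ frontier f = walkImage d w

/-- A set is an open disk if it is homeomorphic to an open disk in the plane. -/
def IsOpenDisk {S : Type} [TopologicalSpace S] (A : Set S) : Prop :=
  Nonempty (A ≃ₜ (Metric.ball (0 : ℝ × ℝ) 1))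

namespace TorusThree

open scoped Classical

/-! ### Part A: density of non-3-colourable graphs (Kostochka-Yancey for k = 4) -/

/-- `G` restricted to `S` is 3-colourable. -/
def ColOn {V : Type} (G : SimpleGraph V) (S : Finset V) : Prop :=
  ∃ c : V → Fin 3, ∀ a ∈ S, ∀ b ∈ S, G.Adj a b → c a ≠ c b

/-- number of neighbours of `a` in `S` -/
def dg {V : Type} (G : SimpleGraph V) (S : Finset V) (a : V) : ℕ := (S.filter (G.Adj a)).card

/-- number of adjacent ordered pairs in `A × B` -/
def cr {V : Type} (G : SimpleGraph V) (A B : Finset V) : ℕ := ∑ a ∈ A, dg G B a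

/-- twice the potential -/
def pot {V : Type} (G : SimpleGraph V) (S : Finset V) : ℤ := 10 * (S.card : ℤ) - 3 * (cr G S S : ℤ)

section KY
variable {V : Type} {G : SimpleGraph V}

lemma ColOn.mono {S T : Finset V} (h : ColOn G T) (hS : S ⊆ T) : ColOn G S := by
  obtain ⟨c, hc⟩ := h
  exact ⟨c, fun a ha b hb => hc a (hS ha) b (hS hb)⟩

lemma ColOn.mono_graph {H : SimpleGraph V} {S : Finset V} (h : ColOn H S) (hG : G ≤ H) :
    ColOn G S := by
  obtain ⟨c, hc⟩ := h
  exact ⟨c, fun a ha b hb hab => hc a ha b hb (hG hab)⟩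

lemma dg_mono {S T : Finset V} (h : S ⊆ T) (a : V) : dg G S a ≤ dg G T a :=
  Finset.card_le_card (Finset.filter_subset_filter _ h)

lemma dg_mono_graph {H : SimpleGraph V} (h : G ≤ H) (S : Finset V) (a : V) :
    dg G S a ≤ dg H S a :=
  Finset.card_le_card (Finset.monotone_filter_right _ (fun b _ hb => h hb))

lemma cr_mono_right {A S T : Finset V} (h : S ⊆ T) : cr G A S ≤ cr G A T :=
  Finset.sum_le_sum (fun a _ => dg_mono h a)

lemma cr_mono_graph {H : SimpleGraph V} (h : G ≤ H) (A S : Finset V) : cr G A S ≤ cr H A S :=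
  Finset.sum_le_sum (fun a _ => dg_mono_graph h S a)

lemma dg_eq_sum (S : Finset V) (a : V) : dg G S a = ∑ b ∈ S, if G.Adj a b then 1 else 0 := by
  rw [dg, Finset.card_filter]

lemma cr_comm (A B : Finset V) : cr G A B = cr G B A := by
  simp only [cr, dg_eq_sum]
  rw [Finset.sum_comm]
  simp [G.adj_comm]

lemma dg_union {A B : Finset V} (h : Disjoint A B) (a : V) :
    dg G (A ∪ B) a = dg G A a + dg G B a := by
  simp only [dg_eq_sum, Finset.sum_union h]

lemma cr_union_left {A B : Finset V} (h : Disjoint A B) (C : Finset V) :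
    cr G (A ∪ B) C = cr G A C + cr G B C := by
  simp only [cr, Finset.sum_union h]

lemma cr_union_right {A B : Finset V} (h : Disjoint A B) (C : Finset V) :
    cr G C (A ∪ B) = cr G C A + cr G C B := by
  rw [cr_comm, cr_union_left h, cr_comm A, cr_comm B]

lemma cr_union_self {A B : Finset V} (h : Disjoint A B) :
    cr G (A ∪ B) (A ∪ B) = cr G A A + cr G B B + 2 * cr G A B := by
  rw [cr_union_left h, cr_union_right h, cr_union_right h, cr_comm B A]; ring

lemma cr_insert_self {T : Finset V} {a : V} (h : a ∉ T) :
    cr G (insert a T) (insert a T) = cr G T T + 2 * dg G T a := by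
  have : Disjoint ({a} : Finset V) T := by simpa using h
  rw [Finset.insert_eq, cr_union_self this]
  simp [cr, dg, Finset.filter_singleton]

lemma cr_self_even (S : Finset V) : Even (cr G S S) := by
  induction S using Finset.induction_on with
  | empty => simp [cr]
  | insert a T ha ih => rw [cr_insert_self ha]; exact ih.add (even_two_mul _)

lemma pot_even (S : Finset V) : Even (pot G S) := by
  obtain ⟨k, hk⟩ := cr_self_even (G := G) S
  exact ⟨5 * S.card - 3 * k, by simp only [pot, hk]; push_cast; ring⟩

lemma pot_two {R : Finset V} (h : R.card ≤ 3) (h2 : 2 ≤ R.card) : 12 ≤ pot G R := by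
  have : cr G R R ≤ R.card * (R.card - 1) := by
    rw [cr, ← smul_eq_mul]
    apply Finset.sum_le_card_nsmul
    intro a ha
    rw [← Finset.card_erase_of_mem ha]
    apply Finset.card_le_card
    intro b hb
    simp only [Finset.mem_filter] at hb
    exact Finset.mem_erase.2 ⟨hb.2.ne', hb.1⟩
  unfold pot
  interval_cases h' : R.card <;> norm_num at this ⊢ <;> omega

lemma colOn_of_card {S : Finset V} (h : S.card ≤ 3) : ColOn G S := by
  obtain ⟨f, hf⟩ : ∃ f : S → Fin 3, Function.Injective f := by
    have : Fintype.card S ≤ Fintype.card (Fin 3) := by simpa using h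
    exact (Function.Embedding.nonempty_of_card_le this).elim fun f => ⟨f, f.injective⟩
  refine ⟨fun a => if h : a ∈ S then f ⟨a, h⟩ else 0, ?_⟩
  intro a ha b hb hab
  simp only [ha, hb, dif_pos]
  intro h
  exact hab.ne (congrArg Subtype.val (hf h))

/-- extension of a colouring to a vertex with at most two neighbours -/
lemma colOn_insert {S : Finset V} {x : V} (h : ColOn G S) (hx : dg G S x ≤ 2) :
    ColOn G (insert x S) := by
  obtain ⟨c, hc⟩ := h
  have : ∃ i : Fin 3, i ∉ (S.filter (G.Adj x)).image c := by
    by_contra hcon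
    push Not at hcon
    have h1 : (Finset.univ : Finset (Fin 3)) ⊆ (S.filter (G.Adj x)).image c := fun i _ => hcon i
    have h2 := Finset.card_le_card h1
    have h3 := h2.trans Finset.card_image_le
    have : (S.filter (G.Adj x)).card ≤ 2 := hx
    simp at h3
    omega
  obtain ⟨i, hi⟩ := this
  have hi' : ∀ b ∈ S, G.Adj x b → c b ≠ i := by
    intro b hb hab h
    exact hi (Finset.mem_image.2 ⟨b, by simp [hb, hab], h⟩)
  refine ⟨fun a => if a = x then i else c a, ?_⟩
  intro a ha b hb hab
  by_cases h1 : a = x <;> by_cases h2 : b = x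
  · subst h1; subst h2; exact absurd hab (G.irrefl)
  · subst h1
    simp only [if_true, h2, if_false]
    exact (hi' b (by simpa [h2] using hb) hab).symm
  · subst h2
    simp only [if_true, h1, if_false]
    exact (hi' a (by simpa [h1] using ha) hab.symm)
  · simp only [h1, h2, if_false]
    exact hc a (by simpa [h1] using ha) b (by simpa [h2] using hb) hab

/-- contraction of the colour classes of `φ` on `R` to a triangle -/
def YG (G : SimpleGraph V) (R : Finset V) (φ : V → Fin 3) : SimpleGraph (V ⊕ Fin 3) where
  Adj p q := match p, q with
    | .inl a, .inl b => G.Adj a b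
    | .inl a, .inr i => ∃ r ∈ R, φ r = i ∧ G.Adj a r
    | .inr i, .inl a => ∃ r ∈ R, φ r = i ∧ G.Adj a r
    | .inr i, .inr j => i ≠ j
  symm := ⟨by
    rintro (a | i) (b | j) h
    · exact G.adj_symm h
    · exact h
    · exact h
    · exact fun h' => h h'.symm⟩
  loopless := ⟨by rintro (a | i) h; exacts [G.irrefl h, h rfl]⟩

lemma YG_not_col {S R : Finset V} {φ : V → Fin 3} (hR : R ⊆ S)
    (hφ : ∀ a ∈ R, ∀ b ∈ R, G.Adj a b → φ a ≠ φ b) (h : ¬ ColOn G S) :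
    ¬ ColOn (YG G R φ) ((S \ R).disjSum Finset.univ) := by
  rintro ⟨c, hc⟩
  apply h
  have hinj : ∀ i j : Fin 3, i ≠ j → c (.inr i) ≠ c (.inr j) := fun i j hij =>
    hc _ (by simp) _ (by simp) hij
  refine ⟨fun a => if a ∈ R then c (.inr (φ a)) else c (.inl a), ?_⟩
  intro a ha b hb hab
  by_cases h1 : a ∈ R <;> by_cases h2 : b ∈ R <;> simp only [h1, h2, if_true, if_false]
  · exact hinj _ _ (hφ a h1 b h2 hab)
  · exact hc _ (by simp) _ (by simp [h2, hb]) ⟨a, h1, rfl, hab.symm⟩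
  · exact hc _ (by simp [h1, ha]) _ (by simp) ⟨b, h2, rfl, hab⟩
  · exact hc _ (by simp [h1, ha]) _ (by simp [h2, hb]) hab

lemma YG_pot {R A : Finset V} {φ : V → Fin 3} (hA : Disjoint A R) (I : Finset (Fin 3)) :
    pot G (A ∪ R) + 6 * ((cr G A R : ℤ) - cr G A (R.filter (fun r => φ r ∈ I)))
      ≤ pot (YG G R φ) (A.disjSum I) + pot G R - (10 * I.card - 3 * (I.card * (I.card - 1))) := by
  have e1 : cr (YG G R φ) (A.disjSum I) (A.disjSum I)
      = cr G A A + 2 * (∑ a ∈ A, ∑ i ∈ I, if (∃ r ∈ R, φ r = i ∧ G.Adj a r) then 1 else 0)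
        + ∑ i ∈ I, ∑ j ∈ I, if i ≠ j then 1 else 0 := by
    have t1 : ∀ a b, (if (YG G R φ).Adj (.inl a) (.inl b) then 1 else 0)
        = (if G.Adj a b then 1 else 0 : ℕ) := fun a b => if_congr Iff.rfl rfl rfl
    have t2 : ∀ a i, (if (YG G R φ).Adj (.inl a) (.inr i) then 1 else 0)
        = (if (∃ r ∈ R, φ r = i ∧ G.Adj a r) then 1 else 0 : ℕ) :=
      fun a b => if_congr Iff.rfl rfl rfl
    have t3 : ∀ a i, (if (YG G R φ).Adj (.inr i) (.inl a) then 1 else 0)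
        = (if (∃ r ∈ R, φ r = i ∧ G.Adj a r) then 1 else 0 : ℕ) :=
      fun a b => if_congr Iff.rfl rfl rfl
    have t4 : ∀ i j, (if (YG G R φ).Adj (.inr i) (.inr j) then 1 else 0)
        = (if i ≠ j then 1 else 0 : ℕ) := fun a b => if_congr Iff.rfl rfl rfl
    simp only [cr, dg_eq_sum, Finset.sum_disjSum, t1, t2, t3, t4, Finset.sum_add_distrib]
    rw [Finset.sum_comm (s := I) (t := A)]
    ring
  have e2 : (∑ a ∈ A, ∑ i ∈ I, if (∃ r ∈ R, φ r = i ∧ G.Adj a r) then 1 else 0)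
      ≤ cr G A (R.filter (fun r => φ r ∈ I)) := by
    apply Finset.sum_le_sum
    intro a _
    rw [← Finset.card_filter, dg]
    apply Finset.card_le_card_of_surjOn φ
    intro i hi
    simp only [Finset.coe_filter, Set.mem_ofPred_eq] at hi
    obtain ⟨hi, r, hr, rfl, hra⟩ := hi
    exact ⟨r, by simp [hr, hi, hra], rfl⟩
  have e3 : (∑ i ∈ I, ∑ j ∈ I, if i ≠ j then 1 else 0) + I.card = I.card * I.card := by
    have : ∀ i ∈ I, (∑ j ∈ I, if i ≠ j then 1 else 0) + 1 = I.card := by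
      intro i hi
      rw [← Finset.card_filter, Finset.filter_ne, Finset.card_erase_of_mem hi]
      have := Finset.card_pos.2 ⟨i, hi⟩
      omega
    calc _ = ∑ i ∈ I, ((∑ j ∈ I, if i ≠ j then 1 else 0) + 1) := by
            rw [Finset.sum_add_distrib]; simp
      _ = _ := by rw [Finset.sum_congr rfl this]; simp
  have e4 := cr_union_self (G := G) hA
  have e5 : ((∑ i ∈ I, ∑ j ∈ I, if i ≠ j then 1 else 0 : ℕ) : ℤ) = I.card * (I.card - 1) := by
    have : (((∑ i ∈ I, ∑ j ∈ I, if i ≠ j then 1 else 0) + I.card : ℕ) : ℤ)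
      = ((I.card * I.card : ℕ) : ℤ) := by rw [e3]
    push_cast at this ⊢
    linarith
  unfold pot
  rw [e1, e4, Finset.card_disjSum, Finset.card_union_of_disjoint hA]
  have e2' : ((∑ a ∈ A, ∑ i ∈ I, if (∃ r ∈ R, φ r = i ∧ G.Adj a r) then 1 else 0 : ℕ) : ℤ)
      ≤ (cr G A (R.filter (fun r => φ r ∈ I)) : ℤ) := by exact_mod_cast e2
  rw [Nat.cast_add, Nat.cast_add _ (∑ i ∈ I, _), e5]
  push_cast at e2' ⊢
  linarith

end KY
end TorusThree

namespace TorusThree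

open scoped Classical

section KY2
variable {V : Type} {G : SimpleGraph V}

lemma exists_ext {S : Finset V} {x : V} {c : V → Fin 3}
    (hc : ∀ a ∈ S, ∀ b ∈ S, G.Adj a b → c a ≠ c b)
    (hx : ((S.filter (G.Adj x)).image c).card ≤ 2) :
    ∃ c' : V → Fin 3, (∀ a ∈ insert x S, ∀ b ∈ insert x S, G.Adj a b → c' a ≠ c' b) ∧
      ∀ a, a ≠ x → c' a = c a := by
  have : ∃ i : Fin 3, i ∉ (S.filter (G.Adj x)).image c := by
    by_contra hcon
    push Not at hcon
    have h1 : (Finset.univ : Finset (Fin 3)) ⊆ (S.filter (G.Adj x)).image c := fun i _ => hcon i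
    have h2 := Finset.card_le_card h1
    simp only [Finset.card_univ, Fintype.card_fin] at h2
    omega
  obtain ⟨i, hi⟩ := this
  have hi' : ∀ b ∈ S, G.Adj x b → c b ≠ i := by
    intro b hb hab h
    exact hi (Finset.mem_image.2 ⟨b, by simp [hb, hab], h⟩)
  refine ⟨fun a => if a = x then i else c a, ?_, fun a ha => by simp [ha]⟩
  intro a ha b hb hab
  by_cases h1 : a = x <;> by_cases h2 : b = x
  · subst h1; subst h2; exact absurd hab (G.irrefl)
  · subst h1
    simp only [if_true, h2, if_false]
    exact (hi' b (by simpa [h2] using hb) hab).symm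
  · subst h2
    simp only [if_true, h1, if_false]
    exact (hi' a (by simpa [h1] using ha) hab.symm)
  · simp only [h1, h2, if_false]
    exact hc a (by simpa [h1] using ha) b (by simpa [h2] using hb) hab

/-- induction hypothesis -/
def KYIH (n : ℕ) : Prop := ∀ (W : Type) (H : SimpleGraph W) (T : Finset W), T.card < n →
  ¬ ColOn H T → ∃ R ⊆ T, ¬ ColOn H R ∧ pot H R ≤ 4

lemma ky_step {S R : Finset V} (IH : KYIH S.card) (hcrit : ∀ R, R ⊂ S → ColOn G R)
    (hS : ¬ ColOn G S) (hR : R ⊂ S) (hR4 : 4 ≤ R.card) {φ : V → Fin 3}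
    (hφ : ∀ a ∈ R, ∀ b ∈ R, G.Adj a b → φ a ≠ φ b) :
    ∃ A ⊆ S \ R, ∃ I : Finset (Fin 3), I.Nonempty ∧
      pot G (A ∪ R) + 6 * ((cr G A R : ℤ) - cr G A (R.filter (fun r => φ r ∈ I)))
      ≤ 4 + pot G R - (10 * I.card - 3 * (I.card * (I.card - 1))) := by
  have h1 := YG_not_col hR.1 hφ hS
  have hcard : ((S \ R).disjSum (Finset.univ : Finset (Fin 3))).card < S.card := by
    rw [Finset.card_disjSum, Finset.card_sdiff_of_subset hR.1]
    have := Finset.card_lt_card hR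
    simp
    omega
  obtain ⟨W, hW, hWc, hWp⟩ := IH _ _ _ hcard h1
  have hWe : W.toLeft.disjSum W.toRight = W := Finset.toLeft_disjSum_toRight
  have hA : W.toLeft ⊆ S \ R := by
    intro a ha
    have := hW (Finset.mem_toLeft.1 ha)
    simpa using this
  have hdis : Disjoint W.toLeft R := Finset.disjoint_of_subset_left hA Finset.sdiff_disjoint
  refine ⟨W.toLeft, hA, W.toRight, ?_, ?_⟩
  · by_contra hI
    rw [Finset.not_nonempty_iff_eq_empty] at hI
    apply hWc
    have hAS : W.toLeft ⊂ S := by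
      refine ⟨hA.trans Finset.sdiff_subset, fun h => ?_⟩
      have : R.Nonempty := Finset.card_pos.1 (by omega)
      obtain ⟨r, hr⟩ := this
      exact Finset.disjoint_left.1 hdis (h (hR.1 hr)) hr
    obtain ⟨c, hc⟩ := hcrit _ hAS
    refine ⟨fun p => Sum.elim c (fun _ => 0) p, ?_⟩
    rintro (a | i) ha (b | j) hb hab
    · exact hc a (Finset.mem_toLeft.2 ha) b (Finset.mem_toLeft.2 hb) hab
    · have := Finset.mem_toRight.2 hb; simp [hI] at this
    · have := Finset.mem_toRight.2 ha; simp [hI] at this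
    · have := Finset.mem_toRight.2 ha; simp [hI] at this
  · have h2 := YG_pot (G := G) (φ := φ) hdis W.toRight
    rw [hWe] at h2
    linarith

lemma cr_filter_le (A R : Finset V) (p : V → Prop) [DecidablePred p] : (cr G A (R.filter p) : ℤ) ≤ cr G A R := by
  exact_mod_cast cr_mono_right (Finset.filter_subset _ _)

lemma ky_c1 {S : Finset V} (IH : KYIH S.card) (hcrit : ∀ R, R ⊂ S → ColOn G R)
    (hS : ¬ ColOn G S) (hp : 4 < pot G S) {R : Finset V} (hR : R ⊂ S) (hR2 : 2 ≤ R.card) :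
    12 ≤ pot G R := by
  have hne : (S.ssubsets.filter (fun R => 2 ≤ R.card)).Nonempty := ⟨R, by simp [hR, hR2]⟩
  obtain ⟨M, hM, hmin⟩ := Finset.exists_min_image _ (pot G) hne
  simp only [Finset.mem_filter, Finset.mem_ssubsets] at hM hmin
  refine le_trans ?_ (hmin R ⟨hR, hR2⟩)
  by_contra hlt
  push Not at hlt
  have h4 : 4 ≤ M.card := by
    by_contra h
    exact absurd (pot_two (G := G) (R := M) (by omega) hM.2) (by omega)
  obtain ⟨φ, hφ⟩ := hcrit M hM.1
  obtain ⟨A, hA, I, hI, h⟩ := ky_step IH hcrit hS hM.1 h4 hφ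
  have h1 := cr_filter_le (G := G) A M (fun r => φ r ∈ I)
  have hk : 1 ≤ I.card := Finset.card_pos.2 hI
  have hk3 : I.card ≤ 3 := by simpa using Finset.card_le_univ I
  have h3 : pot G (A ∪ M) ≤ pot G M - 6 := by
    interval_cases hh : I.card <;> norm_num at h <;> linarith
  have hsub : A ∪ M ⊆ S := Finset.union_subset (hA.trans Finset.sdiff_subset) hM.1.1
  rcases hsub.eq_or_ssubset with heq | hss
  · rw [heq] at h3
    obtain ⟨k, hk⟩ := pot_even (G := G) S
    omega
  · have := hmin _ ⟨hss, hM.2.trans (Finset.card_le_card Finset.subset_union_right)⟩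
    omega

lemma cr_edge_le (a b : V) (R : Finset V) :
    cr (G ⊔ SimpleGraph.edge a b) R R ≤ cr G R R + 2 := by
  have h1 : ∀ x ∈ R, dg (G ⊔ SimpleGraph.edge a b) R x ≤
      dg G R x + (if x ∈ ({a, b} : Finset V) then 1 else 0) := by
    intro x _
    have hsub : R.filter ((G ⊔ SimpleGraph.edge a b).Adj x) ⊆
        R.filter (G.Adj x) ∪ (if x ∈ ({a, b} : Finset V) then {if x = a then b else a} else ∅) := by
      intro y hy
      simp only [Finset.mem_filter, SimpleGraph.sup_adj, SimpleGraph.edge_adj] at hy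
      rcases hy with ⟨hyR, h | ⟨⟨rfl, rfl⟩ | ⟨rfl, rfl⟩, hne⟩⟩
      · simp [hyR, h]
      · simp
      · simp [hne]
    have e : dg (G ⊔ SimpleGraph.edge a b) R x
      = (R.filter ((G ⊔ SimpleGraph.edge a b).Adj x)).card := by unfold dg; congr
    rw [e]
    refine (Finset.card_le_card hsub).trans ((Finset.card_union_le _ _).trans ?_)
    unfold dg
    split_ifs <;> simp
  calc _ ≤ ∑ x ∈ R, (dg G R x + (if x ∈ ({a, b} : Finset V) then 1 else 0)) :=
        Finset.sum_le_sum h1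
    _ ≤ _ := by
        rw [Finset.sum_add_distrib, ← Finset.card_filter]
        have : (R.filter (fun x => x ∈ ({a, b} : Finset V))).card ≤ 2 :=
          (Finset.card_le_card (t := {a, b}) (fun x hx => (Finset.mem_filter.1 hx).2)).trans
            Finset.card_le_two
        unfold cr
        omega

lemma ky_bdry {S : Finset V} (hcrit : ∀ R, R ⊂ S → ColOn G R)
    (hS : ¬ ColOn G S) {R : Finset V} (hR : R ⊂ S) (hR4 : 4 ≤ R.card) :
    ∃ a ∈ R, ∃ b ∈ R, a ≠ b ∧ (∃ z ∈ S \ R, G.Adj z a) ∧ (∃ z ∈ S \ R, G.Adj z b) := by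
  by_contra hcon
  push Not at hcon
  obtain ⟨r0, hr0, hr⟩ : ∃ r0 ∈ R, ∀ a ∈ R, ∀ z ∈ S \ R, G.Adj z a → a = r0 := by
    by_cases h : ∃ r0 ∈ R, ∃ z ∈ S \ R, G.Adj z r0
    · obtain ⟨r0, hr0, z, hz, hzr⟩ := h
      refine ⟨r0, hr0, fun a ha z' hz' h' => ?_⟩
      by_contra hne
      exact hcon a ha r0 hr0 hne ⟨z', hz', h'⟩ z hz hzr
    · push Not at h
      obtain ⟨r, hr⟩ : R.Nonempty := Finset.card_pos.1 (by omega)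
      exact ⟨r, hr, fun a ha z hz h' => absurd h' (h a ha z hz)⟩
  obtain ⟨φ, hφ⟩ := hcrit R hR
  have hT : insert r0 (S \ R) ⊂ S := by
    refine ⟨?_, fun h => ?_⟩
    · intro z hz
      rcases Finset.mem_insert.1 hz with rfl | hz
      · exact hR.1 hr0
      · exact (Finset.mem_sdiff.1 hz).1
    · have : R ⊆ {r0} := by
        intro z hz
        have := h (hR.1 hz)
        simp [hz] at this
        simp [this]
      have := Finset.card_le_card this
      simp at this
      omega
  obtain ⟨ψ, hψ⟩ := hcrit _ hT
  apply hS
  refine ⟨fun z => if z ∈ R then φ z else Equiv.swap (ψ r0) (φ r0) (ψ z), ?_⟩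
  intro a ha b hb hab
  by_cases h1 : a ∈ R <;> by_cases h2 : b ∈ R <;> simp only [h1, h2, if_true, if_false]
  · exact hφ a h1 b h2 hab
  · have hb' : b ∈ S \ R := Finset.mem_sdiff.2 ⟨hb, h2⟩
    have := hr a h1 b hb' hab.symm
    subst this
    have := hψ a (by simp) b (Finset.mem_insert_of_mem hb') hab
    intro h
    apply this
    apply (Equiv.swap (ψ a) (φ a)).injective
    rw [← h, Equiv.swap_apply_left]
  · have ha' : a ∈ S \ R := Finset.mem_sdiff.2 ⟨ha, h1⟩
    have := hr b h2 a ha' hab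
    subst this
    have := hψ b (by simp) a (Finset.mem_insert_of_mem ha') hab.symm
    intro h
    apply this
    apply (Equiv.swap (ψ b) (φ b)).injective
    rw [h, Equiv.swap_apply_left]
  · have ha' : a ∈ S \ R := Finset.mem_sdiff.2 ⟨ha, h1⟩
    have hb' : b ∈ S \ R := Finset.mem_sdiff.2 ⟨hb, h2⟩
    intro h
    exact hψ a (Finset.mem_insert_of_mem ha') b (Finset.mem_insert_of_mem hb') hab
      ((Equiv.swap _ _).injective h)

lemma ky_c2 {S : Finset V} (IH : KYIH S.card) (hcrit : ∀ R, R ⊂ S → ColOn G R)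
    (hS : ¬ ColOn G S) (hp : 4 < pot G S) {R : Finset V} (hR : R ⊂ S) (hR4 : 4 ≤ R.card) :
    12 < pot G R := by
  by_contra hlt
  push Not at hlt
  obtain ⟨a, ha, b, hb, hab, ⟨z1, hz1, hza⟩, ⟨z2, hz2, hzb⟩⟩ := ky_bdry hcrit hS hR hR4
  have hcol : ColOn (G ⊔ SimpleGraph.edge a b) R := by
    by_contra hn
    obtain ⟨R', hR', hc', hp'⟩ := IH _ _ _ (Finset.card_lt_card hR) hn
    have h4 : ¬ R'.card ≤ 3 := fun h => hc' (colOn_of_card h)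
    have h1 := ky_c1 IH hcrit hS hp (R := R') (hR'.trans_ssubset hR) (by omega)
    have h2 := cr_edge_le (G := G) a b R'
    unfold pot at hp' h1
    omega
  obtain ⟨φ, hφ⟩ := hcol
  have hφ1 : ∀ a ∈ R, ∀ b ∈ R, G.Adj a b → φ a ≠ φ b := fun a ha b hb h =>
    hφ a ha b hb (Or.inl h)
  have hφab : φ a ≠ φ b := hφ a ha b hb (Or.inr (by simp [SimpleGraph.edge_adj, hab]))
  obtain ⟨A, hA, I, hI, h⟩ := ky_step IH hcrit hS hR hR4 hφ1
  have h1 := cr_filter_le (G := G) A R (fun r => φ r ∈ I)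
  have hk : 1 ≤ I.card := Finset.card_pos.2 hI
  have hk3 : I.card ≤ 3 := by simpa using Finset.card_le_univ I
  have hsub : A ∪ R ⊆ S := Finset.union_subset (hA.trans Finset.sdiff_subset) hR.1
  have h3 : pot G (A ∪ R) ≤ 6 := by
    interval_cases hh : I.card <;> norm_num at h <;> linarith
  rcases hsub.eq_or_ssubset with heq | hss
  · by_cases hk1 : I.card = 1
    · have hAe : A = S \ R := by
        refine hA.antisymm fun z hz => ?_
        have := heq ▸ (Finset.mem_sdiff.1 hz).1
        exact (Finset.mem_union.1 this).resolve_right (Finset.mem_sdiff.1 hz).2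
      obtain ⟨i, rfl⟩ := Finset.card_eq_one.1 hk1
      have : ∃ r ∈ R, φ r ≠ i ∧ ∃ z ∈ A, G.Adj z r := by
        by_cases hai : φ a = i
        · exact ⟨b, hb, fun hbi => hφab (hai.trans hbi.symm), z2, hAe ▸ hz2, hzb⟩
        · exact ⟨a, ha, hai, z1, hAe ▸ hz1, hza⟩
      obtain ⟨r, hr, hri, z, hz, hzr⟩ := this
      have hlt : cr G A (R.filter (fun r => φ r ∈ ({i} : Finset (Fin 3)))) < cr G A R := by
        apply Finset.sum_lt_sum (fun z _ => dg_mono (Finset.filter_subset _ _) z)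
        refine ⟨z, hz, Finset.card_lt_card ⟨Finset.filter_subset_filter _
          (Finset.filter_subset _ _), fun hs => ?_⟩⟩
        have := hs (Finset.mem_filter.2 ⟨hr, hzr⟩)
        simp [hri] at this
      have hlt' : (cr G A (R.filter (fun r => φ r ∈ ({i} : Finset (Fin 3)))) : ℤ) + 1
        ≤ cr G A R := by exact_mod_cast hlt
      rw [heq] at h
      norm_num at h hlt'
      linarith
    · have : pot G (A ∪ R) ≤ 4 := by
        interval_cases hh : I.card <;> norm_num at h hk1 <;> linarith
      rw [heq] at this
      linarith
  · have := ky_c1 IH hcrit hS hp hss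
      (le_trans (by omega) (Finset.card_le_card Finset.subset_union_right))
    linarith

lemma ky_min {S : Finset V} (hcrit : ∀ R, R ⊂ S → ColOn G R)
    (hS : ¬ ColOn G S) {x : V} (hx : x ∈ S) : 3 ≤ dg G S x := by
  by_contra h
  apply hS
  rw [← Finset.insert_erase hx]
  refine colOn_insert (hcrit _ (Finset.erase_ssubset hx)) ?_
  exact (dg_mono (Finset.erase_subset _ _) x).trans (by omega)

/-- identify `v` with `u` -/
def mergeG (G : SimpleGraph V) (u v : V) : SimpleGraph V where
  Adj p q := p ≠ q ∧ (G.Adj p q ∨ (p = u ∧ G.Adj v q) ∨ (q = u ∧ G.Adj p v))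
  symm := ⟨by
    rintro p q ⟨h, h'⟩
    refine ⟨h.symm, ?_⟩
    rcases h' with h' | ⟨rfl, h'⟩ | ⟨rfl, h'⟩
    · exact Or.inl h'.symm
    · exact Or.inr (Or.inr ⟨rfl, h'.symm⟩)
    · exact Or.inr (Or.inl ⟨rfl, h'.symm⟩)⟩
  loopless := ⟨fun _ h => h.1 rfl⟩

lemma cr_merge_le {u v : V} {W : Finset V} (hu : u ∈ W) :
    cr (mergeG G u v) W W ≤ cr G W W + 2 * dg G W v := by
  have h1 : ∀ p ∈ W, dg (mergeG G u v) W p ≤ dg G W p + (if G.Adj v p then 1 else 0)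
      + (if p = u then dg G W v else 0) := by
    intro p _
    have hsub : W.filter ((mergeG G u v).Adj p) ⊆ (W.filter (G.Adj p) ∪
        (if G.Adj v p then {u} else ∅)) ∪ (if p = u then W.filter (G.Adj v) else ∅) := by
      intro q hq
      obtain ⟨hqW, hne, h | ⟨rfl, h⟩ | ⟨rfl, h⟩⟩ := Finset.mem_filter.1 hq
      · simp [hqW, h]
      · simp [hqW, h]
      · simp [h.symm]
    refine (Finset.card_le_card hsub).trans ((Finset.card_union_le _ _).trans
      (add_le_add ((Finset.card_union_le _ _).trans (add_le_add le_rfl ?_)) ?_))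
    · split_ifs <;> simp
    · unfold dg; split_ifs <;> simp
  calc _ ≤ _ := Finset.sum_le_sum h1
    _ = _ := by
      rw [Finset.sum_add_distrib, Finset.sum_add_distrib, ← dg_eq_sum]
      simp [hu, cr]
      ring

lemma ky_c3 {S : Finset V} (IH : KYIH S.card) (hcrit : ∀ R, R ⊂ S → ColOn G R)
    (hS : ¬ ColOn G S) (hp : 4 < pot G S) {x y u v : V} (hx : x ∈ S) (hy : y ∈ S)
    (hu : u ∈ S) (hv : v ∈ S) (hyu : y ≠ u) (hyv : y ≠ v) (huv : u ≠ v)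
    (hxy : G.Adj x y) (hxu : G.Adj x u) (hxv : G.Adj x v)
    (hN : S.filter (G.Adj x) ⊆ {y, u, v}) (hdy : dg G S y ≤ 3) : G.Adj u v := by
  by_contra hnuv
  set S2 := ((S.erase x).erase y).erase v with hS2
  have hmem : ∀ z, z ∈ S2 ↔ z ∈ S ∧ z ≠ x ∧ z ≠ y ∧ z ≠ v := by
    intro z; simp [hS2]; tauto
  have hS2s : S2 ⊂ S := ⟨fun z hz => ((hmem z).1 hz).1, fun h => ((hmem x).1 (h hx)).2.1 rfl⟩
  have hnc : ¬ ColOn (mergeG G u v) S2 := by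
    rintro ⟨c, hc⟩
    apply hS
    set c1 : V → Fin 3 := fun z => if z = v then c u else c z with hc1
    have huS2 : u ∈ S2 := (hmem u).2 ⟨hu, hxu.ne', hyu.symm, huv⟩
    have hp1 : ∀ a ∈ (S.erase x).erase y, ∀ b ∈ (S.erase x).erase y, G.Adj a b →
        c1 a ≠ c1 b := by
      intro a ha b hb hab
      simp only [Finset.mem_erase] at ha hb
      by_cases h1 : a = v <;> by_cases h2 : b = v
      · subst h1; subst h2; exact absurd hab G.irrefl
      · subst h1
        simp only [hc1, h2, if_true, if_false]
        refine hc u huS2 b ((hmem b).2 ⟨hb.2.2, hb.2.1, hb.1, h2⟩) ⟨?_, Or.inr (Or.inl ⟨rfl, hab⟩)⟩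
        rintro rfl
        exact hnuv hab.symm
      · subst h2
        simp only [hc1, h1, if_true, if_false]
        refine hc a ((hmem a).2 ⟨ha.2.2, ha.2.1, ha.1, h1⟩) u huS2 ⟨?_, Or.inr (Or.inr ⟨rfl, hab⟩)⟩
        rintro rfl
        exact hnuv hab
      · simp only [hc1, h1, h2, if_false]
        exact hc a ((hmem a).2 ⟨ha.2.2, ha.2.1, ha.1, h1⟩) b
          ((hmem b).2 ⟨hb.2.2, hb.2.1, hb.1, h2⟩) ⟨hab.ne, Or.inl hab⟩
    have hd : ((((S.erase x).erase y).filter (G.Adj y)).image c1).card ≤ 2 := by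
      refine Finset.card_image_le.trans ?_
      have : ((S.erase x).erase y).filter (G.Adj y) ⊂ S.filter (G.Adj y) := by
        refine ⟨Finset.filter_subset_filter _ ((Finset.erase_subset _ _).trans
          (Finset.erase_subset _ _)), fun h => ?_⟩
        have := h (Finset.mem_filter.2 ⟨hx, hxy.symm⟩)
        simp at this
      have := Finset.card_lt_card this
      have : (S.filter (G.Adj y)).card ≤ 3 := hdy
      omega
    obtain ⟨c2, hc2, hc2e⟩ := exists_ext hp1 hd
    rw [Finset.insert_erase (Finset.mem_erase.2 ⟨hxy.ne', hy⟩)] at hc2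
    have hd2 : (((S.erase x).filter (G.Adj x)).image c2).card ≤ 2 := by
      have : ((S.erase x).filter (G.Adj x)).image c2 ⊆ {c2 y, c2 u} := by
        intro i hi
        obtain ⟨z, hz, rfl⟩ := Finset.mem_image.1 hi
        obtain ⟨hz1, hz2⟩ := Finset.mem_filter.1 hz
        have := hN (Finset.mem_filter.2 ⟨(Finset.mem_erase.1 hz1).2, hz2⟩)
        simp only [Finset.mem_insert, Finset.mem_singleton] at this
        rcases this with rfl | rfl | rfl
        · simp
        · simp
        · rw [hc2e z hyv.symm, hc2e u hyu.symm]
          simp [hc1]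
      exact (Finset.card_le_card this).trans Finset.card_le_two
    obtain ⟨c3, hc3, -⟩ := exists_ext hc2 hd2
    rw [Finset.insert_erase hx] at hc3
    exact ⟨c3, hc3⟩
  obtain ⟨W, hW, hWc, hWp⟩ := IH _ _ _ (Finset.card_lt_card hS2s) hnc
  have huW : u ∈ W := by
    by_contra huW
    apply hWc
    obtain ⟨c, hc⟩ := hcrit W (hW.trans_ssubset hS2s)
    refine ⟨c, fun a ha b hb ⟨_, h⟩ => ?_⟩
    rcases h with h | ⟨rfl, _⟩ | ⟨rfl, _⟩
    · exact hc a ha b hb h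
    · exact absurd ha huW
    · exact absurd hb huW
  have hvW : v ∉ W := fun h => ((hmem v).1 (hW h)).2.2.2 rfl
  have hxW : x ∉ insert v W := by
    intro h
    rcases Finset.mem_insert.1 h with h | h
    · exact hxv.ne h
    · exact ((hmem x).1 (hW h)).2.1 rfl
  have h1 := cr_merge_le (G := G) (v := v) huW
  have h2 := cr_insert_self (G := G) hvW
  have h3 := cr_insert_self (G := G) hxW
  have h4 : 2 ≤ dg G (insert v W) x := by
    have : ({u, v} : Finset V) ⊆ (insert v W).filter (G.Adj x) := by
      intro z hz
      simp only [Finset.mem_insert, Finset.mem_singleton] at hz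
      rcases hz with rfl | rfl
      · simp [huW, hxu]
      · simp [hxv]
    have h := Finset.card_le_card this
    rwa [Finset.card_pair huv] at h
  have hRs : insert x (insert v W) ⊂ S := by
    refine ⟨?_, fun h => ?_⟩
    · intro z hz
      simp only [Finset.mem_insert] at hz
      rcases hz with rfl | rfl | hz
      exacts [hx, hv, hS2s.1 (hW hz)]
    · have := h hy
      simp only [Finset.mem_insert] at this
      rcases this with h | h | h
      exacts [hxy.ne' h, hyv h, ((hmem y).1 (hW h)).2.2.1 rfl]
  have hW4 : ¬ W.card ≤ 3 := fun h => hWc (colOn_of_card h)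
  have hc1 : (insert x (insert v W)).card = W.card + 2 := by
    rw [Finset.card_insert_of_notMem hxW, Finset.card_insert_of_notMem hvW]
  have h5 := ky_c2 IH hcrit hS hp hRs (by omega)
  unfold pot at h5 hWp
  omega

lemma ky_c4 {S : Finset V} (IH : KYIH S.card) (hcrit : ∀ R, R ⊂ S → ColOn G R)
    (hS : ¬ ColOn G S) (hp : 4 < pot G S) {x : V} (hx : x ∈ S) (hdx : dg G S x = 3) :
    dg G (S.filter (fun z => dg G S z = 3)) x ≤ 1 := by
  by_contra hcon
  have h2 : 1 < ((S.filter (fun z => dg G S z = 3)).filter (G.Adj x)).card := by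
    unfold dg at hcon ⊢; omega
  obtain ⟨y, hy, u, hu, hyu⟩ := Finset.one_lt_card.1 h2
  simp only [Finset.mem_filter] at hy hu
  obtain ⟨⟨hyS, hdy⟩, hxy⟩ := hy
  obtain ⟨⟨huS, hdu⟩, hxu⟩ := hu
  have hsub : ({y, u} : Finset V) ⊆ S.filter (G.Adj x) := by
    intro z hz
    simp only [Finset.mem_insert, Finset.mem_singleton] at hz
    rcases hz with rfl | rfl <;> simp [*]
  have h3 : ((S.filter (G.Adj x)) \ {y, u}).card = 1 := by
    rw [Finset.card_sdiff_of_subset hsub, Finset.card_pair hyu]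
    have : (S.filter (G.Adj x)).card = 3 := hdx
    omega
  obtain ⟨v, hv⟩ := Finset.card_eq_one.1 h3
  have hv' : v ∈ (S.filter (G.Adj x)) \ {y, u} := by rw [hv]; simp
  simp only [Finset.mem_sdiff, Finset.mem_filter, Finset.mem_insert, Finset.mem_singleton,
    not_or] at hv'
  obtain ⟨⟨hvS, hxv⟩, hvy, hvu⟩ := hv'
  have hN : S.filter (G.Adj x) ⊆ {y, u, v} := by
    intro z hz
    by_cases h : z ∈ ({y, u} : Finset V)
    · simp only [Finset.mem_insert, Finset.mem_singleton] at h ⊢; tauto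
    · have : z ∈ (S.filter (G.Adj x)) \ {y, u} := Finset.mem_sdiff.2 ⟨hz, h⟩
      rw [hv] at this
      simp only [Finset.mem_singleton] at this
      simp [this]
  have huv := ky_c3 IH hcrit hS hp hx hyS huS hvS hyu (Ne.symm hvy) (Ne.symm hvu) hxy hxu hxv hN
    hdy.le
  have hyv := ky_c3 IH hcrit hS hp hx huS hyS hvS hyu.symm (Ne.symm hvu) (Ne.symm hvy) hxu hxy hxv
    (hN.trans (by intro z; simp; tauto)) hdu.le
  have hTcard : ({x, y, u, v} : Finset V).card = 4 := by
    rw [Finset.card_insert_of_notMem, Finset.card_insert_of_notMem, Finset.card_pair (Ne.symm hvu)]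
    · simp [hyu, Ne.symm hvy]
    · simp [hxy.ne, hxu.ne, hxv.ne]
  have hTS : ({x, y, u, v} : Finset V) ⊆ S := by
    intro z hz
    simp only [Finset.mem_insert, Finset.mem_singleton] at hz
    rcases hz with rfl | rfl | rfl | rfl <;> assumption
  rcases hTS.eq_or_ssubset with heq | hss
  · have : S.card * 3 ≤ cr G S S := by
      rw [← smul_eq_mul]
      exact Finset.card_nsmul_le_sum _ _ _ (fun z hz => ky_min hcrit hS hz)
    rw [heq] at hTcard
    unfold pot at hp
    omega
  · have h1 := ky_c1 IH hcrit hS hp hss (by omega)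
    have e1 : v ∉ (∅ : Finset V) := by simp
    have e2 : u ∉ insert v (∅ : Finset V) := by simp [Ne.symm hvu]
    have e3 : y ∉ insert u (insert v (∅ : Finset V)) := by simp [hyu, Ne.symm hvy]
    have e4 : x ∉ insert y (insert u (insert v (∅ : Finset V))) := by simp [hxy.ne, hxu.ne, hxv.ne]
    have d4 : 3 ≤ dg G (insert y (insert u (insert v (∅ : Finset V)))) x := by
      unfold dg
      rw [Finset.filter_true_of_mem]
      · rw [Finset.card_insert_of_notMem e3, Finset.card_insert_of_notMem e2]; simp
      · intro z hz; simp at hz; rcases hz with rfl | rfl | rfl <;> assumption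
    have d3 : 1 ≤ dg G (insert u (insert v (∅ : Finset V))) y :=
      Finset.card_pos.2 ⟨v, by simp [hyv]⟩
    have d2 : 1 ≤ dg G (insert v (∅ : Finset V)) u :=
      Finset.card_pos.2 ⟨v, by simp [huv]⟩
    have c2 := cr_insert_self (G := G) e2
    have c3 := cr_insert_self (G := G) e3
    have c4 := cr_insert_self (G := G) e4
    simp only [insert_empty_eq] at c2 c3 c4 d2 d3 d4
    unfold pot at h1
    omega

lemma ky_crit {S : Finset V} (IH : KYIH S.card) (hcrit : ∀ R, R ⊂ S → ColOn G R)
    (hS : ¬ ColOn G S) : pot G S ≤ 4 := by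
  by_contra hp
  push Not at hp
  set L := S.filter (fun z => dg G S z = 3) with hL
  set B := S.filter (fun z => ¬ dg G S z = 3) with hB
  have hLB : Disjoint L B := Finset.disjoint_filter_filter_not _ _ _
  have hU : L ∪ B = S := Finset.filter_union_filter_not_eq _ _
  have h1 : L.card * 2 ≤ cr G L B := by
    rw [← smul_eq_mul]
    refine Finset.card_nsmul_le_sum _ _ _ (fun z hz => ?_)
    obtain ⟨hzS, hz3⟩ := Finset.mem_filter.1 hz
    have h4 := ky_c4 IH hcrit hS hp hzS hz3
    have h5 := dg_union (G := G) hLB z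
    rw [hU, hz3] at h5
    rw [← hL] at h4
    omega
  have h2 : cr G L B ≤ cr G B S := by
    rw [cr_comm]; exact cr_mono_right (Finset.filter_subset _ _)
  have h3 : cr G S S = cr G L S + cr G B S := by
    conv_lhs => rw [← hU]
    rw [cr_union_left hLB, hU]
  have h4 : cr G L S = L.card * 3 := by
    unfold cr
    rw [Finset.sum_const_nat]
    intro z hz
    exact (Finset.mem_filter.1 hz).2
  have h5 : B.card * 4 ≤ cr G B S := by
    rw [← smul_eq_mul]
    refine Finset.card_nsmul_le_sum _ _ _ (fun z hz => ?_)
    obtain ⟨hzS, hz3⟩ := Finset.mem_filter.1 hz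
    have := ky_min hcrit hS hzS
    omega
  have h6 : S.card = L.card + B.card := by rw [← hU, Finset.card_union_of_disjoint hLB]
  unfold pot at hp
  omega

end KY2

theorem ky : ∀ (n : ℕ), KYIH n := by
  intro n
  induction n with
  | zero => intro W H T h; omega
  | succ n ih =>
    intro W H T hT hc
    obtain ⟨M, hM, hmin⟩ := Finset.exists_min_image
      (T.powerset.filter (fun R => ¬ ColOn H R)) Finset.card ⟨T, by simp [hc]⟩
    simp only [Finset.mem_filter, Finset.mem_powerset] at hM hmin
    refine ⟨M, hM.1, hM.2, ky_crit ?_ ?_ hM.2⟩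
    · intro W' H' T' hT'
      have := Finset.card_le_card hM.1
      exact ih W' H' T' (by omega)
    · intro R hR
      by_contra h
      have := hmin R ⟨hR.1.trans hM.1, h⟩
      have := Finset.card_lt_card hR
      omega

/-- Kostochka-Yancey for `k = 4` -/
theorem ky_main {V : Type} (G : SimpleGraph V) (T : Finset V) (h : ¬ ColOn G T) :
    ∃ R ⊆ T, ¬ ColOn G R ∧ 10 * (R.card : ℤ) - 3 * (cr G R R : ℤ) ≤ 4 :=
  ky _ V G T (Nat.lt_succ_self _) h

end TorusThree

namespace TorusThree

open scoped Classical

/-! ### Part B: algebraic duals and minors -/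

/-- antisymmetric functions supported on darts -/
def IsChain {V : Type} (G : SimpleGraph V) (c : V → V → ℚ) : Prop :=
  (∀ v w, c v w = - c w v) ∧ (∀ v w, ¬ G.Adj v w → c v w = 0)

/-- divergence free chains -/
def IsFlow {V : Type} [Fintype V] (G : SimpleGraph V) (c : V → V → ℚ) : Prop :=
  IsChain G c ∧ ∀ v, ∑ w, c v w = 0

/-- the chain of a potential on faces -/
def dl {V F : Type} (G : SimpleGraph V) (f : V → V → F) (s : F → ℚ) (v w : V) : ℚ :=
  if G.Adj v w then s (f v w) - s (f w v) else 0

/-- `f` assigns to each dart its left face, in such a way that flows are exactly the coboundaries -/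
structure IsDual {V F : Type} [Fintype V] (G : SimpleGraph V) (f : V → V → F) : Prop where
  flow : ∀ (s : F → ℚ) (v : V), ∑ w, dl G f s v w = 0
  pot : ∀ c, IsFlow G c → ∃ s : F → ℚ, ∀ v w, G.Adj v w → c v w = s (f v w) - s (f w v)

def HasDual {V : Type} [Fintype V] (G : SimpleGraph V) : Prop :=
  ∃ (F : Type) (_ : Finite F) (f : V → V → F), IsDual G f

lemma dl_chain {V F : Type} (G : SimpleGraph V) (f : V → V → F) (s : F → ℚ) :
    IsChain G (dl G f s) := by
  refine ⟨fun v w => ?_, fun v w h => by simp [dl, h]⟩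
  unfold dl
  by_cases h : G.Adj v w
  · simp [h, h.symm]
  · have : ¬ G.Adj w v := fun h' => h h'.symm
    simp [h, this]

lemma IsDual.isFlow {V F : Type} [Fintype V] {G : SimpleGraph V} {f : V → V → F}
    (h : IsDual G f) (s : F → ℚ) : IsFlow G (dl G f s) := ⟨dl_chain G f s, h.flow s⟩

lemma IsDual.exists_dl {V F : Type} [Fintype V] {G : SimpleGraph V} {f : V → V → F}
    (h : IsDual G f) {c : V → V → ℚ} (hc : IsFlow G c) : ∃ s : F → ℚ, c = dl G f s := by
  obtain ⟨s, hs⟩ := h.pot c hc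
  refine ⟨s, ?_⟩
  ext v w
  by_cases h : G.Adj v w
  · simp [dl, h, hs v w h]
  · simp [dl, h, hc.1.2 v w h]

/-- `e` is the divergence of a chain of `K` -/
def IsDiv {V : Type} [Fintype V] (K : SimpleGraph V) (e : V → ℚ) : Prop :=
  ∃ d, IsChain K d ∧ ∀ v, ∑ w, d v w = e v

section
variable {V : Type} [Fintype V] {K : SimpleGraph V}

lemma IsChain.add {c d : V → V → ℚ} (hc : IsChain K c) (hd : IsChain K d) :
    IsChain K (fun v w => c v w + d v w) :=
  ⟨fun v w => by beta_reduce; rw [hc.1, hd.1]; ring,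
    fun v w h => by beta_reduce; rw [hc.2 _ _ h, hd.2 _ _ h]; ring⟩

lemma IsChain.smul {c : V → V → ℚ} (hc : IsChain K c) (t : ℚ) :
    IsChain K (fun v w => t * c v w) :=
  ⟨fun v w => by beta_reduce; rw [hc.1]; ring, fun v w h => by beta_reduce; rw [hc.2 _ _ h]; ring⟩

lemma IsDiv.zero : IsDiv K 0 := ⟨fun _ _ => 0, ⟨by simp, by simp⟩, by simp⟩

lemma IsDiv.add {e e' : V → ℚ} (h : IsDiv K e) (h' : IsDiv K e') : IsDiv K (e + e') := by
  obtain ⟨d, hd, h⟩ := h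
  obtain ⟨d', hd', h'⟩ := h'
  exact ⟨_, hd.add hd', fun v => by rw [Finset.sum_add_distrib, h, h']; rfl⟩

lemma IsDiv.smul {e : V → ℚ} (h : IsDiv K e) (t : ℚ) : IsDiv K (t • e) := by
  obtain ⟨d, hd, h⟩ := h
  exact ⟨_, hd.smul t, fun v => by rw [← Finset.mul_sum, h]; rfl⟩

lemma IsDiv.sum {ι : Type} {s : Finset ι} {e : ι → V → ℚ} (h : ∀ i ∈ s, IsDiv K (e i)) :
    IsDiv K (∑ i ∈ s, e i) := by
  induction s using Finset.induction_on with
  | empty => simpa using IsDiv.zero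
  | insert i s hi ih =>
    rw [Finset.sum_insert hi]
    exact (h i (Finset.mem_insert_self _ _)).add (ih fun j hj => h j (Finset.mem_insert_of_mem hj))

/-- unit chain on a dart -/
def dart (a b v w : V) : ℚ :=
  (if v = a ∧ w = b then 1 else 0) - (if v = b ∧ w = a then 1 else 0)

lemma dart_chain {a b : V} (h : K.Adj a b) : IsChain K (dart a b) := by
  refine ⟨fun v w => ?_, fun v w hvw => ?_⟩
  · unfold dart
    simp only [and_comm (a := v = a), and_comm (a := v = b)]; ring
  · unfold dart
    rw [if_neg, if_neg]
    · ring
    · rintro ⟨rfl, rfl⟩; exact hvw h.symm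
    · rintro ⟨rfl, rfl⟩; exact hvw h

lemma sum_dart (a b v : V) :
    ∑ w, dart a b v w = (if v = a then 1 else 0) - (if v = b then 1 else 0) := by
  unfold dart
  rw [Finset.sum_sub_distrib]
  congr 1 <;> simp [ite_and]

lemma isDiv_of_reachable {a b : V} (h : K.Reachable a b) :
    IsDiv K (Pi.single a 1 - Pi.single b 1) := by
  obtain ⟨p⟩ := h
  induction p with
  | nil => simpa using IsDiv.zero
  | @cons u v w huv p ih =>
    have h1 : IsDiv K (Pi.single u 1 - Pi.single v 1) := by
      refine ⟨dart u v, dart_chain huv, fun z => ?_⟩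
      rw [sum_dart]
      simp [Pi.single_apply]
    have := h1.add ih
    simpa using this

lemma isDiv_of_classes {V' : Type} (β : V → Option V') (e : V → ℚ)
    (hcon : ∀ v w, β v = β w → β v ≠ none → K.Reachable v w)
    (h0 : ∀ v, β v = none → e v = 0)
    (hs : ∀ x, ∑ v, (if β v = some x then e v else 0) = 0) : IsDiv K e := by
  have hrep : ∃ rep : V → V, (∀ v, β (rep v) = β v) ∧ ∀ v w, β v = β w → rep v = rep w := by
    refine ⟨fun v => Classical.choose (⟨v, rfl⟩ : ∃ w, β w = β v),
      fun v => Classical.choose_spec (⟨v, rfl⟩ : ∃ w, β w = β v), fun v w h => ?_⟩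
    simp only [h]
  obtain ⟨rep, hr1, hr2⟩ := hrep
  have h1 : IsDiv K (∑ v, e v • (Pi.single v 1 - Pi.single (rep v) 1 : V → ℚ)) := by
    apply IsDiv.sum
    intro v _
    by_cases hv : β v = none
    · rw [h0 v hv, zero_smul]; exact IsDiv.zero
    · exact (isDiv_of_reachable (hcon v (rep v) (hr1 v).symm hv)).smul _
  convert h1 using 1
  ext z
  simp only [Finset.sum_apply, Pi.smul_apply, Pi.sub_apply, smul_eq_mul, mul_sub,
    Finset.sum_sub_distrib]
  have e1 : ∑ v, e v * (Pi.single v 1 : V → ℚ) z = e z := by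
    simp [Pi.single_apply]
  have e2 : ∑ v, e v * (Pi.single (rep v) 1 : V → ℚ) z = 0 := by
    by_cases hz : ∃ v0, rep v0 = z ∧ β v0 ≠ none
    · obtain ⟨v0, rfl, hv0⟩ := hz
      obtain ⟨x, hx⟩ := Option.ne_none_iff_exists'.1 hv0
      rw [← hs x]
      apply Finset.sum_congr rfl
      intro v _
      by_cases hv : β v = some x
      · rw [hr2 v v0 (hv.trans hx.symm)]; simp [hv]
      · have : rep v0 ≠ rep v := by
          intro h
          apply hv
          rw [← hr1 v, ← h, hr1, hx]
        simp [hv, Pi.single_apply, this]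
    · push Not at hz
      apply Finset.sum_eq_zero
      intro v _
      by_cases hv : rep v = z
      · rw [h0 v (hz v hv)]; ring
      · simp [Pi.single_apply, Ne.symm hv]
  rw [e1, e2, sub_zero]

lemma sum_antisymm (B : Finset V) {c : V → V → ℚ} (hc : ∀ v w, c v w = - c w v) :
    ∑ v ∈ B, ∑ w ∈ B, c v w = 0 := by
  have h : ∑ v ∈ B, ∑ w ∈ B, c v w = - ∑ v ∈ B, ∑ w ∈ B, c v w := by
    conv_lhs => rw [Finset.sum_comm]
    rw [← Finset.sum_neg_distrib]
    refine Finset.sum_congr rfl fun v _ => ?_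
    rw [← Finset.sum_neg_distrib]
    exact Finset.sum_congr rfl fun w _ => hc _ _
  linarith

end

/-- graph of edges inside branch sets -/
def innerG {V V' : Type} (G : SimpleGraph V) (β : V → Option V') : SimpleGraph V where
  Adj a b := G.Adj a b ∧ β a = β b ∧ β a ≠ none
  symm := ⟨fun _ _ h => ⟨h.1.symm, h.2.1.symm, h.2.1 ▸ h.2.2⟩⟩
  loopless := ⟨fun _ h => G.irrefl h.1⟩

/-- Minors of graphs with a dual have a dual. -/
theorem HasDual.minor {V V' : Type} [Fintype V] [Fintype V'] {G : SimpleGraph V}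
    {H : SimpleGraph V'} (hG : HasDual G) (β : V → Option V') (p : V' → V' → V)
    (hcon : ∀ v w, β v = β w → β v ≠ none → (innerG G β).Reachable v w)
    (hp : ∀ x y, H.Adj x y → β (p x y) = some x ∧ G.Adj (p x y) (p y x)) : HasDual H := by
  obtain ⟨F, hF, f, hd⟩ := hG
  -- type 3 edges
  let r : F → F → Prop := fun i j => ∃ v w, G.Adj v w ∧ ¬ (innerG G β).Adj v w ∧
    (∀ x y, H.Adj x y → ¬ (v = p x y ∧ w = p y x)) ∧ i = f v w ∧ j = f w v
  refine ⟨Quot r, Quot.finite r, fun x y => Quot.mk r (f (p x y) (p y x)), ⟨?_, ?_⟩⟩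
  · intro s' x
    set s : F → ℚ := fun i => s' (Quot.mk r i) with hs
    have hfl := hd.isFlow s
    set g := dl G f s with hg
    have h3 : ∀ v w, ¬ (innerG G β).Adj v w → (∀ x y, H.Adj x y → ¬ (v = p x y ∧ w = p y x)) →
        g v w = 0 := by
      intro v w h1 h2
      by_cases h : G.Adj v w
      · have : s (f v w) = s (f w v) := by
          simp only [hs]
          rw [Quot.sound (⟨v, w, h, h1, h2, rfl, rfl⟩ : r (f v w) (f w v))]
        simp [hg, dl, h, this]
      · simp [hg, dl, h]
    set B : Finset V := Finset.univ.filter (fun v => β v = some x) with hB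
    have e0 : ∑ v ∈ B, ∑ w, g v w = 0 := Finset.sum_eq_zero fun v _ => hfl.2 v
    have e1 : ∑ v ∈ B, ∑ w, g v w = ∑ v ∈ B, ∑ w ∈ B, g v w + ∑ v ∈ B, ∑ w ∈ Bᶜ, g v w := by
      rw [← Finset.sum_add_distrib]
      exact Finset.sum_congr rfl fun v _ => (Finset.sum_add_sum_compl B _).symm
    rw [e0, sum_antisymm B hfl.1.1, zero_add] at e1
    rw [e1, ← Finset.sum_product']
    have hL : ∑ y, dl H (fun x y => Quot.mk r (f (p x y) (p y x))) s' x y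
        = ∑ y ∈ Finset.univ.filter (fun y => H.Adj x y), g (p x y) (p y x) := by
      rw [Finset.sum_filter]
      refine Finset.sum_congr rfl fun y _ => ?_
      by_cases h : H.Adj x y
      · simp [dl, h, hg, hs, (hp x y h).2]
      · simp [dl, h]
    rw [hL]
    have hinj : Set.InjOn (fun y => (p x y, p y x))
        (Finset.univ.filter (fun y => H.Adj x y) : Finset V') := by
      intro y hy y' hy' h
      simp only [Finset.coe_filter, Finset.mem_univ, true_and, Set.mem_ofPred_eq] at hy hy'
      have h1 := (hp y x hy.symm).1
      have h2 := (hp y' x hy'.symm).1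
      simp only [Prod.mk.injEq] at h
      rw [h.2, h2] at h1
      exact (Option.some.inj h1).symm
    rw [← Finset.sum_image (f := fun q : V × V => g q.1 q.2) hinj]
    apply Finset.sum_subset
    · intro q hq
      obtain ⟨y, hy, rfl⟩ := Finset.mem_image.1 hq
      simp only [Finset.mem_filter, Finset.mem_univ, true_and] at hy
      simp only [hB, Finset.mem_product, Finset.mem_filter, Finset.mem_univ, true_and,
        Finset.mem_compl]
      refine ⟨(hp x y hy).1, ?_⟩
      rw [(hp y x hy.symm).1]
      intro h
      exact hy.ne (Option.some.inj h).symm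
    · rintro ⟨v, w⟩ hq hq'
      simp only [hB, Finset.mem_product, Finset.mem_filter, Finset.mem_univ, true_and,
        Finset.mem_compl] at hq
      apply h3
      · rintro ⟨_, h, _⟩
        exact hq.2 (h ▸ hq.1)
      · rintro x' y' hxy' ⟨rfl, rfl⟩
        have h1 := (hp x' y' hxy').1
        rw [hq.1] at h1
        obtain rfl := Option.some.inj h1
        apply hq'
        exact Finset.mem_image.2 ⟨y', by simp [hxy'], rfl⟩
  · intro c' hc'
    set c0 : V → V → ℚ := fun v w => ∑ x, ∑ y,
      if H.Adj x y ∧ v = p x y ∧ w = p y x then c' x y else 0 with hc0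
    have hanti : ∀ v w, c0 v w = - c0 w v := by
      intro v w
      simp only [hc0]
      rw [Finset.sum_comm, ← Finset.sum_neg_distrib]
      refine Finset.sum_congr rfl fun x _ => ?_
      rw [← Finset.sum_neg_distrib]
      refine Finset.sum_congr rfl fun y _ => ?_
      by_cases h : H.Adj x y ∧ w = p x y ∧ v = p y x
      · rw [if_pos h, if_pos ⟨h.1.symm, h.2.2, h.2.1⟩, hc'.1.1]
      · rw [if_neg h, if_neg, neg_zero]
        rintro ⟨h1, h2, h3⟩
        exact h ⟨h1.symm, h3, h2⟩
    have hzero : ∀ v w, (∀ x y, H.Adj x y → ¬ (v = p x y ∧ w = p y x)) → c0 v w = 0 := by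
      intro v w h
      simp only [hc0]
      refine Finset.sum_eq_zero fun x _ => Finset.sum_eq_zero fun y _ => if_neg ?_
      rintro ⟨h1, h2⟩
      exact h x y h1 h2
    have hval : ∀ x y, H.Adj x y → c0 (p x y) (p y x) = c' x y := by
      intro x y h
      simp only [hc0]
      rw [Finset.sum_eq_single x, Finset.sum_eq_single y]
      · simp [h]
      · intro y' _ hy'
        refine if_neg ?_
        rintro ⟨h1, _, h3⟩
        have h4 := (hp y x h.symm).1
        rw [h3, (hp y' x h1.symm).1] at h4
        exact hy' (Option.some.inj h4)
      · simp
      · intro x' _ hx'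
        refine Finset.sum_eq_zero fun y' _ => if_neg ?_
        rintro ⟨h1, h2, _⟩
        have h4 := (hp x y h).1
        rw [h2, (hp x' y' h1).1] at h4
        exact hx' (Option.some.inj h4)
      · simp
    have hexc : ∀ v, ∑ w, c0 v w = ∑ x, ∑ y, if H.Adj x y ∧ v = p x y then c' x y else 0 := by
      intro v
      simp only [hc0]
      rw [Finset.sum_comm]
      refine Finset.sum_congr rfl fun x _ => ?_
      rw [Finset.sum_comm]
      refine Finset.sum_congr rfl fun y _ => ?_
      by_cases h : H.Adj x y ∧ v = p x y
      · rw [if_pos h]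
        simp [h.1, h.2]
      · rw [if_neg h]
        refine Finset.sum_eq_zero fun w _ => if_neg ?_
        rintro ⟨h1, h2, _⟩
        exact h ⟨h1, h2⟩
    obtain ⟨d, hdc, hdd⟩ : IsDiv (innerG G β) (fun v => - ∑ w, c0 v w) := by
      refine isDiv_of_classes β _ hcon ?_ ?_
      · intro v hv
        rw [hexc, neg_eq_zero]
        refine Finset.sum_eq_zero fun x _ => Finset.sum_eq_zero fun y _ => if_neg ?_
        rintro ⟨h1, rfl⟩
        rw [(hp x y h1).1] at hv
        simp at hv
      · intro x
        have : ∀ v, (if β v = some x then - ∑ w, c0 v w else 0)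
            = - ∑ y, if H.Adj x y ∧ v = p x y then c' x y else 0 := by
          intro v
          split_ifs with hv
          · rw [hexc, Finset.sum_eq_single x]
            · intro x' _ hx'
              refine Finset.sum_eq_zero fun y _ => if_neg ?_
              rintro ⟨h1, rfl⟩
              rw [(hp x' y h1).1] at hv
              exact hx' (Option.some.inj hv)
            · simp
          · symm
            rw [neg_eq_zero]
            refine Finset.sum_eq_zero fun y _ => if_neg ?_
            rintro ⟨h1, rfl⟩
            exact hv (hp x y h1).1
        simp only [this]
        rw [Finset.sum_neg_distrib, neg_eq_zero, Finset.sum_comm]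
        refine Eq.trans ?_ (hc'.2 x)
        refine Finset.sum_congr rfl fun y _ => ?_
        by_cases h : H.Adj x y
        · simp [h]
        · simp [h, hc'.1.2 x y h]
    have hfl : IsFlow G (fun v w => c0 v w + d v w) := by
      refine ⟨⟨fun v w => by beta_reduce; rw [hanti, hdc.1]; ring,
        fun v w h => ?_⟩, fun v => ?_⟩
      · beta_reduce
        rw [hzero, hdc.2]
        · ring
        · exact fun h' => h h'.1
        · rintro x y hxy ⟨rfl, rfl⟩
          exact h (hp x y hxy).2
      · rw [Finset.sum_add_distrib, hdd]; ring
    obtain ⟨s, hs⟩ := hd.pot _ hfl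
    have hlift : ∀ i j, r i j → s i = s j := by
      rintro i j ⟨v, w, h1, h2, h3, rfl, rfl⟩
      have := hs v w h1
      rw [hzero v w h3, hdc.2 v w h2] at this
      linarith
    refine ⟨Quot.lift s hlift, fun x y hxy => ?_⟩
    have h1 := hs _ _ (hp x y hxy).2
    rw [hval x y hxy, hdc.2, add_zero] at h1
    · exact h1
    · rintro ⟨_, h, _⟩
      rw [(hp x y hxy).1, (hp y x hxy.symm).1] at h
      exact hxy.ne (Option.some.inj h)

end TorusThree

namespace TorusThree

open scoped Classical

/-! ### Part C: adding a chord, merging, pendant edges -/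

section
variable {V : Type} [Fintype V] {G : SimpleGraph V}

lemma IsDual.chord {F : Type} {f : V → V → F} (hd : IsDual G f) {a b c : V}
    (hab : G.Adj a b) (hbc : G.Adj b c) (hac : a ≠ c) (hnac : ¬ G.Adj a c)
    (hf : f a b = f b c) :
    ∃ f' : V → V → Option F, IsDual (G ⊔ SimpleGraph.edge a c) f' := by
  set G' := G ⊔ SimpleGraph.edge a c with hG'
  have hadj : ∀ v w, G'.Adj v w ↔ G.Adj v w ∨ ((v = a ∧ w = c) ∨ (v = c ∧ w = a)) := by
    intro v w
    simp only [hG', SimpleGraph.sup_adj, SimpleGraph.edge_adj]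
    constructor
    · rintro (h | h)
      · exact Or.inl h
      · exact Or.inr h.1
    · rintro (h | ⟨rfl, rfl⟩ | ⟨rfl, rfl⟩)
      · exact Or.inl h
      · exact Or.inr ⟨Or.inl ⟨rfl, rfl⟩, hac⟩
      · exact Or.inr ⟨Or.inr ⟨rfl, rfl⟩, hac.symm⟩
  have hnca : ¬ G.Adj c a := fun h => hnac h.symm
  set f' : V → V → Option F := fun v w =>
    if (v = a ∧ w = b) ∨ (v = b ∧ w = c) ∨ (v = c ∧ w = a) then none
    else if v = a ∧ w = c then some (f a b) else some (f v w) with hf'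
  set tri : V → V → ℚ := fun v w => dart a b v w + dart b c v w + dart c a v w with htri
  have hsum : ∀ v, ∑ w, tri v w = 0 := by
    intro v
    simp only [htri, Finset.sum_add_distrib, sum_dart]
    ring
  have htc : IsChain G' tri := by
    refine ((dart_chain ?_).add (dart_chain ?_)).add (dart_chain ?_)
    · exact (hadj _ _).2 (Or.inl hab)
    · exact (hadj _ _).2 (Or.inl hbc)
    · exact (hadj _ _).2 (Or.inr (Or.inr ⟨rfl, rfl⟩))
  have key : ∀ (s' : Option F → ℚ) v w, dl G' f' s' v w =
      dl G f (fun j => s' (some j)) v w + (s' none - s' (some (f a b))) * tri v w := by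
    intro s' v w
    have n1 := hab.ne
    have n2 := hbc.ne
    by_cases va : v = a
    · subst va
      by_cases wb : w = b
      · subst wb
        simp [dl, hadj, hab, hf', htri, dart, n1, n2, hac, n1.symm, n2.symm, hac.symm]
      · by_cases wc : w = c
        · subst wc
          simp [dl, hadj, hab, hf', htri, dart, n1, n2, hac, n1.symm, n2.symm, hac.symm, hnac]
        · by_cases h : G.Adj v w <;>
          simp [dl, hadj, hab, hf', htri, dart, n1, n2, hac, n1.symm, n2.symm, hac.symm, h, wb, wc]
    · by_cases vb : v = b
      · subst vb
        by_cases wa : w = a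
        · subst wa
          simp [dl, hadj, hab, hf', htri, dart, n1, n2, hac, n1.symm, n2.symm, hac.symm, hab.symm]
        · by_cases wc : w = c
          · subst wc
            simp [dl, hadj, hf', htri, dart, n1, n2, hac, n1.symm, n2.symm, hac.symm, hbc, hf]
          · by_cases h : G.Adj v w <;>
            simp [dl, hadj, hf', htri, dart, n1, n2, n1.symm, n2.symm, h, wa, wc]
      · by_cases vc : v = c
        · subst vc
          by_cases wa : w = a
          · subst wa
            simp [dl, hadj, hf', htri, dart, n1, n2, hac, n1.symm, n2.symm, hac.symm, hnca]
          · by_cases wb : w = b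
            · subst wb
              simp [dl, hadj, hf', htri, dart, n1, n2, hac, n1.symm, n2.symm, hac.symm, hbc.symm,
                hf]
            · by_cases h : G.Adj v w <;>
              simp [dl, hadj, hf', htri, dart, n2, hac, n2.symm, hac.symm, h, wa, wb]
        · by_cases h : G.Adj v w <;>
          simp [dl, hadj, hf', htri, dart, h, va, vb, vc]
  refine ⟨f', ⟨fun s' v => ?_, fun c' hc' => ?_⟩⟩
  · simp only [key, Finset.sum_add_distrib, ← Finset.mul_sum, hsum, hd.flow]
    ring
  · set t := c' c a with ht
    have htri1 : tri c a = 1 := by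
      simp [htri, dart, hab.ne, hbc.ne, hac, hbc.ne.symm, hac.symm]
    have hfl : IsFlow G (fun v w => c' v w + (-t) * tri v w) := by
      have hch := hc'.1.add (htc.smul (-t))
      refine ⟨⟨hch.1, fun v w h => ?_⟩, fun v => ?_⟩
      · by_cases h' : G'.Adj v w
        · rcases (hadj v w).1 h' with h1 | ⟨rfl, rfl⟩ | ⟨rfl, rfl⟩
          · exact absurd h1 h
          · rw [hch.1]; beta_reduce; rw [htri1]; ring
          · beta_reduce; rw [htri1]; ring
        · exact hch.2 v w h'
      · rw [Finset.sum_add_distrib, ← Finset.mul_sum, hsum, hc'.2]; ring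
    obtain ⟨s, hs⟩ := hd.exists_dl hfl
    set s' : Option F → ℚ := fun o => Option.elim o (s (f a b) + t) s with hs'
    refine ⟨s', fun v w h => ?_⟩
    have h1 := key s' v w
    have h2 : c' v w + (-t) * tri v w = dl G f s v w := congrFun (congrFun hs v) w
    have h3 : (fun j => s' (some j)) = s := rfl
    rw [h3, ← h2] at h1
    have h4 : s' none = s (f a b) + t := rfl
    have h5 : s' (some (f a b)) = s (f a b) := rfl
    rw [h4, h5, dl, if_pos h] at h1
    rw [h1]
    ring

/-- merging the ends of a 2-path around a face -/
theorem HasDual.merge {F : Type} [Finite F] {f : V → V → F} (hd : IsDual G f) {a b c : V}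
    (hab : G.Adj a b) (hbc : G.Adj b c) (hac : a ≠ c) (hnac : ¬ G.Adj a c)
    (hf : f a b = f b c) :
    HasDual ((mergeG G a c).comap (Subtype.val : {z // z ≠ c} → V)) := by
  obtain ⟨f', hd'⟩ := hd.chord hab hbc hac hnac hf
  have hG' : HasDual (G ⊔ SimpleGraph.edge a c) := ⟨_, inferInstance, f', hd'⟩
  have hca : (G ⊔ SimpleGraph.edge a c).Adj a c := Or.inr (by simp [SimpleGraph.edge_adj, hac])
  have hle : ∀ v w, G.Adj v w → (G ⊔ SimpleGraph.edge a c).Adj v w := fun v w h => Or.inl h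
  refine hG'.minor (fun z => if h : z = c then some ⟨a, hac⟩ else some ⟨z, h⟩)
    (fun x y => if x.1 = a then (if G.Adj a y.1 then a else c) else x.1) ?_ ?_
  · have hr : (innerG (G ⊔ SimpleGraph.edge a c) (fun z => if h : z = c then
        some (⟨a, hac⟩ : {z // z ≠ c}) else some ⟨z, h⟩)).Adj a c := by
      refine ⟨hca, ?_, ?_⟩
      · simp [hac]
      · simp [hac]
    intro v w hvw _
    by_cases hv : v = c <;> by_cases hw : w = c
    · subst hv; subst hw; exact SimpleGraph.Reachable.refl _
    · subst hv
      simp only [hw, dif_pos, dif_neg, not_false_eq_true, Option.some.injEq, Subtype.mk.injEq] at hvw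
      subst hvw
      exact hr.reachable.symm
    · subst hw
      simp only [hv, dif_pos, dif_neg, not_false_eq_true, Option.some.injEq, Subtype.mk.injEq] at hvw
      subst hvw
      exact hr.reachable
    · simp only [hv, hw, dif_neg, not_false_eq_true, Option.some.injEq, Subtype.mk.injEq] at hvw
      subst hvw
      exact SimpleGraph.Reachable.refl _
  · rintro ⟨x, hx⟩ ⟨y, hy⟩ ⟨hne, h⟩
    simp only at hne h
    by_cases hxa : x = a
    · subst hxa
      have hya : y ≠ x := Ne.symm hne
      simp only [hya, if_true, if_false]
      by_cases h1 : G.Adj x y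
      · simp only [h1, if_true]
        exact ⟨by simp [hac], hle _ _ h1⟩
      · simp only [h1, if_false]
        refine ⟨by simp, hle _ _ ?_⟩
        rcases h with h | ⟨_, h⟩ | ⟨h, _⟩
        · exact absurd h h1
        · exact h
        · exact absurd h hya
    · simp only [hxa, if_false]
      refine ⟨by simp [hx], ?_⟩
      by_cases hya : y = a
      · subst hya
        simp only [if_true]
        by_cases h1 : G.Adj y x
        · simp only [h1, if_true]
          exact hle _ _ h1.symm
        · simp only [h1, if_false]
          refine hle _ _ ?_
          rcases h with h | ⟨h, _⟩ | ⟨_, h⟩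
          · exact absurd h.symm h1
          · exact absurd h hxa
          · exact h
      · simp only [hya, if_false]
        refine hle _ _ ?_
        rcases h with h | ⟨h, _⟩ | ⟨h, _⟩
        · exact h
        · exact absurd h hxa
        · exact absurd h hya

theorem HasDual.mono {H : SimpleGraph V} (hG : HasDual G) (h : H ≤ G) : HasDual H := by
  refine hG.minor some (fun x _ => x) ?_ ?_
  · intro v w hvw _
    rw [Option.some.inj hvw]
  · intro x y hxy
    exact ⟨rfl, h hxy⟩

/-- add a pendant vertex -/
def pendG (G : SimpleGraph V) (b : V) : SimpleGraph (Option V) where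
  Adj p q := match p, q with
    | some x, some y => G.Adj x y
    | some x, none => x = b
    | none, some x => x = b
    | none, none => False
  symm := ⟨by
    rintro (_ | a) (_ | b) h
    · exact h
    · exact h
    · exact h
    · exact G.adj_symm h⟩
  loopless := ⟨by rintro (_ | a) h; exacts [h, G.irrefl h]⟩

theorem HasDual.pend (hG : HasDual G) (b : V) : HasDual (pendG G b) := by
  obtain ⟨F, _, f, hd⟩ := hG
  have a1 : ∀ x y, (pendG G b).Adj (some x) (some y) ↔ G.Adj x y := fun _ _ => Iff.rfl
  have a2 : ∀ x, (pendG G b).Adj (some x) none ↔ x = b := fun _ => Iff.rfl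
  have a3 : ∀ x, (pendG G b).Adj none (some x) ↔ x = b := fun _ => Iff.rfl
  refine ⟨Option F, inferInstance, fun p q => match p, q with
    | some x, some y => some (f x y)
    | _, _ => none, ⟨?_, ?_⟩⟩
  · intro s v
    rw [Fintype.sum_option]
    rcases v with _ | v
    · simp [dl]
    · have := hd.flow (fun j => s (some j)) v
      simpa [dl, a1] using this
  · intro c hc
    have h0 : c none (some b) = 0 := by
      have := hc.2 none
      rw [Fintype.sum_option, Finset.sum_eq_single b] at this
      · rw [hc.1.2 none none (fun h => h)] at this
        linarith
      · intro x _ hx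
        exact hc.1.2 _ _ (fun h => hx h)
      · simp
    have h1 : ∀ x, c (some x) none = 0 := by
      intro x
      by_cases hx : x = b
      · subst hx; rw [hc.1.1, h0, neg_zero]
      · exact hc.1.2 _ _ (fun h => hx h)
    have hfl : IsFlow G (fun x y => c (some x) (some y)) := by
      refine ⟨⟨fun x y => hc.1.1 _ _, fun x y h => hc.1.2 _ _ h⟩, fun x => ?_⟩
      have := hc.2 (some x)
      rw [Fintype.sum_option, h1] at this
      linarith
    obtain ⟨s, hs⟩ := hd.pot _ hfl
    refine ⟨fun o => o.elim 0 s, ?_⟩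
    rintro (_ | x) (_ | y) h
    · exact absurd h (SimpleGraph.irrefl _)
    · rw [hc.1.1, h1]; simp
    · rw [h1]; simp
    · exact hs x y h

end
end TorusThree

namespace TorusThree

open scoped Classical

/-! ### Part D: the Euler inequality -/

/-- `a b c d` is a quadrangular face `i` -/
structure QF {V F : Type} (G : SimpleGraph V) (f : V → V → F) (i : F) (a b c d : V) : Prop where
  ab : G.Adj a b
  bc : G.Adj b c
  cd : G.Adj c d
  da : G.Adj d a
  ac : a ≠ c
  bd : b ≠ d
  val : ∀ v w, dl G f (Pi.single i 1) v w
    = dart a b v w + dart b c v w + dart c d v w + dart d a v w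

section
variable {V F : Type} {G : SimpleGraph V} {f : V → V → F}

lemma dl_single (i : F) {v w : V} (h : G.Adj v w) : dl G f (Pi.single i 1) v w =
    (if f v w = i then 1 else 0) - (if f w v = i then 1 else 0) := by
  simp [dl, h, Pi.single_apply]

lemma dl_single_one {i : F} {v w : V} (h : dl G f (Pi.single i 1) v w = 1) :
    f v w = i ∧ f w v ≠ i := by
  by_cases h' : G.Adj v w
  · rw [dl_single i h'] at h
    split_ifs at h with h1 h2 h2 <;> norm_num at h
    exact ⟨h1, h2⟩
  · rw [dl, if_neg h'] at h
    norm_num at h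

lemma QF.rot {i : F} {a b c d : V} (h : QF G f i a b c d) : QF G f i b c d a :=
  ⟨h.bc, h.cd, h.da, h.ab, h.bd, h.ac.symm, fun v w => by rw [h.val]; ring⟩

lemma QF.f1 {i : F} {a b c d : V} (h : QF G f i a b c d) : f a b = i ∧ f b a ≠ i := by
  apply dl_single_one (G := G)
  rw [h.val]
  simp [dart, h.ab.ne, h.bc.ne, h.cd.ne, h.da.ne, h.ac, h.bd, h.ab.ne', h.bc.ne', h.cd.ne',
    h.da.ne', h.ac.symm, h.bd.symm]

lemma QF.f2 {i : F} {a b c d : V} (h : QF G f i a b c d) : f b c = i ∧ f c b ≠ i := h.rot.f1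
lemma QF.f3 {i : F} {a b c d : V} (h : QF G f i a b c d) : f c d = i ∧ f d c ≠ i := h.rot.rot.f1
lemma QF.f4 {i : F} {a b c d : V} (h : QF G f i a b c d) : f d a = i ∧ f a d ≠ i :=
  h.rot.rot.rot.f1

end

section
variable {V : Type} [Fintype V] {G : SimpleGraph V}

/-- edges in the support of a chain -/
def supE (c : V → V → ℚ) : Finset (Sym2 V) :=
  Finset.univ.filter (fun e => ∃ v w, e = s(v, w) ∧ c v w ≠ 0)

lemma IsFlow.next {c : V → V → ℚ} (hc : IsFlow G c) {v w : V} (h : c v w ≠ 0) :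
    ∃ z, z ≠ v ∧ c w z ≠ 0 := by
  by_contra hcon
  push Not at hcon
  have := hc.2 w
  rw [Finset.sum_eq_single v] at this
  · rw [hc.1.1, neg_eq_zero] at this
    exact h this
  · intro z _ hz
    exact hcon z hz
  · simp

lemma sum_eq_two {g : V → ℚ} (a b : V) (hab : a ≠ b) (h : ∀ w, w ≠ a → w ≠ b → g w = 0) :
    ∑ w, g w = g a + g b := by
  rw [← Finset.sum_pair hab]
  symm
  apply Finset.sum_subset (Finset.subset_univ _)
  intro w _ hw
  simp only [Finset.mem_insert, Finset.mem_singleton, not_or] at hw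
  exact h w hw.1 hw.2

lemma sum_eq_three {g : V → ℚ} (a b c : V) (hab : a ≠ b) (hac : a ≠ c) (hbc : b ≠ c)
    (h : ∀ w, w ≠ a → w ≠ b → w ≠ c → g w = 0) :
    ∑ w, g w = g a + g b + g c := by
  have : ∑ w ∈ ({a, b, c} : Finset V), g w = g a + g b + g c := by
    rw [Finset.sum_insert (by simp [hab, hac]), Finset.sum_pair hbc]; ring
  rw [← this]
  symm
  apply Finset.sum_subset (Finset.subset_univ _)
  intro w _ hw
  simp only [Finset.mem_insert, Finset.mem_singleton, not_or] at hw
  exact h w hw.1 hw.2.1 hw.2.2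

lemma card_five {a b c d e : Sym2 V} (h1 : a ≠ b) (h2 : a ≠ c) (h3 : a ≠ d) (h4 : a ≠ e)
    (h5 : b ≠ c) (h6 : b ≠ d) (h7 : b ≠ e) (h8 : c ≠ d) (h9 : c ≠ e) (h10 : d ≠ e) :
    ({a, b, c, d, e} : Finset (Sym2 V)).card = 5 := by
  rw [Finset.card_insert_of_notMem, Finset.card_insert_of_notMem, Finset.card_insert_of_notMem,
    Finset.card_pair h10] <;> simp [*]

lemma card_four {a b c d : Sym2 V} (h1 : a ≠ b) (h2 : a ≠ c) (h3 : a ≠ d)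
    (h5 : b ≠ c) (h6 : b ≠ d) (h8 : c ≠ d) :
    ({a, b, c, d} : Finset (Sym2 V)).card = 4 := by
  rw [Finset.card_insert_of_notMem, Finset.card_insert_of_notMem,
    Finset.card_pair h8] <;> simp [*]

lemma flow_support {c : V → V → ℚ} (hc : IsFlow G c)
    (htf : ∀ a b c, G.Adj a b → G.Adj b c → G.Adj c a → False) {v w : V} (h : c v w ≠ 0) :
    5 ≤ (supE c).card ∨ (4 ≤ (supE c).card ∧ ∃ p q r t : V, p ≠ r ∧ q ≠ t ∧
      c p q ≠ 0 ∧ c q r ≠ 0 ∧ c r t ≠ 0 ∧ c t p ≠ 0 ∧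
      ∀ v w, c v w ≠ 0 → s(v, w) ∈ ({s(p, q), s(q, r), s(r, t), s(t, p)} : Finset (Sym2 V))) := by
  have hadj : ∀ v w, c v w ≠ 0 → G.Adj v w := by
    intro v w h; by_contra h'; exact h (hc.1.2 v w h')
  have hs : ∀ v w, c v w ≠ 0 → s(v, w) ∈ supE c := by
    intro v w h; simp only [supE, Finset.mem_filter, Finset.mem_univ, true_and]
    exact ⟨v, w, rfl, h⟩
  have hsy : ∀ v w, c v w ≠ 0 → c w v ≠ 0 := by
    intro v w h h'; rw [hc.1.1, h', neg_zero] at h; exact h rfl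
  obtain ⟨x, hxv, hx⟩ := hc.next h
  obtain ⟨y, hyw, hy⟩ := hc.next hx
  obtain ⟨z, hzx, hz⟩ := hc.next hy
  have a1 := hadj _ _ h
  have a2 := hadj _ _ hx
  have a3 := hadj _ _ hy
  have a4 := hadj _ _ hz
  have hyv : y ≠ v := by rintro rfl; exact htf _ _ _ a1 a2 a3
  have hzw : z ≠ w := by rintro rfl; exact htf _ _ _ a2 a3 a4
  by_cases hzv : z = v
  · subst hzv
    have hcard : ({s(z, w), s(w, x), s(x, y), s(y, z)} : Finset (Sym2 V)).card = 4 := by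
      have := a1.ne; have := a2.ne; have := a3.ne; have := a4.ne
      apply card_four <;> simp <;> grind
    have hsub : ({s(z, w), s(w, x), s(x, y), s(y, z)} : Finset (Sym2 V)) ⊆ supE c := by
      intro e he
      simp only [Finset.mem_insert, Finset.mem_singleton] at he
      rcases he with rfl | rfl | rfl | rfl <;> apply hs <;> assumption
    by_cases h5 : supE c ⊆ ({s(z, w), s(w, x), s(x, y), s(y, z)} : Finset (Sym2 V))
    · right
      refine ⟨hcard ▸ Finset.card_le_card hsub, z, w, x, y, hxv.symm, hyw.symm, h, hx, hy, hz, ?_⟩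
      intro v' w' h'
      exact h5 (hs _ _ h')
    · left
      have := Finset.card_lt_card (⟨hsub, h5⟩ : _ ⊂ supE c)
      omega
  · left
    obtain ⟨u, huw, hu⟩ := hc.next (hsy _ _ h)
    have a5 := hadj _ _ hu
    have hcard : ({s(v, w), s(w, x), s(x, y), s(y, z), s(v, u)} : Finset (Sym2 V)).card = 5 := by
      have := a1.ne; have := a2.ne; have := a3.ne; have := a4.ne; have := a5.ne
      apply card_five <;> simp <;> grind
    rw [← hcard]
    apply Finset.card_le_card
    intro e he
    simp only [Finset.mem_insert, Finset.mem_singleton] at he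
    rcases he with rfl | rfl | rfl | rfl | rfl <;> apply hs <;> assumption

lemma dart_anti (x y v w : V) : dart x y v w = - dart x y w v := by
  unfold dart
  simp only [and_comm (a := v = x), and_comm (a := v = y)]; ring

lemma dart_zero {x y v w : V} (h : s(v, w) ≠ s(x, y)) : dart x y v w = 0 := by
  rw [Ne, Sym2.eq_iff] at h
  unfold dart
  rw [if_neg (fun h' => h (Or.inl h')), if_neg (fun h' => h (Or.inr h'))]; ring

lemma four_cycle_chain (c : V → V → ℚ) (hanti : ∀ v w, c v w = - c w v) {p q r t : V}
    (n1 : p ≠ q) (n2 : q ≠ r) (n3 : r ≠ t) (n4 : t ≠ p) (hpr : p ≠ r) (hqt : q ≠ t) (k : ℚ)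
    (e1 : c p q = k) (e2 : c q r = k) (e3 : c r t = k) (e4 : c t p = k)
    (hz : ∀ v w, s(v, w) ∉ ({s(p, q), s(q, r), s(r, t), s(t, p)} : Finset (Sym2 V)) →
      c v w = 0) (v w : V) : c v w = k *
      (dart p q v w + dart q r v w + dart r t v w + dart t p v w) := by
  by_cases h : s(v, w) ∈ ({s(p, q), s(q, r), s(r, t), s(t, p)} : Finset (Sym2 V))
  · have g1 : dart p q p q + dart q r p q + dart r t p q + dart t p p q = 1 := by
      simp [dart, n1, n2, n3, n4, n1.symm, n2.symm, n3.symm, n4.symm, hpr, hqt, hpr.symm,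
        hqt.symm]
    have g2 : dart p q q r + dart q r q r + dart r t q r + dart t p q r = 1 := by
      simp [dart, n1, n2, n3, n4, n1.symm, n2.symm, n3.symm, n4.symm, hpr, hqt, hpr.symm,
        hqt.symm]
    have g3 : dart p q r t + dart q r r t + dart r t r t + dart t p r t = 1 := by
      simp [dart, n1, n2, n3, n4, n1.symm, n2.symm, n3.symm, n4.symm, hpr, hqt, hpr.symm,
        hqt.symm]
    have g4 : dart p q t p + dart q r t p + dart r t t p + dart t p t p = 1 := by
      simp [dart, n1, n2, n3, n4, n1.symm, n2.symm, n3.symm, n4.symm, hpr, hqt, hpr.symm,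
        hqt.symm]
    have key : ∀ x y, (c x y = k ∧ dart p q x y + dart q r x y + dart r t x y + dart t p x y = 1) →
        s(v, w) = s(x, y) → c v w = k *
      (dart p q v w + dart q r v w + dart r t v w + dart t p v w) := by
      rintro x y ⟨h1, h2⟩ h
      rcases Sym2.eq_iff.1 h with ⟨rfl, rfl⟩ | ⟨rfl, rfl⟩
      · rw [h1, h2, mul_one]
      · rw [hanti, h1, dart_anti p q, dart_anti q r, dart_anti r t, dart_anti t p]
        linear_combination k * h2
    simp only [Finset.mem_insert, Finset.mem_singleton] at h
    rcases h with h | h | h | h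
    · exact key _ _ ⟨e1, g1⟩ h
    · exact key _ _ ⟨e2, g2⟩ h
    · exact key _ _ ⟨e3, g3⟩ h
    · exact key _ _ ⟨e4, g4⟩ h
  · rw [hz v w h]
    simp only [Finset.mem_insert, Finset.mem_singleton, not_or] at h
    obtain ⟨h1, h2, h3, h4⟩ := h
    rw [dart_zero h1, dart_zero h2, dart_zero h3, dart_zero h4]
    ring

lemma quad_of_flow {F : Type} {f : V → V → F} (hd : IsDual G f) {i : F} {p q r t : V}
    (hpr : p ≠ r) (hqt : q ≠ t)
    (h1 : dl G f (Pi.single i 1) p q ≠ 0) (h2 : dl G f (Pi.single i 1) q r ≠ 0)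
    (h3 : dl G f (Pi.single i 1) r t ≠ 0) (h4 : dl G f (Pi.single i 1) t p ≠ 0)
    (hall : ∀ v w, dl G f (Pi.single i 1) v w ≠ 0 →
      s(v, w) ∈ ({s(p, q), s(q, r), s(r, t), s(t, p)} : Finset (Sym2 V))) :
    ∃ a b c d, QF G f i a b c d := by
  have hfl := hd.isFlow (Pi.single i 1)
  set c := dl G f (Pi.single i 1) with hc
  have hadj : ∀ v w, c v w ≠ 0 → G.Adj v w := by
    intro v w h; by_contra h'; exact h (hfl.1.2 v w h')
  have a1 := hadj _ _ h1
  have a2 := hadj _ _ h2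
  have a3 := hadj _ _ h3
  have a4 := hadj _ _ h4
  have n1 := a1.ne
  have n2 := a2.ne
  have n3 := a3.ne
  have n4 := a4.ne
  have hz : ∀ v w, s(v, w) ∉ ({s(p, q), s(q, r), s(r, t), s(t, p)} : Finset (Sym2 V)) →
      c v w = 0 := by
    intro v w h; by_contra h'; exact h (hall v w h')
  have e2 : c p q = c q r := by
    have := hfl.2 q
    rw [sum_eq_two p r hpr, hfl.1.1 q p] at this
    · linarith
    · intro w hw1 hw2
      apply hz
      simp only [Finset.mem_insert, Finset.mem_singleton, Sym2.eq_iff]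
      grind
  have e3 : c q r = c r t := by
    have := hfl.2 r
    rw [sum_eq_two q t hqt, hfl.1.1 r q] at this
    · linarith
    · intro w hw1 hw2
      apply hz
      simp only [Finset.mem_insert, Finset.mem_singleton, Sym2.eq_iff]
      grind
  have e4 : c r t = c t p := by
    have := hfl.2 t
    rw [sum_eq_two r p hpr.symm, hfl.1.1 t r] at this
    · linarith
    · intro w hw1 hw2
      apply hz
      simp only [Finset.mem_insert, Finset.mem_singleton, Sym2.eq_iff]
      grind
  have hval : c p q = 1 ∨ c p q = -1 := by
    have h := dl_single (f := f) i a1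
    rw [← hc] at h
    rw [h] at h1 ⊢
    split_ifs at h1 ⊢ <;> simp_all
  have hc2 := four_cycle_chain c hfl.1.1 n1 n2 n3 n4 hpr hqt (c p q) rfl e2.symm
    (by rw [e2, e3]) (by rw [e2, e3, e4]) hz
  rcases hval with h | h
  · refine ⟨p, q, r, t, ⟨a1, a2, a3, a4, hpr, hqt, fun v w => ?_⟩⟩
    rw [← hc, hc2, h, one_mul]
  · refine ⟨p, t, r, q, ⟨a4.symm, a3.symm, a2.symm, a1.symm, hpr, hqt.symm, fun v w => ?_⟩⟩
    rw [← hc, hc2, h]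
    have ds : ∀ x y : V, dart x y v w = - dart y x v w := by
      intro x y; unfold dart; ring
    rw [ds p t, ds t r, ds r q, ds q p]
    ring

lemma two_edges : cr G Finset.univ Finset.univ = 2 * G.edgeFinset.card := by
  rw [← SimpleGraph.sum_degrees_eq_twice_card_edges]
  unfold cr dg
  refine Finset.sum_congr rfl fun v _ => ?_
  rw [SimpleGraph.degree, SimpleGraph.neighborFinset_eq_filter]

/-- dimension count -/
lemma euler_dim {F : Type} [Fintype F] {f : V → V → F} (hd : IsDual G f) [Nonempty V] :
    G.edgeFinset.card + 1 ≤ Fintype.card V +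
      ((Finset.univ : Finset F).filter (fun i => ∃ v w, dl G f (Pi.single i 1) v w ≠ 0)).card - 1
    ∨ (G.edgeFinset.card + 1 ≤ Fintype.card V) := by
  set E := G.edgeSet with hE
  let o : E → V × V := fun e => Quot.out e.1
  have ho : ∀ e : E, s((o e).1, (o e).2) = e.1 := fun e => Quot.out_eq e.1
  have hoa : ∀ e : E, G.Adj (o e).1 (o e).2 := by
    intro e
    have : s((o e).1, (o e).2) ∈ G.edgeSet := by rw [ho]; exact e.2
    exact this
  let D : (E → ℚ) →ₗ[ℚ] (V → ℚ) :=
    { toFun := fun x v => ∑ e, x e * ((if v = (o e).1 then 1 else 0) - (if v = (o e).2 then 1 else 0))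
      map_add' := by
        intro x y; ext v
        simp only [Pi.add_apply, add_mul, Finset.sum_add_distrib]
      map_smul' := by
        intro t x; ext v
        simp only [Pi.smul_apply, smul_eq_mul, RingHom.id_apply, Finset.mul_sum, mul_assoc] }
  let ψ : (F → ℚ) →ₗ[ℚ] (E → ℚ) :=
    { toFun := fun s e => s (f (o e).1 (o e).2) - s (f (o e).2 (o e).1)
      map_add' := by intro x y; ext v; simp only [Pi.add_apply]; ring
      map_smul' := by
        intro t x; ext v; simp only [Pi.smul_apply, smul_eq_mul, RingHom.id_apply]; ring }
  have hker : LinearMap.ker D ≤ LinearMap.range ψ := by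
    intro x hx
    rw [LinearMap.mem_ker] at hx
    have hfl : IsFlow G (fun v w => ∑ e, x e * dart (o e).1 (o e).2 v w) := by
      refine ⟨⟨fun v w => ?_, fun v w h => ?_⟩, fun v => ?_⟩
      · rw [← Finset.sum_neg_distrib]
        refine Finset.sum_congr rfl fun e _ => ?_
        rw [(dart_chain (hoa e)).1 v w]; ring
      · refine Finset.sum_eq_zero fun e _ => ?_
        rw [(dart_chain (hoa e)).2 v w h]; ring
      · rw [Finset.sum_comm]
        have := congrFun hx v
        simp only [← Finset.mul_sum, sum_dart]
        exact this
    obtain ⟨s, hs⟩ := hd.pot _ hfl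
    refine ⟨s, ?_⟩
    ext e
    have h1 := hs _ _ (hoa e)
    have h2 : ∑ e', x e' * dart (o e').1 (o e').2 (o e).1 (o e).2 = x e := by
      rw [Finset.sum_eq_single e]
      · have := (hoa e).ne
        simp [dart, this]
      · intro e' _ hne
        have h3 : s((o e).1, (o e).2) ≠ s((o e').1, (o e').2) := by
          rw [ho, ho]; exact fun h => hne (Subtype.ext h.symm)
        rw [Ne, Sym2.eq_iff] at h3
        push Not at h3
        unfold dart
        rw [if_neg (fun h => h3.1 h.1 h.2), if_neg (fun h => h3.2 h.1 h.2)]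
        ring
      · simp
    rw [h2] at h1
    exact h1.symm
  have hrn := LinearMap.finrank_range_add_finrank_ker D
  rw [Module.finrank_fintype_fun_eq_card] at hrn
  have hEc : Fintype.card E = G.edgeFinset.card := by
    rw [SimpleGraph.edgeFinset, Set.toFinset_card]
  have hrange : Module.finrank ℚ (LinearMap.range D) + 1 ≤ Fintype.card V := by
    let σ : (V → ℚ) →ₗ[ℚ] ℚ :=
      { toFun := fun x => ∑ v, x v
        map_add' := by intro x y; simp [Finset.sum_add_distrib]
        map_smul' := by intro t x; simp [Finset.mul_sum] }
    have h1 : LinearMap.range D ≤ LinearMap.ker σ := by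
      rintro _ ⟨x, rfl⟩
      rw [LinearMap.mem_ker]
      change ∑ v, ∑ e, x e * ((if v = (o e).1 then (1 : ℚ) else 0) - (if v = (o e).2 then 1 else 0)) = 0
      rw [Finset.sum_comm]
      refine Finset.sum_eq_zero fun e _ => ?_
      rw [← Finset.mul_sum, Finset.sum_sub_distrib]
      simp
    have h2 := Submodule.finrank_mono h1
    have h3 := LinearMap.finrank_range_add_finrank_ker σ
    rw [Module.finrank_fintype_fun_eq_card] at h3
    have h4 : 1 ≤ Module.finrank ℚ (LinearMap.range σ) := by
      rw [Nat.one_le_iff_ne_zero]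
      intro h0
      rw [Submodule.finrank_eq_zero] at h0
      obtain ⟨v⟩ := ‹Nonempty V›
      have : σ (Pi.single v 1) ∈ LinearMap.range σ := ⟨_, rfl⟩
      rw [h0, Submodule.mem_bot] at this
      have h5 : σ (Pi.single v 1) = 1 := by
        change ∑ w, (Pi.single v 1 : V → ℚ) w = 1
        simp
      rw [h5] at this
      norm_num at this
    omega
  set NZ := (Finset.univ : Finset F).filter (fun i => ∃ v w, dl G f (Pi.single i 1) v w ≠ 0) with hNZ
  have hz : ∀ i, i ∉ NZ → ψ (Pi.single i 1) = 0 := by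
    intro i hi
    simp only [hNZ, Finset.mem_filter, Finset.mem_univ, true_and] at hi
    push Not at hi
    ext e
    have := hi (o e).1 (o e).2
    rw [dl, if_pos (hoa e)] at this
    exact this
  have hexp : ∀ s : F → ℚ, ψ s = ∑ i, s i • ψ (Pi.single i 1) := by
    intro s
    conv_lhs => rw [pi_eq_sum_univ' s]
    rw [map_sum]
    refine Finset.sum_congr rfl fun i _ => ?_
    rw [← map_smul]
  have hfin := Submodule.finrank_mono hker
  rcases NZ.eq_empty_or_nonempty with h0 | ⟨i0, hi0⟩
  · right
    have : LinearMap.range ψ = ⊥ := by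
      rw [eq_bot_iff]
      rintro _ ⟨s, rfl⟩
      rw [hexp, Submodule.mem_bot]
      refine Finset.sum_eq_zero fun i _ => ?_
      rw [hz i (by rw [h0]; simp), smul_zero]
    rw [this, finrank_bot] at hfin
    omega
  · left
    have hle : LinearMap.range ψ ≤ Submodule.span ℚ
        (((NZ.erase i0).image (fun i => ψ (Pi.single i 1)) : Finset (E → ℚ)) : Set (E → ℚ)) := by
      rintro _ ⟨s, rfl⟩
      have h1 : ψ s = ψ (fun i => s i - s i0) := by
        ext e
        change s _ - s _ = (s _ - s i0) - (s _ - s i0)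
        ring
      rw [h1, hexp]
      refine Submodule.sum_mem _ fun i _ => ?_
      by_cases hi : i = i0
      · subst hi; simp
      · by_cases hi' : i ∈ NZ
        · refine Submodule.smul_mem _ _ (Submodule.subset_span ?_)
          simp only [Finset.coe_image]
          exact ⟨i, by simp [hi, hi'], rfl⟩
        · rw [hz i hi', smul_zero]; exact Submodule.zero_mem _
    have h2 := Submodule.finrank_mono hle
    have h3 := finrank_span_finset_le_card (R := ℚ)
      ((NZ.erase i0).image (fun i => ψ (Pi.single i 1)) : Finset (E → ℚ))
    rw [Set.finrank] at h3
    have h4 : ((NZ.erase i0).image (fun i => ψ (Pi.single i 1)) : Finset (E → ℚ)).card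
        ≤ NZ.card - 1 := by
      rw [← Finset.card_erase_of_mem hi0]; exact Finset.card_image_le
    have h5 := Finset.card_pos.2 ⟨i0, hi0⟩
    omega

/-- Euler's inequality for triangle-free graphs with a dual -/
theorem euler {F : Type} [Fintype F] {f : V → V → F} (hd : IsDual G f)
    (htf : ∀ a b c, G.Adj a b → G.Adj b c → G.Adj c a → False) (hV : 4 ≤ Fintype.card V) :
    ∃ Q : Finset F, (∀ i ∈ Q, ∃ a b c d, QF G f i a b c d) ∧
      3 * cr G Finset.univ Finset.univ + 20 ≤ 10 * Fintype.card V + 2 * Q.card := by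
  have : Nonempty V := Fintype.card_pos_iff.1 (by omega)
  set Q := (Finset.univ : Finset F).filter (fun i => ∃ a b c d, QF G f i a b c d) with hQ
  refine ⟨Q, fun i hi => (Finset.mem_filter.1 hi).2, ?_⟩
  rw [two_edges]
  set NZ := (Finset.univ : Finset F).filter (fun i => ∃ v w, dl G f (Pi.single i 1) v w ≠ 0) with hNZ
  have h1 : ∑ i ∈ NZ, (supE (dl G f (Pi.single i 1))).card ≤ 2 * G.edgeFinset.card := by
    have e1 : ∀ i ∈ NZ, (supE (dl G f (Pi.single i 1))).card =
        ∑ e ∈ G.edgeFinset, if e ∈ supE (dl G f (Pi.single i 1)) then 1 else 0 := by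
      intro i _
      rw [← Finset.card_filter]
      congr 1
      ext e
      simp only [Finset.mem_filter, SimpleGraph.mem_edgeFinset]
      refine ⟨fun h => ⟨?_, h⟩, fun h => h.2⟩
      simp only [supE, Finset.mem_filter, Finset.mem_univ, true_and] at h
      obtain ⟨v, w, rfl, h⟩ := h
      rw [SimpleGraph.mem_edgeSet]
      by_contra h'
      exact h ((dl_chain G f _).2 v w h')
    rw [Finset.sum_congr rfl e1, Finset.sum_comm, mul_comm, ← smul_eq_mul]
    apply Finset.sum_le_card_nsmul
    intro e he
    rw [← Finset.card_filter]
    induction e using Sym2.ind with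
    | _ v w =>
    rw [SimpleGraph.mem_edgeFinset, SimpleGraph.mem_edgeSet] at he
    have : NZ.filter (fun i => s(v, w) ∈ supE (dl G f (Pi.single i 1))) ⊆ {f v w, f w v} := by
      intro i hi
      obtain ⟨_, hi⟩ := Finset.mem_filter.1 hi
      simp only [supE, Finset.mem_filter, Finset.mem_univ, true_and] at hi
      obtain ⟨v', w', heq, h⟩ := hi
      have h' : dl G f (Pi.single i 1) v w ≠ 0 := by
        rcases Sym2.eq_iff.1 heq with ⟨rfl, rfl⟩ | ⟨rfl, rfl⟩
        · exact h
        · rw [(dl_chain G f _).1, neg_ne_zero]; exact h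
      rw [dl_single i he] at h'
      simp only [Finset.mem_insert, Finset.mem_singleton]
      by_contra hcon
      push Not at hcon
      rw [if_neg (fun h => hcon.1 h.symm), if_neg (fun h => hcon.2 h.symm)] at h'
      norm_num at h'
    exact (Finset.card_le_card this).trans Finset.card_le_two
  have h2 : 5 * NZ.card ≤ ∑ i ∈ NZ, (supE (dl G f (Pi.single i 1))).card + Q.card := by
    have e2 : ∀ i ∈ NZ, 5 ≤ (supE (dl G f (Pi.single i 1))).card + (if i ∈ Q then 1 else 0) := by
      intro i hi
      obtain ⟨_, v, w, h⟩ := Finset.mem_filter.1 hi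
      rcases flow_support (hd.isFlow _) htf h with h5 | ⟨h4, p, q, r, t, g1, g2, g3, g4, g5, g6, g7⟩
      · omega
      · have : i ∈ Q := by
          simp only [hQ, Finset.mem_filter, Finset.mem_univ, true_and]
          exact quad_of_flow hd g1 g2 g3 g4 g5 g6 g7
        rw [if_pos this]
        omega
    have e3 := Finset.card_nsmul_le_sum _ _ _ e2
    rw [Finset.sum_add_distrib, ← Finset.card_filter, smul_eq_mul] at e3
    have : (NZ.filter (fun i => i ∈ Q)).card ≤ Q.card :=
      Finset.card_le_card (fun i hi => (Finset.mem_filter.1 hi).2)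
    omega
  have h3 := euler_dim hd
  rw [← hNZ] at h3
  omega

end
end TorusThree

namespace TorusThree

open scoped Classical

/-! ### Part E: separation by five-cycles -/

section
variable {V : Type} [Fintype V] {G : SimpleGraph V}

/-- delete the vertices in `Z` (keeping them as isolated vertices) -/
def delG (G : SimpleGraph V) (Z : Set V) : SimpleGraph V where
  Adj a b := G.Adj a b ∧ a ∉ Z ∧ b ∉ Z
  symm := ⟨fun _ _ h => ⟨h.1.symm, h.2.2, h.2.1⟩⟩
  loopless := ⟨fun _ h => h.1.ne rfl⟩

lemma dl_const {F : Type} (f : V → V → F) (s : F → ℚ) (k : ℚ) :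
    dl G f (fun j => s j + k) = dl G f s := by
  ext v w
  unfold dl
  split_ifs
  · ring
  · rfl

lemma IsDual.exists_norm {F : Type} {f : V → V → F} (hd : IsDual G f) {c : V → V → ℚ}
    (hc : IsFlow G c) (i : F) : ∃ s : F → ℚ, s i = 1 ∧ c = dl G f s := by
  obtain ⟨s, hs⟩ := hd.exists_dl hc
  exact ⟨fun j => s j + (1 - s i), by ring, by rw [dl_const]; exact hs⟩

/-- the chain of a closed pentagon -/
def pent (a b c d e : V) (v w : V) : ℚ :=
  dart a b v w + dart b c v w + dart c d v w + dart d e v w + dart e a v w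

lemma pent_flow {a b c d e : V} (hab : G.Adj a b) (hbc : G.Adj b c) (hcd : G.Adj c d)
    (hde : G.Adj d e) (hea : G.Adj e a) : IsFlow G (pent a b c d e) := by
  refine ⟨((((dart_chain hab).add (dart_chain hbc)).add (dart_chain hcd)).add
    (dart_chain hde)).add (dart_chain hea), fun v => ?_⟩
  unfold pent
  simp only [Finset.sum_add_distrib, sum_dart]
  ring

lemma dl_mul_left {F : Type} {f : V → V → F} {s r : F → ℚ} {v w : V} (h : dl G f s v w = 0) :
    dl G f (fun j => s j * r j) v w = s (f v w) * dl G f r v w := by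
  unfold dl at *
  split_ifs at * with h1
  · have : s (f w v) = s (f v w) := by linarith
    beta_reduce; rw [this]; ring
  · ring

lemma dl_mul_right {F : Type} {f : V → V → F} {s r : F → ℚ} {v w : V} (h : dl G f r v w = 0) :
    dl G f (fun j => s j * r j) v w = r (f v w) * dl G f s v w := by
  unfold dl at *
  split_ifs at * with h1
  · have : r (f w v) = r (f v w) := by linarith
    beta_reduce; rw [this]; ring
  · ring

lemma dl_mul_zero {F : Type} {f : V → V → F} {s r : F → ℚ} {v w : V} (h : dl G f s v w = 0)
    (h' : dl G f r v w = 0) :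
    dl G f (fun j => s j * r j) v w = 0 := by
  rw [dl_mul_left h, h', mul_zero]

/-- lemma S -/
theorem sep {F : Type} {f : V → V → F} (hd : IsDual G f)
    (htf : ∀ a b c, G.Adj a b → G.Adj b c → G.Adj c a → False) {i : F} {v1 v2 v3 v4 x y : V}
    (hq : QF G f i v1 v2 v3 v4) (h1x : G.Adj v1 x) (hxy : G.Adj x y) (hy3 : G.Adj y v3)
    (hr : (delG G {v1, x, y, v3}).Reachable v2 v4) : False := by
  obtain ⟨q, hqc, hqd⟩ := isDiv_of_reachable hr
  have n12 := hq.ab.ne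
  have n23 := hq.bc.ne
  have n34 := hq.cd.ne
  have n41 := hq.da.ne
  have n13 := hq.ac
  have n24 := hq.bd
  have m1 := h1x.ne
  have m2 := hxy.ne
  have m3 := hy3.ne
  have m4 : x ≠ v2 := by rintro rfl; exact htf _ _ _ hxy hy3 hq.bc.symm
  have m5 : y ≠ v2 := by rintro rfl; exact htf _ _ _ h1x hxy hq.ab.symm
  have m6 : x ≠ v4 := by rintro rfl; exact htf _ _ _ hxy hy3 hq.cd
  have m7 : y ≠ v4 := by rintro rfl; exact htf _ _ _ h1x hxy hq.da
  have m8 : x ≠ v3 := by rintro rfl; exact htf _ _ _ hq.ab hq.bc h1x.symm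
  have m9 : y ≠ v1 := by rintro rfl; exact htf _ _ _ hq.ab hq.bc hy3.symm
  have hqc' : IsChain G q := ⟨hqc.1, fun v w h => hqc.2 v w (fun h' => h h'.1)⟩
  have hq0 : ∀ v ∈ ({v1, x, y, v3} : Set V), ∀ w, q v w = 0 :=
    fun v hv w => hqc.2 v w (fun h' => h'.2.1 hv)
  have q1 := hq0 v1 (by simp)
  have qx := hq0 x (by simp)
  have qy := hq0 y (by simp)
  have q3 := hq0 v3 (by simp)
  have hC := pent_flow hq.ab hq.bc hy3.symm hxy.symm h1x.symm
  have hD : IsFlow G (fun v w => dart v1 v2 v w + q v w + dart v4 v1 v w) := by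
    refine ⟨((dart_chain hq.ab).add hqc').add (dart_chain hq.da), fun v => ?_⟩
    simp only [Finset.sum_add_distrib, sum_dart, hqd, Pi.sub_apply, Pi.single_apply]
    ring
  obtain ⟨s, hsi, hs⟩ := hd.exists_norm hC i
  obtain ⟨r, hri, hr'⟩ := hd.exists_norm hD i
  have hCv : ∀ v w, dl G f s v w = pent v1 v2 v3 y x v w := fun v w => by rw [hs]
  have hDv : ∀ v w, dl G f r v w = dart v1 v2 v w + q v w + dart v4 v1 v w :=
    fun v w => (congrFun (congrFun hr' v) w).symm
  have hT := hd.isFlow (fun j => s j * r j)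
  set T := dl G f (fun j => s j * r j) with hTd
  -- values of `r`
  have D3 : ∀ w, dl G f r v3 w = 0 := by
    intro w; rw [hDv, q3]; simp [dart, n13, n23, n34, n13.symm, n23.symm, n34.symm]
  have Dx : ∀ w, dl G f r x w = 0 := by
    intro w; rw [hDv, qx]; simp [dart, m1.symm, m4, m6]
  have Dy : ∀ w, dl G f r y w = 0 := by
    intro w; rw [hDv, qy]; simp [dart, m9, m5, m7]
  have D1 : ∀ w, w ≠ v2 → w ≠ v4 → dl G f r v1 w = 0 := by
    intro w h1 h2; rw [hDv, q1]; simp [dart, h1, h2, n12, n41.symm]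
  have D12 : dl G f r v1 v2 = 1 := by
    rw [hDv, q1]; simp [dart, n12, n24, n12.symm]
  have D41 : dl G f r v4 v1 = 1 := by
    rw [hDv, hqc.1, q1]; simp [dart, n12.symm, n24.symm, n12, n41]
  -- values of `s`
  have C1 : ∀ w, w ≠ v2 → w ≠ x → dl G f s v1 w = 0 := by
    intro w h1 h2; rw [hCv]; simp [pent, dart, h1, h2, n12, n13, m9.symm, m1]
  have C3 : ∀ w, w ≠ v2 → w ≠ y → dl G f s v3 w = 0 := by
    intro w h1 h2; rw [hCv]; simp [pent, dart, h1, h2, n23.symm, n13.symm, m3.symm, m8.symm]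
  have Cx : ∀ w, w ≠ v1 → w ≠ y → dl G f s x w = 0 := by
    intro w h1 h2; rw [hCv]; simp [pent, dart, h1, h2, m2, m1.symm, m4, m8]
  have Cy : ∀ w, w ≠ v3 → w ≠ x → dl G f s y w = 0 := by
    intro w h1 h2; rw [hCv]; simp [pent, dart, h1, h2, m2.symm, m9, m5, m3]
  have C12 : dl G f s v1 v2 = 1 := by
    rw [hCv]; simp [pent, dart, n12, n13, m9.symm, m1, m4.symm]
  have C23 : dl G f s v2 v3 = 1 := by
    rw [hCv]; simp [pent, dart, n12.symm, n23, m4.symm, m5.symm, m3.symm, n13.symm]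
  have C3y : dl G f s v3 y = 1 := by
    rw [hCv]; simp [pent, dart, n23.symm, n13.symm, m3.symm, m8.symm, m5]
  have Cyx : dl G f s y x = 1 := by
    rw [hCv]; simp [pent, dart, m2.symm, m9, m5, m3, m8]
  have Cx1 : dl G f s x v1 = 1 := by
    rw [hCv]; simp [pent, dart, m1.symm, m4, m8, m2, m9.symm]
  have anti := (dl_chain G f (fun j => s j * r j)).1
  rw [← hTd] at anti
  have T12 : T v1 v2 = 1 := by
    rw [dl, if_pos hq.ab, hq.f1.1] at C12 D12
    rw [hTd, dl, if_pos hq.ab, hq.f1.1]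
    have : s (f v2 v1) = 0 := by linarith
    rw [this, hsi, hri]; ring
  have T23 : T v2 v3 = 1 := by
    rw [dl, if_pos hq.bc, hq.f2.1] at C23
    rw [hTd, dl, if_pos hq.bc, hq.f2.1]
    have : s (f v3 v2) = 0 := by linarith
    rw [this, hsi, hri]; ring
  have T41 : T v4 v1 = 1 := by
    rw [dl, if_pos hq.da, hq.f4.1] at D41
    rw [hTd, dl, if_pos hq.da, hq.f4.1]
    have : r (f v1 v4) = 0 := by linarith
    rw [this, hsi, hri]; ring
  have e3 : T v3 y = 1 := by
    have := hT.2 v3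
    rw [sum_eq_two v2 y m5.symm, anti v3 v2, T23] at this
    · linarith
    · intro w h1 h2
      exact dl_mul_zero (C3 w h1 h2) (D3 w)
  have e2 : T y x = 1 := by
    have := hT.2 y
    rw [sum_eq_two v3 x m8.symm, anti y v3, e3] at this
    · linarith
    · intro w h1 h2
      exact dl_mul_zero (Cy w h1 h2) (Dy w)
  have e1 : T x v1 = 1 := by
    have := hT.2 x
    rw [sum_eq_two v1 y m9.symm, anti x y, e2] at this
    · linarith
    · intro w h1 h2
      exact dl_mul_zero (Cx w h1 h2) (Dx w)
  have := hT.2 v1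
  rw [sum_eq_three v2 v4 x n24 m4.symm m6.symm, anti v1 v4, T41, T12, anti v1 x, e1] at this
  · norm_num at this
  · intro w h1 h2 h3
    exact dl_mul_zero (C1 w h1 h3) (D1 w h1 h2)

/-- a quadrangular face at `u` that cannot be collapsed -/
structure Bad {F : Type} (G : SimpleGraph V) (f : V → V → F) (u v : V) (i : F)
    (v1 v3 v4 x y : V) : Prop where
  q : QF G f i v1 u v3 v4
  h1 : G.Adj v1 x
  h2 : G.Adj x y
  h3 : G.Adj y v3
  hv : G.Adj v4 v

lemma bad_aux1 {F : Type} {f : V → V → F} (hd : IsDual G f)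
    (htf : ∀ a b c, G.Adj a b → G.Adj b c → G.Adj c a → False) {u v : V} (huv : ¬ G.Adj u v)
    {i : F} {v1 v3 v4 x y : V} (B : Bad G f u v i v1 v3 v4 x y) {t w4 : V}
    (hut : G.Adj u t) (htw : G.Adj t w4) (hwv : G.Adj w4 v) (ht1 : t ≠ v1) (ht3 : t ≠ v3) :
    w4 = x ∨ w4 = y := by
  by_contra hcon
  push Not at hcon
  have hq := B.q
  have k : ∀ z, ¬ (z = v1 ∨ z = x ∨ z = y ∨ z = v3) → z ∉ ({v1, x, y, v3} : Set V) := by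
    intro z hz; simpa using hz
  have hu : u ∉ ({v1, x, y, v3} : Set V) := by
    apply k
    rintro (rfl | rfl | rfl | rfl)
    · exact hq.ab.ne rfl
    · exact htf _ _ _ B.h2 B.h3 hq.bc.symm
    · exact htf _ _ _ B.h1 B.h2 hq.ab.symm
    · exact hq.bc.ne rfl
  have ht : t ∉ ({v1, x, y, v3} : Set V) := by
    apply k
    rintro (rfl | rfl | rfl | rfl)
    · exact ht1 rfl
    · exact htf _ _ _ hut B.h1.symm hq.ab
    · exact htf _ _ _ hut B.h3 hq.bc.symm
    · exact ht3 rfl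
  have hw : w4 ∉ ({v1, x, y, v3} : Set V) := by
    apply k
    rintro (rfl | rfl | rfl | rfl)
    · exact htf _ _ _ hut htw hq.ab
    · exact hcon.1 rfl
    · exact hcon.2 rfl
    · exact htf _ _ _ hut htw hq.bc.symm
  have hv : v ∉ ({v1, x, y, v3} : Set V) := by
    apply k
    rintro (rfl | rfl | rfl | rfl)
    · exact huv hq.ab.symm
    · exact htf _ _ _ B.hv B.h1.symm hq.da.symm
    · exact htf _ _ _ B.hv B.h3 hq.cd
    · exact huv hq.bc
  have h4 : v4 ∉ ({v1, x, y, v3} : Set V) := by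
    apply k
    rintro (rfl | rfl | rfl | rfl)
    · exact hq.da.ne rfl
    · exact htf _ _ _ B.h2 B.h3 hq.cd
    · exact htf _ _ _ B.h1 B.h2 hq.da
    · exact hq.cd.ne rfl
  have e1 : (delG G {v1, x, y, v3}).Adj u t := ⟨hut, hu, ht⟩
  have e2 : (delG G {v1, x, y, v3}).Adj t w4 := ⟨htw, ht, hw⟩
  have e3 : (delG G {v1, x, y, v3}).Adj w4 v := ⟨hwv, hw, hv⟩
  have e4 : (delG G {v1, x, y, v3}).Adj v v4 := ⟨B.hv.symm, hv, h4⟩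
  exact sep hd htf hq B.h1 B.h2 B.h3
    (e1.reachable.trans (e2.reachable.trans (e3.reachable.trans e4.reachable)))

/-- short detours are impossible as well -/
lemma bad_aux2 {F : Type} {f : V → V → F} (hd : IsDual G f)
    (htf : ∀ a b c, G.Adj a b → G.Adj b c → G.Adj c a → False) {u v : V}
    {i : F} {v1 v3 v4 x y : V} (B : Bad G f u v i v1 v3 v4 x y) {t : V}
    (hut : G.Adj u t) (ht1 : t ≠ v1) (ht3 : t ≠ v3)
    (h : G.Adj t v4 ∨ ∃ z, G.Adj t z ∧ G.Adj z v4) : False := by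
  have hq := B.q
  have k : ∀ z, ¬ (z = v1 ∨ z = x ∨ z = y ∨ z = v3) → z ∉ ({v1, x, y, v3} : Set V) := by
    intro z hz; simpa using hz
  have hu : u ∉ ({v1, x, y, v3} : Set V) := by
    apply k
    rintro (rfl | rfl | rfl | rfl)
    · exact hq.ab.ne rfl
    · exact htf _ _ _ B.h2 B.h3 hq.bc.symm
    · exact htf _ _ _ B.h1 B.h2 hq.ab.symm
    · exact hq.bc.ne rfl
  have ht : t ∉ ({v1, x, y, v3} : Set V) := by
    apply k
    rintro (rfl | rfl | rfl | rfl)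
    · exact ht1 rfl
    · exact htf _ _ _ hut B.h1.symm hq.ab
    · exact htf _ _ _ hut B.h3 hq.bc.symm
    · exact ht3 rfl
  have h4 : v4 ∉ ({v1, x, y, v3} : Set V) := by
    apply k
    rintro (rfl | rfl | rfl | rfl)
    · exact hq.da.ne rfl
    · exact htf _ _ _ B.h2 B.h3 hq.cd
    · exact htf _ _ _ B.h1 B.h2 hq.da
    · exact hq.cd.ne rfl
  have e1 : (delG G {v1, x, y, v3}).Adj u t := ⟨hut, hu, ht⟩
  rcases h with h | ⟨z, h1, h2⟩
  · have e2 : (delG G {v1, x, y, v3}).Adj t v4 := ⟨h, ht, h4⟩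
    exact sep hd htf hq B.h1 B.h2 B.h3 (e1.reachable.trans e2.reachable)
  · have hz : z ∉ ({v1, x, y, v3} : Set V) := by
      apply k
      rintro (rfl | rfl | rfl | rfl)
      · exact htf _ _ _ hut h1 hq.ab
      · exact htf _ _ _ B.h1 h2 hq.da
      · exact htf _ _ _ B.h3.symm h2 hq.cd.symm
      · exact htf _ _ _ hut h1 hq.bc.symm
    have e2 : (delG G {v1, x, y, v3}).Adj t z := ⟨h1, ht, hz⟩
    have e3 : (delG G {v1, x, y, v3}).Adj z v4 := ⟨h2, hz, h4⟩
    exact sep hd htf hq B.h1 B.h2 B.h3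
      (e1.reachable.trans (e2.reachable.trans e3.reachable))

lemma bad_aux3 {F : Type} {f : V → V → F} (hd : IsDual G f)
    (htf : ∀ a b c, G.Adj a b → G.Adj b c → G.Adj c a → False) {u v : V} (huv : ¬ G.Adj u v)
    {i i' : F} {v1 v3 v4 x y w4 x' y' : V} (B : Bad G f u v i v1 v3 v4 x y)
    (B' : Bad G f u v i' v3 v1 w4 x' y') : False := by
  have hq := B.q
  have hq' := B'.q
  have n12 := hq.ab.ne
  have n23 := hq.bc.ne
  have n34 := hq.cd.ne
  have n41 := hq.da.ne
  have n13 := hq.ac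
  have n24 := hq.bd
  have m1 := B.h1.ne
  have m2 := B.h2.ne
  have m3 := B.h3.ne
  have m4 : x ≠ u := by rintro rfl; exact htf _ _ _ B.h2 B.h3 hq.bc.symm
  have m5 : y ≠ u := by rintro rfl; exact htf _ _ _ B.h1 B.h2 hq.ab.symm
  have m6 : x ≠ v4 := by rintro rfl; exact htf _ _ _ B.h2 B.h3 hq.cd
  have m7 : y ≠ v4 := by rintro rfl; exact htf _ _ _ B.h1 B.h2 hq.da
  have m8 : x ≠ v3 := by rintro rfl; exact htf _ _ _ hq.ab hq.bc B.h1.symm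
  have m9 : y ≠ v1 := by rintro rfl; exact htf _ _ _ hq.ab hq.bc B.h3.symm
  have m6' : x ≠ w4 := by rintro rfl; exact htf _ _ _ B.h2 B.h3 hq'.da.symm
  have m7' : y ≠ w4 := by rintro rfl; exact htf _ _ _ B.h1 B.h2 hq'.cd.symm
  have k1 : v1 ≠ v := by rintro rfl; exact huv hq.ab.symm
  have k3 : v3 ≠ v := by rintro rfl; exact huv hq.bc
  have kx : x ≠ v := by rintro rfl; exact htf _ _ _ B.hv B.h1.symm hq.da.symm
  have ky : y ≠ v := by rintro rfl; exact htf _ _ _ B.hv B.h3 hq.cd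
  have n14' := hq'.cd.ne
  have n34' := hq'.da.ne
  have n24' := hq'.bd
  have hC := pent_flow hq.ab hq.bc B.h3.symm B.h2.symm B.h1.symm
  obtain ⟨s, hsi, hs⟩ := hd.exists_norm hC i
  have hCv : ∀ v w, dl G f s v w = pent v1 u v3 y x v w := fun v w => by rw [hs]
  have C1 : ∀ w, w ≠ u → w ≠ x → dl G f s v1 w = 0 := by
    intro w h1 h2; rw [hCv]; simp [pent, dart, h1, h2, n12, n13, m9.symm, m1]
  have C3 : ∀ w, w ≠ u → w ≠ y → dl G f s v3 w = 0 := by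
    intro w h1 h2; rw [hCv]; simp [pent, dart, h1, h2, n23.symm, n13.symm, m3.symm, m8.symm]
  have Cx : ∀ w, w ≠ v1 → w ≠ y → dl G f s x w = 0 := by
    intro w h1 h2; rw [hCv]; simp [pent, dart, h1, h2, m2, m1.symm, m4, m8]
  have Cy : ∀ w, w ≠ v3 → w ≠ x → dl G f s y w = 0 := by
    intro w h1 h2; rw [hCv]; simp [pent, dart, h1, h2, m2.symm, m9, m5, m3]
  have C12 : dl G f s v1 u = 1 := by
    rw [hCv]; simp [pent, dart, n12, n13, m9.symm, m1, m4.symm]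
  have si' : s i' = 0 := by
    rw [dl, if_pos hq.ab, hq.f1.1, hq'.f2.1] at C12
    linarith
  have C14 := C1 v4 n24.symm m6.symm
  have C14' := C1 w4 n24'.symm m6'.symm
  by_cases h44 : w4 = v4
  · rw [dl, if_pos hq.da.symm, hq.f4.1, ← h44, hq'.f3.1] at C14
    linarith
  have hD : IsFlow G (fun a b => dart v1 v4 a b + dart v4 v a b + dart v w4 a b + dart w4 v1 a b) := by
    refine ⟨(((dart_chain hq.da.symm).add (dart_chain B.hv)).add (dart_chain B'.hv.symm)).add
      (dart_chain hq'.cd.symm), fun v => ?_⟩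
    simp only [Finset.sum_add_distrib, sum_dart]
    ring
  obtain ⟨r, hri, hr'⟩ := hd.exists_norm hD i
  have hDv : ∀ a b, dl G f r a b =
      dart v1 v4 a b + dart v4 v a b + dart v w4 a b + dart w4 v1 a b :=
    fun v w => (congrFun (congrFun hr' v) w).symm
  have hT := hd.isFlow (fun j => s j * r j)
  set T := dl G f (fun j => s j * r j) with hTd
  have D3 : ∀ w, dl G f r v3 w = 0 := by
    intro w; rw [hDv]; simp [dart, n13.symm, n34, k3, n34'.symm]
  have Dx : ∀ w, dl G f r x w = 0 := by
    intro w; rw [hDv]; simp [dart, m1.symm, m6, kx, m6']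
  have Dy : ∀ w, dl G f r y w = 0 := by
    intro w; rw [hDv]; simp [dart, m9, m7, ky, m7']
  have D1 : ∀ w, w ≠ v4 → w ≠ w4 → dl G f r v1 w = 0 := by
    intro w h1 h2; rw [hDv]; simp [dart, h1, h2, k1, n41.symm, n14']
  have D14 : dl G f r v1 v4 = 1 := by
    rw [hDv]; simp [dart, k1, n41.symm, n14', n41, Ne.symm h44]
  have D14' : dl G f r v1 w4 = -1 := by
    rw [hDv]; simp [dart, k1, n41.symm, n14', n41, h44]
  have anti := (dl_chain G f (fun j => s j * r j)).1
  rw [← hTd] at anti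
  have ri' : r i' = 1 := by
    have := D3 u
    rw [dl, if_pos hq.bc.symm, hq.f2.1, hq'.f1.1] at this
    linarith
  have T12 : T v1 u = 1 := by
    rw [hTd, dl, if_pos hq.ab, hq.f1.1, hq'.f2.1]
    beta_reduce
    rw [hsi, hri, si']; ring
  have T23 : T v3 u = -1 := by
    rw [hTd, dl, if_pos hq.bc.symm, hq.f2.1, hq'.f1.1]
    beta_reduce
    rw [hsi, hri, si']; ring
  have T14 : T v1 v4 = 1 := by
    rw [hTd, dl_mul_left C14, D14]
    rw [dl, if_pos hq.da.symm, hq.f4.1] at C14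
    linarith
  have T14' : T v1 w4 = 0 := by
    rw [hTd, dl_mul_left C14', D14', hq'.f3.1, si']; ring
  have e3 : T v3 y = 1 := by
    have := hT.2 v3
    rw [sum_eq_two u y m5.symm, T23] at this
    · linarith
    · intro w h1 h2
      exact dl_mul_zero (C3 w h1 h2) (D3 w)
  have e2 : T y x = 1 := by
    have := hT.2 y
    rw [sum_eq_two v3 x m8.symm, anti y v3, e3] at this
    · linarith
    · intro w h1 h2
      exact dl_mul_zero (Cy w h1 h2) (Dy w)
  have e1 : T x v1 = 1 := by
    have := hT.2 x
    rw [sum_eq_two v1 y m9.symm, anti x y, e2] at this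
    · linarith
    · intro w h1 h2
      exact dl_mul_zero (Cx w h1 h2) (Dx w)
  have := hT.2 v1
  rw [sum_eq_three u v4 x n24 m4.symm m6.symm, anti v1 x, e1, T12, T14] at this
  · norm_num at this
  · intro w h1 h2 h3
    by_cases hw : w = w4
    · rw [hw, T14']
    · exact dl_mul_zero (C1 w h1 h3) (D1 w h2 hw)

/-- at most one bad face at `u` -/
theorem bad_unique {F : Type} {f : V → V → F} (hd : IsDual G f)
    (htf : ∀ a b c, G.Adj a b → G.Adj b c → G.Adj c a → False) {u v : V} (huv : ¬ G.Adj u v)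
    {i i' : F} {v1 v3 v4 x y w1 w3 w4 x' y' : V} (B : Bad G f u v i v1 v3 v4 x y)
    (B' : Bad G f u v i' w1 w3 w4 x' y') : i = i' := by
  by_contra hne
  have hq := B.q
  have hq' := B'.q
  by_cases hA : w1 = v1 ∧ w3 = v3
  · obtain ⟨rfl, rfl⟩ := hA
    exact hne (hq.f1.1.symm.trans hq'.f1.1)
  by_cases hB : w1 = v3 ∧ w3 = v1
  · obtain ⟨rfl, rfl⟩ := hB
    exact bad_aux3 hd htf huv B B'
  have c1 : (v1 ≠ w1 ∧ v1 ≠ w3) ∨ (v3 ≠ w1 ∧ v3 ≠ w3) := by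
    have := hq.ac; have := hq'.ac; grind
  have c2 : (w1 ≠ v1 ∧ w1 ≠ v3) ∨ (w3 ≠ v1 ∧ w3 ≠ v3) := by
    have := hq.ac; have := hq'.ac; grind
  have c3 : v4 = x' ∨ v4 = y' := by
    rcases c1 with h | h
    · exact bad_aux1 hd htf huv B' hq.ab.symm hq.da.symm B.hv h.1 h.2
    · exact bad_aux1 hd htf huv B' hq.bc hq.cd B.hv h.1 h.2
  have b1 := B'.h1
  have b2 := B'.h2
  have b3 := B'.h3
  rcases c3 with h4 | h4 <;> simp only [← h4] at b1 b2 b3 <;> rcases c2 with h | h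
  · exact bad_aux2 hd htf B hq'.ab.symm h.1 h.2 (Or.inl b1)
  · exact bad_aux2 hd htf B hq'.bc h.1 h.2 (Or.inr ⟨_, b3.symm, b2.symm⟩)
  · exact bad_aux2 hd htf B hq'.ab.symm h.1 h.2 (Or.inr ⟨_, b1, b2⟩)
  · exact bad_aux2 hd htf B hq'.bc h.1 h.2 (Or.inl b3.symm)

end
end TorusThree

namespace TorusThree

open scoped Classical

/-! ### Part F: colouring with two identified vertices -/

section
variable {V : Type} [Fintype V] {G : SimpleGraph V}

lemma HasDual.induce (hG : HasDual G) (W : Finset V) :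
    HasDual (G.comap (Subtype.val : {z // z ∈ W} → V)) := by
  refine HasDual.minor hG (fun v => if h : v ∈ W then some ⟨v, h⟩ else none) (fun x _ => x.1) ?_ ?_
  · intro v w h1 h2
    by_cases hv : v ∈ W
    · by_cases hw : w ∈ W
      · rw [dif_pos hv, dif_pos hw] at h1
        have : v = w := by simpa using h1
        rw [this]
      · rw [dif_pos hv, dif_neg hw] at h1
        exact absurd h1 (by simp)
    · rw [dif_neg hv] at h2
      exact absurd rfl h2
  · intro x y h
    exact ⟨by simp, h⟩

def TF {V : Type} (G : SimpleGraph V) : Prop :=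
  ∀ a b c, G.Adj a b → G.Adj b c → G.Adj c a → False

def GoodCol {V : Type} (G : SimpleGraph V) (u v : V) : Prop :=
  ∃ c : V → Fin 3, (∀ a b, G.Adj a b → c a ≠ c b) ∧ c u = c v

def TIH (n : ℕ) : Prop := ∀ (W : Type) [Fintype W] (K : SimpleGraph W), Fintype.card W < n →
  HasDual K → TF K → ∀ u v, ¬ K.Adj u v → GoodCol K u v

lemma merge_col {u v : V} (huv : ¬ G.Adj u v) {S : Finset V} (hS : ∀ z, z ≠ v → z ∈ S)
    (hu : u ∈ S) (h : ColOn (mergeG G u v) S) : GoodCol G u v := by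
  obtain ⟨c, hc⟩ := h
  refine ⟨fun z => if z = v then c u else c z, ?_, ?_⟩
  · intro a b hab
    beta_reduce
    have hne := hab.ne
    by_cases ha : a = v
    · by_cases hb : b = v
      · exact absurd (ha.trans hb.symm) hne
      · rw [if_pos ha, if_neg hb]
        subst ha
        apply hc _ hu _ (hS b hb)
        refine ⟨?_, Or.inr (Or.inl ⟨rfl, hab⟩)⟩
        rintro rfl; exact huv hab.symm
    · by_cases hb : b = v
      · rw [if_neg ha, if_pos hb]
        subst hb
        apply hc _ (hS a ha) _ hu
        refine ⟨?_, Or.inr (Or.inr ⟨rfl, hab⟩)⟩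
        rintro rfl; exact huv hab
      · rw [if_neg ha, if_neg hb]
        exact hc _ (hS a ha) _ (hS b hb) ⟨hne, Or.inl hab⟩
  · by_cases h : u = v
    · simp [h]
    · simp [h]

/-- collapsing a quadrangular face -/
lemma collapse {F : Type} [Finite F] {f : V → V → F} (hd : IsDual G f) (htf : TF G)
    (IH : TIH (Fintype.card V)) {u v : V} (huv : ¬ G.Adj u v) (hcon : ¬ GoodCol G u v)
    {i : F} {a b c d : V} (hq : QF G f i a b c d) :
    (∃ x y, G.Adj a x ∧ G.Adj x y ∧ G.Adj y c) ∨
    ((u = a ∧ G.Adj v c) ∨ (u = c ∧ G.Adj v a) ∨ (v = a ∧ G.Adj u c) ∨ (v = c ∧ G.Adj u a)) := by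
  by_contra hno
  push Not at hno
  obtain ⟨hA, hB1, hB2, hB3, hB4⟩ := hno
  have hnac : ¬ G.Adj a c := fun h => htf _ _ _ hq.ab hq.bc h.symm
  have hD := HasDual.merge hd hq.ab hq.bc hq.ac hnac (hq.f1.1.trans hq.f2.1.symm)
  have hcard : Fintype.card {z // z ≠ c} < Fintype.card V :=
    Fintype.card_subtype_lt (x := c) (by simp)
  let ρ : V → {z // z ≠ c} := fun z => if h : z = c then ⟨a, hq.ac⟩ else ⟨z, h⟩
  have hρc : ∀ z, z = c → (ρ z).1 = a := by intro z hz; simp [ρ, hz]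
  have hρ : ∀ z, z ≠ c → (ρ z).1 = z := by intro z hz; simp [ρ, hz]
  have hadj : ∀ p q, G.Adj p q → ((mergeG G a c).comap (Subtype.val : {z // z ≠ c} → V)).Adj (ρ p) (ρ q) := by
    intro p q hpq
    have hne := hpq.ne
    change (ρ p).1 ≠ (ρ q).1 ∧ _
    by_cases hp : p = c
    · have hqc : q ≠ c := fun h => hne (hp.trans h.symm)
      rw [hρc p hp, hρ q hqc]
      subst hp
      refine ⟨?_, Or.inr (Or.inl ⟨rfl, hpq⟩)⟩
      rintro rfl; exact hnac hpq.symm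
    · rw [hρ p hp]
      by_cases hqc : q = c
      · rw [hρc q hqc]
        subst hqc
        refine ⟨?_, Or.inr (Or.inr ⟨rfl, hpq⟩)⟩
        rintro rfl; exact hnac hpq
      · rw [hρ q hqc]
        exact ⟨hne, Or.inl hpq⟩
  have hkey : ∀ q r : V, (G.Adj a q ∨ G.Adj c q) → (G.Adj a r ∨ G.Adj c r) → G.Adj q r → False := by
    intro q r h1 h2 h3
    rcases h1 with h1 | h1 <;> rcases h2 with h2 | h2
    · exact htf _ _ _ h1 h3 h2.symm
    · exact hA _ _ h1 h3 h2.symm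
    · exact hA _ _ h2 h3.symm h1.symm
    · exact htf _ _ _ h1 h3 h2.symm
  have hm1 : ∀ q, (mergeG G a c).Adj a q → G.Adj a q ∨ G.Adj c q := by
    rintro q ⟨hne, h | h | h⟩
    · exact Or.inl h
    · exact Or.inr h.2
    · exact absurd h.1.symm hne
  have hm2 : ∀ p q, p ≠ a → q ≠ a → (mergeG G a c).Adj p q → G.Adj p q := by
    rintro p q hp hq ⟨hne, h | h | h⟩
    · exact h
    · exact absurd h.1 hp
    · exact absurd h.1 hq
  have htf' : TF ((mergeG G a c).comap (Subtype.val : {z // z ≠ c} → V)) := by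
    rintro ⟨p, _⟩ ⟨q, _⟩ ⟨r, _⟩ h1 h2 h3
    change (mergeG G a c).Adj p q at h1
    change (mergeG G a c).Adj q r at h2
    change (mergeG G a c).Adj r p at h3
    by_cases hp : p = a
    · subst hp
      exact hkey q r (hm1 _ h1) (hm1 _ h3.symm) (hm2 _ _ h1.1.symm h3.1 h2)
    · by_cases hqa : q = a
      · subst hqa
        exact hkey r p (hm1 _ h2) (hm1 _ h1.symm) (hm2 _ _ h2.1.symm h1.1 h3)
      · by_cases hr : r = a
        · subst hr
          exact hkey p q (hm1 _ h3) (hm1 _ h2.symm) (hm2 _ _ h3.1.symm h2.1 h1)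
        · exact htf _ _ _ (hm2 _ _ hp hqa h1) (hm2 _ _ hqa hr h2) (hm2 _ _ hr hp h3)
  have huv' : ¬ ((mergeG G a c).comap (Subtype.val : {z // z ≠ c} → V)).Adj (ρ u) (ρ v) := by
    intro h
    change (mergeG G a c).Adj (ρ u).1 (ρ v).1 at h
    by_cases hu : u = c
    · have hvc : v ≠ c := by
        intro hv
        rw [hρc u hu, hρc v hv] at h
        exact h.1 rfl
      rw [hρc u hu, hρ v hvc] at h
      rcases hm1 _ h with h | h
      · exact hB2 hu h.symm
      · exact huv (hu ▸ h)
    · by_cases hv : v = c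
      · rw [hρc v hv, hρ u hu] at h
        rcases hm1 _ h.symm with h | h
        · exact hB4 hv h.symm
        · exact huv (hv ▸ h.symm)
      · rw [hρ u hu, hρ v hv] at h
        obtain ⟨_, h | h | h⟩ := h
        · exact huv h
        · exact hB1 h.1 h.2.symm
        · exact hB3 h.1 h.2
  obtain ⟨k, hk1, hk2⟩ := IH _ _ hcard hD htf' _ _ huv'
  exact hcon ⟨fun z => k (ρ z), fun p q h => hk1 _ _ (hadj p q h), hk2⟩

lemma face_AA {F : Type} {f : V → V → F} (hd : IsDual G f) (htf : TF G)
    {i : F} {v1 v2 v3 v4 : V} (hq : QF G f i v1 v2 v3 v4) {x y z w : V}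
    (h1 : G.Adj v1 x) (h2 : G.Adj x y) (h3 : G.Adj y v3)
    (g1 : G.Adj v2 z) (g2 : G.Adj z w) (g3 : G.Adj w v4) : False := by
  have k : ∀ z, ¬ (z = v1 ∨ z = x ∨ z = y ∨ z = v3) → z ∉ ({v1, x, y, v3} : Set V) := by
    intro z hz; simpa using hz
  have hu : v2 ∉ ({v1, x, y, v3} : Set V) := by
    apply k
    rintro (rfl | rfl | rfl | rfl)
    · exact hq.ab.ne rfl
    · exact htf _ _ _ h2 h3 hq.bc.symm
    · exact htf _ _ _ h1 h2 hq.ab.symm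
    · exact hq.bc.ne rfl
  have hz : z ∉ ({v1, x, y, v3} : Set V) := by
    apply k
    rintro (rfl | rfl | rfl | rfl)
    · exact htf _ _ _ g2 g3 hq.da
    · exact htf _ _ _ h1 g1.symm hq.ab.symm
    · exact htf _ _ _ h3 hq.bc.symm g1
    · exact htf _ _ _ g2 g3 hq.cd.symm
  have hw : w ∉ ({v1, x, y, v3} : Set V) := by
    apply k
    rintro (rfl | rfl | rfl | rfl)
    · exact htf _ _ _ g1 g2 hq.ab
    · exact htf _ _ _ h1 g3 hq.da
    · exact htf _ _ _ g3 hq.cd.symm h3.symm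
    · exact htf _ _ _ g1 g2 hq.bc.symm
  have h4 : v4 ∉ ({v1, x, y, v3} : Set V) := by
    apply k
    rintro (rfl | rfl | rfl | rfl)
    · exact hq.da.ne rfl
    · exact htf _ _ _ h2 h3 hq.cd
    · exact htf _ _ _ h1 h2 hq.da
    · exact hq.cd.ne rfl
  have e1 : (delG G {v1, x, y, v3}).Adj v2 z := ⟨g1, hu, hz⟩
  have e2 : (delG G {v1, x, y, v3}).Adj z w := ⟨g2, hz, hw⟩
  have e3 : (delG G {v1, x, y, v3}).Adj w v4 := ⟨g3, hw, h4⟩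
  exact sep hd htf hq h1 h2 h3 (e1.reachable.trans (e2.reachable.trans e3.reachable))

def BadAt {F : Type} (G : SimpleGraph V) (f : V → V → F) (u v : V) (i : F) : Prop :=
  ∃ v1 v3 v4 x y, Bad G f u v i v1 v3 v4 x y

lemma face_AB {F : Type} {f : V → V → F}
    {i : F} {v1 v2 v3 v4 u v : V} (hq : QF G f i v1 v2 v3 v4) {x y : V}
    (h1 : G.Adj v1 x) (h2 : G.Adj x y) (h3 : G.Adj y v3)
    (hB : (u = v2 ∧ G.Adj v v4) ∨ (u = v4 ∧ G.Adj v v2) ∨ (v = v2 ∧ G.Adj u v4) ∨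
      (v = v4 ∧ G.Adj u v2)) : BadAt G f u v i ∨ BadAt G f v u i := by
  rcases hB with ⟨rfl, h⟩ | ⟨rfl, h⟩ | ⟨rfl, h⟩ | ⟨rfl, h⟩
  · exact Or.inl ⟨_, _, _, _, _, ⟨hq, h1, h2, h3, h.symm⟩⟩
  · exact Or.inl ⟨_, _, _, _, _, ⟨hq.rot.rot, h3.symm, h2.symm, h1.symm, h.symm⟩⟩
  · exact Or.inr ⟨_, _, _, _, _, ⟨hq, h1, h2, h3, h.symm⟩⟩
  · exact Or.inr ⟨_, _, _, _, _, ⟨hq.rot.rot, h3.symm, h2.symm, h1.symm, h.symm⟩⟩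

lemma face_bad {F : Type} [Finite F] {f : V → V → F} (hd : IsDual G f) (htf : TF G)
    (IH : TIH (Fintype.card V)) {u v : V} (huv : ¬ G.Adj u v) (hcon : ¬ GoodCol G u v)
    {i : F} {v1 v2 v3 v4 : V} (hq : QF G f i v1 v2 v3 v4) :
    BadAt G f u v i ∨ BadAt G f v u i := by
  rcases collapse hd htf IH huv hcon hq with ⟨x, y, h1, h2, h3⟩ | hB
  · rcases collapse hd htf IH huv hcon hq.rot with ⟨z, w, g1, g2, g3⟩ | hB'
    · exact (face_AA hd htf hq h1 h2 h3 g1 g2 g3).elim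
    · exact face_AB hq h1 h2 h3 hB'
  · rcases collapse hd htf IH huv hcon hq.rot with ⟨z, w, g1, g2, g3⟩ | hB'
    · apply face_AB hq.rot g1 g2 g3
      tauto
    · exfalso
      have n1 := hq.ab
      have n2 := hq.bc
      have n3 := hq.cd
      have n4 := hq.da
      have m1 := n1.ne; have m2 := n2.ne; have m3 := n3.ne; have m4 := n4.ne
      have n1' := n1.symm
      have n2' := n2.symm
      have n3' := n3.symm
      have n4' := n4.symm
      rcases hB with ⟨e, _⟩ | ⟨e, _⟩ | ⟨e, _⟩ | ⟨e, _⟩ <;>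
      rcases hB' with ⟨e', _⟩ | ⟨e', _⟩ | ⟨e', _⟩ | ⟨e', _⟩ <;>
      subst e <;> first | (subst e'; exact absurd ‹_› huv) | (exact absurd e' (by first | assumption | (exact Ne.symm ‹_›)))

/-- Theorem T -/
theorem thmT_step (hG : HasDual G) (htf : TF G) (IH : TIH (Fintype.card V)) {u v : V}
    (huv : ¬ G.Adj u v) : GoodCol G u v := by
  by_contra hcon
  obtain ⟨F, hF, f, hd⟩ := hG
  have hG : HasDual G := ⟨F, hF, f, hd⟩
  have := Fintype.ofFinite F
  set S : Finset V := if u = v then Finset.univ else Finset.univ.erase v with hS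
  have hSv : ∀ z, z ≠ v → z ∈ S := by
    intro z hz; rw [hS]; split_ifs <;> simp [hz]
  have hSu : u ∈ S := by
    rw [hS]; split_ifs with h <;> simp [h]
  have hScard : Fintype.card V ≤ S.card + 1 := by
    rw [hS]; split_ifs with h
    · simp
    · rw [Finset.card_erase_of_mem (Finset.mem_univ _), Finset.card_univ]; omega
  have hnc : ¬ ColOn (mergeG G u v) S := fun h => hcon (merge_col huv hSv hSu h)
  obtain ⟨R, hRS, hRc, hRp⟩ := ky_main _ _ hnc
  have hR4 : 4 ≤ R.card := by
    by_contra h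
    exact hRc (colOn_of_card (by omega))
  have hcomap : ∀ W : Finset V, TF (G.comap (Subtype.val : {z // z ∈ W} → V)) := by
    intro W a b c h1 h2 h3
    exact htf _ _ _ h1 h2 h3
  have hsmall : ∀ W : Finset V, W ≠ Finset.univ → Fintype.card {z // z ∈ W} < Fintype.card V := by
    intro W hW
    rw [Fintype.card_coe]
    obtain ⟨x, hx⟩ : ∃ x, x ∉ W := by
      by_contra h
      exact hW (Finset.eq_univ_iff_forall.2 (by simpa using h))
    exact Finset.card_lt_univ_of_notMem hx
  have hW : insert u (insert v R) = Finset.univ := by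
    by_contra hne
    obtain ⟨c, hc, hcuv⟩ := IH _ _ (hsmall _ hne) (hG.induce _) (hcomap _) ⟨u, by simp⟩ ⟨v, by simp⟩ huv
    apply hRc
    refine ⟨fun z => if h : z ∈ insert u (insert v R) then c ⟨z, h⟩ else 0, ?_⟩
    intro a ha b hb hab
    have ha' : a ∈ insert u (insert v R) := by simp [ha]
    have hb' : b ∈ insert u (insert v R) := by simp [hb]
    beta_reduce
    rw [dif_pos ha', dif_pos hb']
    obtain ⟨_, h | ⟨rfl, h⟩ | ⟨rfl, h⟩⟩ := hab
    · exact hc _ _ h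
    · rw [hcuv]
      exact hc _ _ h
    · rw [hcuv]
      exact hc _ _ h
  have huR : u ∈ R := by
    by_contra hu
    have hne : R ≠ Finset.univ := by rintro rfl; simp at hu
    obtain ⟨r0, hr0⟩ : R.Nonempty := Finset.card_pos.1 (by omega)
    obtain ⟨c, hc, _⟩ := IH _ _ (hsmall _ hne) (hG.induce _) (hcomap _) ⟨r0, hr0⟩ ⟨r0, hr0⟩
      (SimpleGraph.irrefl _)
    apply hRc
    refine ⟨fun z => if h : z ∈ R then c ⟨z, h⟩ else 0, ?_⟩
    intro a ha b hb hab
    beta_reduce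
    rw [dif_pos ha, dif_pos hb]
    obtain ⟨_, h | ⟨rfl, h⟩ | ⟨rfl, h⟩⟩ := hab
    · exact hc _ _ h
    · exact absurd ha hu
    · exact absurd hb hu
  have hRS' : R = S := by
    apply Finset.Subset.antisymm hRS
    intro z hz
    have hz' : z ∈ insert u (insert v R) := by rw [hW]; simp
    simp only [Finset.mem_insert] at hz'
    rcases hz' with rfl | rfl | h
    · exact huR
    · by_cases h : u = z
      · exact h ▸ huR
      · rw [hS, if_neg h] at hz
        simp at hz
    · exact h
  have hcr : cr (mergeG G u v) R R ≤ cr G Finset.univ Finset.univ := by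
    by_cases h : u = v
    · have hle : mergeG G u v ≤ G := by
        subst h
        rintro p q ⟨_, h | ⟨rfl, h⟩ | ⟨rfl, h⟩⟩ <;> exact h
      have hRu : R = Finset.univ := by rw [hRS', hS, if_pos h]
      rw [hRu]
      exact cr_mono_graph hle _ _
    · have hRu : R = Finset.univ.erase v := by rw [hRS', hS, if_neg h]
      have hv : v ∉ R := by rw [hRu]; simp
      have hun : Finset.univ = insert v R := by
        rw [hRu, Finset.insert_erase (Finset.mem_univ _)]
      rw [hun, cr_insert_self hv]
      exact cr_merge_le huR
  have hV4 : 4 ≤ Fintype.card V := hR4.trans (Finset.card_le_univ R)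
  obtain ⟨Q, hQ, hE⟩ := euler hd htf hV4
  have hQ2 : Q.card ≤ 2 := by
    have h1 : Q ⊆ Q.filter (BadAt G f u v) ∪ Q.filter (BadAt G f v u) := by
      intro i hi
      obtain ⟨a, b, c, d, hq⟩ := hQ i hi
      rw [← Finset.filter_or, Finset.mem_filter]
      exact ⟨hi, face_bad hd htf IH huv hcon hq⟩
    have h2 : ∀ p q : V, ¬ G.Adj p q → (Q.filter (BadAt G f p q)).card ≤ 1 := by
      intro p q hpq
      rw [Finset.card_le_one]
      intro i hi j hj
      obtain ⟨_, _, _, _, _, _, hi⟩ := Finset.mem_filter.1 hi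
      obtain ⟨_, _, _, _, _, _, hj⟩ := Finset.mem_filter.1 hj
      exact bad_unique hd htf hpq hi hj
    calc Q.card ≤ _ := Finset.card_le_card h1
      _ ≤ _ := Finset.card_union_le _ _
      _ ≤ 1 + 1 := add_le_add (h2 u v huv) (h2 v u (fun h => huv h.symm))
  have : R.card = S.card := by rw [hRS']
  omega

end

theorem thmT_aux (n : ℕ) : TIH n := by
  induction n with
  | zero => intro W _ K h; omega
  | succ n ih =>
    intro W _ K h hD htf u v huv
    refine thmT_step hD htf (fun W' _ K' h' => ih W' K' (by omega)) huv

theorem thmT {V : Type} [Fintype V] {G : SimpleGraph V} (hG : HasDual G) (htf : TF G) {u v : V}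
    (huv : ¬ G.Adj u v) : GoodCol G u v :=
  thmT_aux (Fintype.card V + 1) V G (by omega) hG htf u v huv

end TorusThree

namespace TorusThree

open scoped Classical

/-! ### Part G: the toroidal grid with an essential walk removed -/

lemma int_const {D : ℤ → ℚ} (h : ∀ i, D i = D (i - 1)) (i : ℤ) : D i = D 0 := by
  induction i with
  | zero => rfl
  | succ k ih => rw [h, ← ih]; congr 1; ring
  | pred k ih => rw [← ih, h (-(k : ℤ))]

lemma int_prim (g : ℤ → ℚ) : ∃ A : ℤ → ℚ, A 0 = 0 ∧ ∀ i, A i - A (i - 1) = g i := by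
  refine ⟨fun i => ∑ k ∈ Finset.range i.toNat, g (k + 1) -
    ∑ k ∈ Finset.range (-i).toNat, g (-k), by simp, fun i => ?_⟩
  beta_reduce
  rcases le_or_gt 1 i with hi | hi
  · have e1 : i.toNat = (i - 1).toNat + 1 := by omega
    have e2 : (-i).toNat = 0 := by omega
    have e3 : (-(i - 1)).toNat = 0 := by omega
    have e4 : (((i - 1).toNat : ℤ) + 1) = i := by omega
    rw [e1, e2, e3, Finset.sum_range_succ, e4]
    ring
  · have e1 : (-(i - 1)).toNat = (-i).toNat + 1 := by omega
    have e2 : i.toNat = 0 := by omega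
    have e3 : (i - 1).toNat = 0 := by omega
    have e4 : (-((-i).toNat : ℤ)) = i := by omega
    rw [e1, e2, e3, Finset.sum_range_succ, e4]
    ring

lemma int_potential (h v : ℤ → ℤ → ℚ)
    (hdiv : ∀ i j, h i j - h (i - 1) j + v i j - v i (j - 1) = 0) :
    ∃ S : ℤ → ℤ → ℚ, (∀ i j, S i j - S i (j - 1) = h i j) ∧
      (∀ i j, S (i - 1) j - S i j = v i j) := by
  obtain ⟨A, _, hA⟩ := int_prim (fun i => - v i 0)
  choose B hB0 hB using fun i => int_prim (fun j => h i j)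
  refine ⟨fun i j => A i + B i j, fun i j => ?_, fun i j => ?_⟩
  · linarith [hB i j]
  · have key := int_const (D := fun j => (A (i - 1) + B (i - 1) j) - (A i + B i j) - v i j) (by
      intro j
      linarith [hdiv i j, hB i j, hB (i - 1) j]) j
    have h0 := hA i
    simp only [hB0] at key
    linarith

section
variable {N : ℕ}

def E1 (N : ℕ) : ZMod N × ZMod N := (1, 0)
def E2 (N : ℕ) : ZMod N × ZMod N := (0, 1)

lemma one_ne_zero_zmod (hN : 3 ≤ N) : (1 : ZMod N) ≠ 0 := by
  have : Fact (1 < N) := ⟨by omega⟩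
  exact one_ne_zero

lemma one_ne_neg_one_zmod (hN : 3 ≤ N) : (1 : ZMod N) ≠ -1 := by
  intro h
  have h2 : ((2 : ℕ) : ZMod N) = 0 := by
    push_cast
    linear_combination h
  rw [ZMod.natCast_eq_zero_iff] at h2
  have := Nat.le_of_dvd (by norm_num) h2
  omega

/-- the toroidal grid -/
def grid (N : ℕ) (hN : 3 ≤ N) : SimpleGraph (ZMod N × ZMod N) where
  Adj p q := q = p + E1 N ∨ q = p - E1 N ∨ q = p + E2 N ∨ q = p - E2 N
  symm := ⟨by
    rintro p q (rfl | rfl | rfl | rfl)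
    · right; left; simp
    · left; simp
    · right; right; right; simp
    · right; right; left; simp⟩
  loopless := ⟨by
    have := one_ne_zero_zmod hN
    rintro p (h | h | h | h) <;> simp [E1, E2, this, Prod.ext_iff, sub_eq_add_neg] at h⟩

/-- left faces -/
def gf (p q : ZMod N × ZMod N) : ZMod N × ZMod N :=
  if q = p + E1 N then p else if q = p + E2 N then p - E1 N
  else if q = p - E1 N then p - E1 N - E2 N else p - E2 N

lemma gdist (hN : 3 ≤ N) : E1 N ≠ E2 N ∧ E1 N ≠ - E1 N ∧ E1 N ≠ -E2 N ∧ E2 N ≠ - E1 N ∧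
    E2 N ≠ - E2 N ∧ - E1 N ≠ - E2 N := by
  have h1 := one_ne_zero_zmod hN
  have h2 := one_ne_neg_one_zmod hN
  refine ⟨?_, ?_, ?_, ?_, ?_, ?_⟩ <;> simp [E1, E2, Prod.ext_iff, h1, h2, h1.symm]

variable [NeZero N]

lemma gf1 (p : ZMod N × ZMod N) : gf p (p + E1 N) = p := by simp [gf]
lemma gf2 (hN : 3 ≤ N) (p : ZMod N × ZMod N) : gf p (p + E2 N) = p - E1 N := by
  simp [gf, (gdist hN).1.symm]
lemma gf3 (hN : 3 ≤ N) (p : ZMod N × ZMod N) : gf p (p - E1 N) = p - E1 N - E2 N := by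
  have := gdist hN
  simp [gf, sub_eq_add_neg, this.2.1.symm, this.2.2.2.1.symm]
lemma gf4 (hN : 3 ≤ N) (p : ZMod N × ZMod N) : gf p (p - E2 N) = p - E2 N := by
  have := gdist hN
  simp [gf, sub_eq_add_neg, this.2.2.1.symm, this.2.2.2.2.1.symm, this.2.2.2.2.2.symm]

lemma gsum (hN : 3 ≤ N) (p : ZMod N × ZMod N) (g : ZMod N × ZMod N → ℚ)
    (hg : ∀ q, ¬ (grid N hN).Adj p q → g q = 0) :
    ∑ q, g q = g (p + E1 N) + g (p - E1 N) + g (p + E2 N) + g (p - E2 N) := by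
  obtain ⟨d1, d2, d3, d4, d5, d6⟩ := gdist hN
  have : ∑ q ∈ ({p + E1 N, p - E1 N, p + E2 N, p - E2 N} : Finset (ZMod N × ZMod N)), g q =
      g (p + E1 N) + g (p - E1 N) + g (p + E2 N) + g (p - E2 N) := by
    rw [Finset.sum_insert, Finset.sum_insert, Finset.sum_pair]
    · ring
    · simpa [sub_eq_add_neg] using d5
    · simp [sub_eq_add_neg, d4.symm, d6]
    · simp [sub_eq_add_neg, d1, d2, d3]
  rw [← this]
  symm
  apply Finset.sum_subset (Finset.subset_univ _)
  intro q _ hq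
  apply hg
  intro h
  apply hq
  simpa [grid] using h

/-- periods -/
def Sg1 (c : ZMod N × ZMod N → ZMod N × ZMod N → ℚ) : ℚ := ∑ p, c p (p + E1 N)
def Sg2 (c : ZMod N × ZMod N → ZMod N × ZMod N → ℚ) : ℚ := ∑ p, c p (p + E2 N)

lemma sum_range_zmod (g : ZMod N → ℚ) : ∑ k ∈ Finset.range N, g (k : ZMod N) = ∑ z, g z := by
  refine Finset.sum_bij' (fun k _ => (k : ZMod N)) (fun z _ => z.val) ?_ ?_ ?_ ?_ ?_
  · simp
  · intro z _; simpa using ZMod.val_lt z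
  · intro k hk; exact ZMod.val_cast_of_lt (by simpa using hk)
  · intro z _; simp
  · simp

/-- cast of lattice points -/
def gc (N : ℕ) (i j : ℤ) : ZMod N × ZMod N := ((i : ZMod N), (j : ZMod N))

lemma telesc (A g : ℤ → ℚ) (h : ∀ j, A j - A (j - 1) = g j) (j : ℤ) (n : ℕ) :
    A (j + n) - A j = ∑ k ∈ Finset.range n, g (j + k + 1) := by
  induction n with
  | zero => simp
  | succ n ih =>
    rw [Finset.sum_range_succ, ← ih, ← h]
    have e1 : j + (n : ℤ) + 1 - 1 = j + n := by ring
    have e2 : j + ((n + 1 : ℕ) : ℤ) = j + n + 1 := by push_cast; ring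
    rw [e1, e2]; ring

/-- quasi-periodic potential of a flow on the grid -/
lemma grid_pot (hN : 3 ≤ N) {c : ZMod N × ZMod N → ZMod N × ZMod N → ℚ}
    (hc : IsFlow (grid N hN) c) : ∃ S : ℤ → ℤ → ℚ,
      (∀ i j, S i j - S i (j - 1) = c (gc N i j) (gc N i j + E1 N)) ∧
      (∀ i j, S (i - 1) j - S i j = c (gc N i j) (gc N i j + E2 N)) ∧
      (∀ i j, S (i + N) j = S i j - Sg2 c / N) ∧ (∀ i j, S i (j + N) = S i j + Sg1 c / N) := by
  have hg1 : ∀ i j, gc N (i - 1) j + E1 N = gc N i j := by intro i j; simp [gc, E1]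
  have hg2 : ∀ i j, gc N i (j - 1) + E2 N = gc N i j := by intro i j; simp [gc, E2]
  have hN0 : (N : ℚ) ≠ 0 := by positivity
  obtain ⟨S, hS1, hS2⟩ := int_potential (fun i j => c (gc N i j) (gc N i j + E1 N))
    (fun i j => c (gc N i j) (gc N i j + E2 N)) (by
      intro i j
      have h := hc.2 (gc N i j)
      rw [gsum hN (gc N i j) _ (fun q hq => hc.1.2 _ q hq)] at h
      have e1 : gc N i j - E1 N = gc N (i - 1) j := by rw [← hg1]; simp
      have e2 : gc N i j - E2 N = gc N i (j - 1) := by rw [← hg2]; simp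
      rw [e1, e2, hc.1.1 _ (gc N (i - 1) j), hc.1.1 _ (gc N i (j - 1))] at h
      rw [hg1, hg2]
      linarith)
  refine ⟨S, hS1, hS2, ?_, ?_⟩
  · have hp : ∀ i j, gc N (i + N) j = gc N i j := by intro i j; simp [gc]
    have hcst : ∀ i j, S (i + N) j - S i j = S (0 + N) 0 - S 0 0 := by
      intro i j
      have k1 := int_const (D := fun j => S (i + N) j - S i j) (by
        intro j
        have h1 := hS1 (i + N) j
        have h2 := hS1 i j
        rw [hp] at h1
        linarith) j
      have k2 := int_const (D := fun i => S (i + N) 0 - S i 0) (by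
        intro i
        have h1 := hS2 (i + N) 0
        have h2 := hS2 i 0
        rw [hp] at h1
        have e : i + (N : ℤ) - 1 = i - 1 + N := by ring
        rw [e] at h1
        linarith) i
      exact k1.trans k2
    have htot : (N : ℚ) * (S (0 + N) 0 - S 0 0) = - Sg2 c := by
      have h1 : ∀ j : ℤ, S (0 + N) 0 - S 0 0 =
          - ∑ z : ZMod N, c (z, (j : ZMod N)) ((z, (j : ZMod N)) + E2 N) := by
        intro j
        rw [← hcst 0 j, telesc (fun i => S i j) (fun i => - c (gc N i j) (gc N i j + E2 N))
          (fun i => by linarith [hS2 i j]) 0 N, Finset.sum_neg_distrib]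
        congr 1
        rw [← Equiv.sum_comp (Equiv.addRight (1 : ZMod N)), ← sum_range_zmod]
        refine Finset.sum_congr rfl fun k _ => ?_
        simp [gc]
      have h2 : ∑ z : ZMod N, ∑ w : ZMod N, c (w, z) ((w, z) + E2 N) = Sg2 c := by
        unfold Sg2
        rw [Fintype.sum_prod_type_right]
      rw [← h2, ← sum_range_zmod, ← Finset.sum_neg_distrib]
      have h3 : ∀ k ∈ Finset.range N, - ∑ w : ZMod N, c (w, (k : ZMod N)) ((w, (k : ZMod N)) + E2 N)
          = S (0 + N) 0 - S 0 0 := by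
        intro k _
        rw [h1 k]; simp
      rw [Finset.sum_congr rfl h3, Finset.sum_const, Finset.card_range, nsmul_eq_mul]
    intro i j
    have h4 := hcst i j
    rw [← h4] at htot
    field_simp
    linarith
  · have hp : ∀ i j, gc N i (j + N) = gc N i j := by intro i j; simp [gc]
    have hcst : ∀ i j, S i (j + N) - S i j = S 0 (0 + N) - S 0 0 := by
      intro i j
      have k1 := int_const (D := fun i => S i (j + N) - S i j) (by
        intro i
        have h1 := hS2 i (j + N)
        have h2 := hS2 i j
        rw [hp] at h1
        linarith) i
      have k2 := int_const (D := fun j => S 0 (j + N) - S 0 j) (by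
        intro j
        have h1 := hS1 0 (j + N)
        have h2 := hS1 0 j
        rw [hp] at h1
        have e : j + (N : ℤ) - 1 = j - 1 + N := by ring
        rw [e] at h1
        linarith) j
      exact k1.trans k2
    have htot : (N : ℚ) * (S 0 (0 + N) - S 0 0) = Sg1 c := by
      have h1 : ∀ i : ℤ, S 0 (0 + N) - S 0 0 =
          ∑ z : ZMod N, c ((i : ZMod N), z) (((i : ZMod N), z) + E1 N) := by
        intro i
        rw [← hcst i 0, telesc (fun j => S i j) (fun j => c (gc N i j) (gc N i j + E1 N))
          (fun j => by linarith [hS1 i j]) 0 N]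
        rw [← Equiv.sum_comp (Equiv.addRight (1 : ZMod N)), ← sum_range_zmod]
        refine Finset.sum_congr rfl fun k _ => ?_
        simp [gc]
      have h2 : ∑ z : ZMod N, ∑ w : ZMod N, c (z, w) ((z, w) + E1 N) = Sg1 c := by
        unfold Sg1
        rw [Fintype.sum_prod_type]
      rw [← h2, ← sum_range_zmod]
      have h3 : ∀ k ∈ Finset.range N, ∑ w : ZMod N, c ((k : ZMod N), w) (((k : ZMod N), w) + E1 N)
          = S 0 (0 + N) - S 0 0 := by
        intro k _
        rw [h1 k]; simp
      rw [Finset.sum_congr rfl h3, Finset.sum_const, Finset.card_range, nsmul_eq_mul]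
    intro i j
    have h4 := hcst i j
    rw [← h4] at htot
    field_simp
    linarith

lemma quasi_mul {A : ℤ → ℚ} {t : ℚ} (n : ℤ) (h : ∀ i, A (i + n) = A i + t) (a i : ℤ) :
    A (i + a * n) = A i + a * t := by
  have := int_const (D := fun a => A (i + a * n) - a * t) (by
    intro a
    have := h (i + (a - 1) * n)
    have e : i + (a - 1) * n + n = i + a * n := by ring
    rw [e] at this
    push_cast
    linarith) a
  simp at this
  linarith

lemma gadj (hN : 3 ≤ N) (p : ZMod N × ZMod N) : (grid N hN).Adj p (p + E1 N) ∧
    (grid N hN).Adj p (p + E2 N) := ⟨Or.inl rfl, Or.inr (Or.inr (Or.inl rfl))⟩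

/-- flows without periods are coboundaries -/
lemma grid_pot0 (hN : 3 ≤ N) {c : ZMod N × ZMod N → ZMod N × ZMod N → ℚ}
    (hc : IsFlow (grid N hN) c) (h1 : Sg1 c = 0) (h2 : Sg2 c = 0) :
    ∃ s : ZMod N × ZMod N → ℚ, ∀ p q, (grid N hN).Adj p q → c p q = s (gf p q) - s (gf q p) := by
  obtain ⟨S, hS1, hS2, hS3, hS4⟩ := grid_pot hN hc
  rw [h2] at hS3
  rw [h1] at hS4
  have hper : ∀ i j : ℤ, S ((i : ZMod N).val) ((j : ZMod N).val) = S i j := by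
    intro i j
    rw [ZMod.val_intCast, ZMod.val_intCast]
    have e1 := quasi_mul (A := fun i => S i (j % N)) (t := 0) N (by intro i; rw [hS3]; ring) (i / N) (i % N)
    have e2 := quasi_mul (A := fun j => S i j) (t := 0) N (by intro i; rw [hS4]; ring) (j / N) (j % N)
    have e3 : i % N + i / N * N = i := by rw [mul_comm]; exact Int.emod_add_mul_ediv i N
    have e4 : j % N + j / N * N = j := by rw [mul_comm]; exact Int.emod_add_mul_ediv j N
    simp only [e3, e4, mul_zero, add_zero] at e1 e2
    rw [← e1, ← e2]
  have hp : ∀ p : ZMod N × ZMod N, ∃ i j : ℤ, p = gc N i j := by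
    rintro ⟨x, y⟩
    exact ⟨x.val, y.val, by simp [gc]⟩
  let s : ZMod N × ZMod N → ℚ := fun p => S p.1.val p.2.val
  have hs : ∀ i j, s (gc N i j) = S i j := hper
  have g1 : ∀ i j, gc N i j - E1 N = gc N (i - 1) j := by intro i j; simp [gc, E1]
  have g2 : ∀ i j, gc N i j - E2 N = gc N i (j - 1) := by intro i j; simp [gc, E2]
  have k1 : ∀ p, c p (p + E1 N) = s p - s (p - E2 N) := by
    intro p
    obtain ⟨i, j, rfl⟩ := hp p
    rw [← hS1, g2, hs, hs]
  have k2 : ∀ p, c p (p + E2 N) = s (p - E1 N) - s p := by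
    intro p
    obtain ⟨i, j, rfl⟩ := hp p
    rw [← hS2, g1, hs, hs]
  have m1 : ∀ p, c p (p + E1 N) = s (gf p (p + E1 N)) - s (gf (p + E1 N) p) := by
    intro p
    have := gf3 hN (p + E1 N)
    rw [add_sub_cancel_right] at this
    rw [gf1, this, k1]
  have m2 : ∀ p, c p (p + E2 N) = s (gf p (p + E2 N)) - s (gf (p + E2 N) p) := by
    intro p
    have := gf4 hN (p + E2 N)
    rw [add_sub_cancel_right] at this
    rw [gf2 hN, this, k2]
  refine ⟨s, ?_⟩
  rintro p q (rfl | rfl | rfl | rfl)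
  · exact m1 p
  · have := m1 (p - E1 N)
    rw [sub_add_cancel] at this
    rw [hc.1.1, this]; ring
  · exact m2 p
  · have := m2 (p - E2 N)
    rw [sub_add_cancel] at this
    rw [hc.1.1, this]; ring

/-- lattice steps inside the preimage of `W` -/
def lstep (N : ℕ) (W : Set (ZMod N × ZMod N)) (p q : ℤ × ℤ) : Prop :=
  gc N p.1 p.2 ∈ W ∧ gc N q.1 q.2 ∈ W ∧
    (q = p + (1, 0) ∨ p = q + (1, 0) ∨ q = p + (0, 1) ∨ p = q + (0, 1))

lemma Sg1_dart (a b : ZMod N × ZMod N) : Sg1 (dart a b) =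
    (if a + E1 N = b then 1 else 0) - (if b + E1 N = a then 1 else 0) := by
  unfold Sg1 dart
  rw [Finset.sum_sub_distrib]
  congr 1
  · refine (Finset.sum_eq_single a (fun x _ hx => if_neg (fun h => hx h.1))
      (fun h => absurd (Finset.mem_univ a) h)).trans ?_
    simp only [true_and]
  · refine (Finset.sum_eq_single b (fun x _ hx => if_neg (fun h => hx h.1))
      (fun h => absurd (Finset.mem_univ b) h)).trans ?_
    simp only [true_and]

lemma Sg2_dart (a b : ZMod N × ZMod N) : Sg2 (dart a b) =
    (if a + E2 N = b then 1 else 0) - (if b + E2 N = a then 1 else 0) := by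
  unfold Sg2 dart
  rw [Finset.sum_sub_distrib]
  congr 1
  · refine (Finset.sum_eq_single a (fun x _ hx => if_neg (fun h => hx h.1))
      (fun h => absurd (Finset.mem_univ a) h)).trans ?_
    simp only [true_and]
  · refine (Finset.sum_eq_single b (fun x _ hx => if_neg (fun h => hx h.1))
      (fun h => absurd (Finset.mem_univ b) h)).trans ?_
    simp only [true_and]

/-- the chain of a walk in `W` -/
lemma walk_chain (hN : 3 ≤ N) {W : Set (ZMod N × ZMod N)} {p0 p : ℤ × ℤ}
    (h : Relation.ReflTransGen (lstep N W) p0 p) :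
    ∃ g : ZMod N × ZMod N → ZMod N × ZMod N → ℚ, IsChain (grid N hN) g ∧
      (∀ x y, g x y ≠ 0 → x ∈ W ∧ y ∈ W) ∧
      (∀ x, ∑ y, g x y = (if x = gc N p0.1 p0.2 then 1 else 0) - (if x = gc N p.1 p.2 then 1 else 0)) ∧
      Sg1 g = p.1 - p0.1 ∧ Sg2 g = p.2 - p0.2 := by
  obtain ⟨d1, d2, d3, d4, d5, d6⟩ := gdist hN
  have n0 : ∀ (x a b : ZMod N × ZMod N), a ≠ -b → x + a + b ≠ x := by
    intro x a b hab h
    apply hab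
    linear_combination (exp := 1) h
  have n1 : ∀ x, x + E1 N + E1 N ≠ x := fun x => n0 x _ _ d2
  have n2 : ∀ x, x + E1 N ≠ x + E2 N := fun x h => d1 (add_left_cancel h)
  have n3 : ∀ x, x + E2 N + E1 N ≠ x := fun x => n0 x _ _ d4
  have n4 : ∀ x, x + E2 N + E2 N ≠ x := fun x => n0 x _ _ d5
  have n5 : ∀ x, x + E1 N + E2 N ≠ x := fun x => n0 x _ _ d3
  induction h with
  | refl =>
    refine ⟨fun _ _ => 0, ⟨by simp, by simp⟩, by simp, by simp, by simp [Sg1], by simp [Sg2]⟩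
  | @tail q r _ hqr ih =>
    obtain ⟨g, hg, hgW, hgd, hg1, hg2⟩ := ih
    obtain ⟨hq, hr, hst⟩ := hqr
    have hadj : (grid N hN).Adj (gc N q.1 q.2) (gc N r.1 r.2) := by
      rcases hst with rfl | rfl | rfl | rfl
      · left; simp [gc, E1]
      · right; left; simp [gc, E1]
      · right; right; left; simp [gc, E2]
      · right; right; right; simp [gc, E2]
    refine ⟨fun x y => g x y + dart (gc N q.1 q.2) (gc N r.1 r.2) x y, hg.add (dart_chain hadj), ?_,
      ?_, ?_, ?_⟩
    · intro x y hxy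
      by_cases h0 : g x y = 0
      · beta_reduce at hxy
        rw [h0, zero_add] at hxy
        have h1 : s(x, y) = s(gc N q.1 q.2, gc N r.1 r.2) := by
          by_contra h; exact hxy (dart_zero h)
        rcases Sym2.eq_iff.1 h1 with ⟨rfl, rfl⟩ | ⟨rfl, rfl⟩
        · exact ⟨hq, hr⟩
        · exact ⟨hr, hq⟩
      · exact hgW x y h0
    · intro x
      rw [Finset.sum_add_distrib, hgd, sum_dart]; ring
    · have : Sg1 (fun x y => g x y + dart (gc N q.1 q.2) (gc N r.1 r.2) x y) =
          Sg1 g + Sg1 (dart (gc N q.1 q.2) (gc N r.1 r.2)) := by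
        simp only [Sg1, Finset.sum_add_distrib]
      rw [this, hg1]
      have hd : Sg1 (dart (gc N q.1 q.2) (gc N r.1 r.2)) = (r.1 : ℚ) - q.1 := by
        rw [Sg1_dart]
        rcases hst with rfl | rfl | rfl | rfl
        · have e : gc N (q + (1, 0)).1 (q + (1, 0)).2 = gc N q.1 q.2 + E1 N := by simp [gc, E1]
          rw [e, if_pos rfl, if_neg (n1 _)]
          simp
        · have e : gc N (r + (1, 0)).1 (r + (1, 0)).2 = gc N r.1 r.2 + E1 N := by simp [gc, E1]
          rw [e, if_neg (n1 _), if_pos rfl]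
          simp
        · have e : gc N (q + (0, 1)).1 (q + (0, 1)).2 = gc N q.1 q.2 + E2 N := by simp [gc, E2]
          rw [e, if_neg (n2 _), if_neg (n3 _)]
          simp
        · have e : gc N (r + (0, 1)).1 (r + (0, 1)).2 = gc N r.1 r.2 + E2 N := by simp [gc, E2]
          rw [e, if_neg (n3 _), if_neg (n2 _)]
          simp
      rw [hd]; ring
    · have : Sg2 (fun x y => g x y + dart (gc N q.1 q.2) (gc N r.1 r.2) x y) =
          Sg2 g + Sg2 (dart (gc N q.1 q.2) (gc N r.1 r.2)) := by
        simp only [Sg2, Finset.sum_add_distrib]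
      rw [this, hg2]
      have hd : Sg2 (dart (gc N q.1 q.2) (gc N r.1 r.2)) = (r.2 : ℚ) - q.2 := by
        rw [Sg2_dart]
        rcases hst with rfl | rfl | rfl | rfl
        · have e : gc N (q + (1, 0)).1 (q + (1, 0)).2 = gc N q.1 q.2 + E1 N := by simp [gc, E1]
          rw [e, if_neg (fun h => n2 _ h.symm), if_neg (n5 _)]
          simp
        · have e : gc N (r + (1, 0)).1 (r + (1, 0)).2 = gc N r.1 r.2 + E1 N := by simp [gc, E1]
          rw [e, if_neg (n5 _), if_neg (fun h => n2 _ h.symm)]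
          simp
        · have e : gc N (q + (0, 1)).1 (q + (0, 1)).2 = gc N q.1 q.2 + E2 N := by simp [gc, E2]
          rw [e, if_pos rfl, if_neg (n4 _)]
          simp
        · have e : gc N (r + (0, 1)).1 (r + (0, 1)).2 = gc N r.1 r.2 + E2 N := by simp [gc, E2]
          rw [e, if_neg (n4 _), if_pos rfl]
          simp
      rw [hd]; ring


/-- the dual of the grid minus `W` -/
theorem host (hN : 3 ≤ N) (W : Set (ZMod N × ZMod N)) (p0 : ℤ × ℤ) (a b : ℤ)
    (hab : a ≠ 0 ∨ b ≠ 0)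
    (h : Relation.ReflTransGen (lstep N W) p0 (p0.1 + a * N, p0.2 + b * N)) :
    HasDual (delG (grid N hN) W) := by
  have hN0 : (N : ℚ) ≠ 0 := by positivity
  let r : ZMod N × ZMod N → ZMod N × ZMod N → Prop := fun x y =>
    ∃ p q, (grid N hN).Adj p q ∧ p ∈ W ∧ q ∉ W ∧ x = gf p q ∧ y = gf q p
  refine ⟨Quot r, Quot.finite r, fun p q => Quot.mk r (gf p q), ⟨?_, ?_⟩⟩
  · intro s p
    by_cases hp : p ∈ W
    · refine Finset.sum_eq_zero fun q _ => ?_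
      rw [dl, if_neg]
      exact fun h => h.2.1 hp
    · have hz : ∀ q, dl (delG (grid N hN) W) (fun p q => Quot.mk r (gf p q)) s p q =
          dl (grid N hN) gf (fun x => s (Quot.mk r x)) p q := by
        intro q
        unfold dl
        by_cases hq : q ∈ W
        · rw [if_neg (fun h => h.2.2 hq)]
          split_ifs with hpq
          · have : Quot.mk r (gf q p) = Quot.mk r (gf p q) :=
              Quot.sound ⟨q, p, hpq.symm, hq, hp, rfl, rfl⟩
            beta_reduce
            rw [this, sub_self]
          · rfl
        · by_cases hpq : (grid N hN).Adj p q
          · rw [if_pos hpq, if_pos ⟨hpq, hp, hq⟩]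
          · rw [if_neg hpq, if_neg (fun h => hpq h.1)]
      simp only [hz]
      rw [gsum hN p _ (fun q hq => by rw [dl, if_neg hq])]
      have a1 := (gadj hN p).1
      have a2 := (gadj hN p).2
      have a3 : (grid N hN).Adj p (p - E1 N) := Or.inr (Or.inl rfl)
      have a4 : (grid N hN).Adj p (p - E2 N) := Or.inr (Or.inr (Or.inr rfl))
      unfold dl
      rw [if_pos a1, if_pos a2, if_pos a3, if_pos a4, gf1, gf2 hN, gf3 hN, gf4 hN]
      have b1 := gf3 hN (p + E1 N)
      rw [add_sub_cancel_right] at b1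
      have b2 := gf4 hN (p + E2 N)
      rw [add_sub_cancel_right] at b2
      have b3 := gf1 (p - E1 N)
      rw [sub_add_cancel] at b3
      have b4 := gf2 hN (p - E2 N)
      rw [sub_add_cancel] at b4
      rw [b1, b2, b3, b4, sub_right_comm p (E2 N)]
      ring
  · intro c hc
    have hcW : ∀ p q, (p ∈ W ∨ q ∈ W) → c p q = 0 := by
      intro p q hpq
      apply hc.1.2
      intro h'
      rcases hpq with h | h
      · exact h'.2.1 h
      · exact h'.2.2 h
    have hcG : IsFlow (grid N hN) c := ⟨⟨hc.1.1, fun v w h => hc.1.2 v w (fun h' => h h'.1)⟩, hc.2⟩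
    obtain ⟨g, hg, hgW, hgd, hg1, hg2⟩ := walk_chain hN h
    have hgF : IsFlow (grid N hN) g := by
      refine ⟨hg, fun v => ?_⟩
      have e : gc N (p0.1 + a * N) (p0.2 + b * N) = gc N p0.1 p0.2 := by simp [gc]
      rw [hgd v, e, sub_self]
    have hg1' : Sg1 g = a * N := by rw [hg1]; push_cast; ring
    have hg2' : Sg2 g = b * N := by rw [hg2]; push_cast; ring
    have hrel : (a : ℚ) * Sg2 c = b * Sg1 c := by
      obtain ⟨S, hS1, hS2, hS3, hS4⟩ := grid_pot hN hcG
      have hcst : ∀ p, Relation.ReflTransGen (lstep N W) p0 p → S p.1 p.2 = S p0.1 p0.2 := by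
        intro p hp
        induction hp with
        | refl => rfl
        | @tail q r _ hqr ih =>
          rw [← ih]
          obtain ⟨hq, hr, hst⟩ := hqr
          rcases hst with rfl | rfl | rfl | rfl
          · have := hS2 (q + (1, 0)).1 (q + (1, 0)).2
            rw [hcW _ _ (Or.inl hr)] at this
            simp at this ⊢
            linarith
          · have := hS2 (r + (1, 0)).1 (r + (1, 0)).2
            rw [hcW _ _ (Or.inl hq)] at this
            simp at this ⊢
            linarith
          · have := hS1 (q + (0, 1)).1 (q + (0, 1)).2
            rw [hcW _ _ (Or.inl hr)] at this
            simp at this ⊢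
            linarith
          · have := hS1 (r + (0, 1)).1 (r + (0, 1)).2
            rw [hcW _ _ (Or.inl hq)] at this
            simp at this ⊢
            linarith
      have h1 := hcst _ h
      have h2 := quasi_mul (A := fun i => S i (p0.2 + b * N)) (t := - Sg2 c / N) N
        (by intro i; rw [hS3]; ring) a p0.1
      have h3 := quasi_mul (A := fun j => S p0.1 j) (t := Sg1 c / N) N
        (by intro i; rw [hS4]) b p0.2
      simp only at h1 h2 h3
      rw [h2, h3] at h1
      field_simp at h1
      linarith
    obtain ⟨l, hl1, hl2⟩ : ∃ l : ℚ, Sg1 c = l * Sg1 g ∧ Sg2 c = l * Sg2 g := by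
      rw [hg1', hg2']
      rcases hab with ha | hb
      · have ha' : (a : ℚ) ≠ 0 := by exact_mod_cast ha
        refine ⟨Sg1 c / (a * N), by field_simp, ?_⟩
        field_simp
        linarith
      · have hb' : (b : ℚ) ≠ 0 := by exact_mod_cast hb
        refine ⟨Sg2 c / (b * N), ?_, by field_simp⟩
        field_simp
        linarith
    have hF : IsFlow (grid N hN) (fun x y => c x y + (-l) * g x y) := by
      refine ⟨hcG.1.add (hg.smul (-l)), fun v => ?_⟩
      rw [Finset.sum_add_distrib, ← Finset.mul_sum, hcG.2, hgF.2]; ring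
    have z1 : Sg1 (fun x y => c x y + (-l) * g x y) = 0 := by
      have : Sg1 (fun x y => c x y + (-l) * g x y) = Sg1 c + (-l) * Sg1 g := by
        simp only [Sg1, Finset.sum_add_distrib, Finset.mul_sum]
      rw [this, hl1]; ring
    have z2 : Sg2 (fun x y => c x y + (-l) * g x y) = 0 := by
      have : Sg2 (fun x y => c x y + (-l) * g x y) = Sg2 c + (-l) * Sg2 g := by
        simp only [Sg2, Finset.sum_add_distrib, Finset.mul_sum]
      rw [this, hl2]; ring
    obtain ⟨s, hs⟩ := grid_pot0 hN hF z1 z2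
    have hg0 : ∀ p q, (p ∉ W ∨ q ∉ W) → g p q = 0 := by
      intro p q hpq
      by_contra hne
      have := hgW p q hne
      tauto
    refine ⟨Quot.lift s ?_, ?_⟩
    · rintro x y ⟨p, q, hpq, hp, hq, rfl, rfl⟩
      have := hs p q hpq
      rw [hcW p q (Or.inl hp), hg0 p q (Or.inr hq)] at this
      linarith
    · intro p q hpq
      have := hs p q hpq.1
      rw [hg0 p q (Or.inl hpq.2.1)] at this
      change c p q = s (gf p q) - s (gf q p)
      linarith

end
end TorusThree

namespace TorusThree

open scoped Classical

/-! ### Part H: discretization -/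

/-- one step of a graph inside a set -/
def stepIn {U : Type} (Q : SimpleGraph U) (S : Set U) (u v : U) : Prop :=
  Q.Adj u v ∧ u ∈ S ∧ v ∈ S

lemma stepIn_symm {U : Type} {Q : SimpleGraph U} {S : Set U} {u v : U}
    (h : Relation.ReflTransGen (stepIn Q S) u v) : Relation.ReflTransGen (stepIn Q S) v u := by
  induction h with
  | refl => exact .refl
  | tail _ h2 ih => exact .head ⟨h2.1.symm, h2.2.2, h2.2.1⟩ ih

lemma stepIn_inner {U V' : Type} {Q : SimpleGraph U} {S : Set U} {β : U → Option V'} {x : V'}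
    (hβ : ∀ u ∈ S, β u = some x) {u v : U}
    (h : Relation.ReflTransGen (stepIn Q S) u v) : (innerG Q β).Reachable u v := by
  induction h with
  | refl => exact .refl _
  | tail _ h2 ih =>
    refine ih.trans (SimpleGraph.Adj.reachable ?_)
    refine ⟨h2.1, ?_, ?_⟩
    · rw [hβ _ h2.2.1, hβ _ h2.2.2]
    · rw [hβ _ h2.2.1]; simp

lemma dual_of_sets {U V' : Type} [Fintype U] [Nonempty U] [Fintype V'] {Q : SimpleGraph U} (hQ : HasDual Q)
    {H : SimpleGraph V'} (A : V' → Set U) (B : Sym2 V' → Set U)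
    (hA : ∀ x, ∀ u ∈ A x, ∀ v ∈ A x, Relation.ReflTransGen (stepIn Q (A x)) u v)
    (hAd : ∀ x y u, u ∈ A x → u ∈ A y → x = y)
    (hB : ∀ e ∈ H.edgeSet, ∀ u ∈ B e, ∀ v ∈ B e, Relation.ReflTransGen (stepIn Q (B e)) u v)
    (hBd : ∀ e ∈ H.edgeSet, ∀ e' ∈ H.edgeSet, ∀ u, u ∈ B e → u ∈ B e' → e = e')
    (hBA : ∀ e ∈ H.edgeSet, ∀ z u, u ∈ B e → u ∈ A z → z ∈ e)
    (hm : ∀ e ∈ H.edgeSet, ∀ z ∈ e, ∃ u, u ∈ B e ∧ u ∈ A z) : HasDual H := by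
  let φ := Fintype.equivFin V'
  let D : V' → V' → Prop := fun a b => H.Adj a b ∧ φ a < φ b
  let C : V' → V' → Set U := fun a b => {u | ∃ v ∈ A a ∩ B s(a, b),
    Relation.ReflTransGen (stepIn Q (B s(a, b) \ A b)) v u}
  have hCB : ∀ a b u, H.Adj a b → u ∈ C a b → u ∈ B s(a, b) ∧ u ∉ A b := by
    rintro a b u hab ⟨v, hv, h⟩
    induction h with
    | refl => exact ⟨hv.2, fun h => hab.ne (hAd _ _ _ hv.1 h)⟩
    | tail _ h2 _ => exact h2.2.2
  let M : V' → U → Prop := fun a u => u ∈ A a ∨ ∃ b, D a b ∧ u ∈ C a b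
  have hM : ∀ a a' u, M a u → M a' u → a = a' := by
    have key : ∀ a a' b' u, u ∈ A a → D a' b' → u ∈ C a' b' → a = a' := by
      intro a a' b' u hu hD hC
      have h1 := hCB _ _ _ hD.1 hC
      have h2 := hBA _ hD.1 a u h1.1 hu
      rcases Sym2.mem_iff.1 h2 with h | h
      · exact h
      · subst h; exact absurd hu h1.2
    rintro a a' u (h | ⟨b, hD, hC⟩) (h' | ⟨b', hD', hC'⟩)
    · exact hAd _ _ _ h h'
    · exact key _ _ _ _ h hD' hC'
    · exact (key _ _ _ _ h' hD hC).symm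
    · have h1 := hBd _ hD.1 _ hD'.1 u (hCB _ _ _ hD.1 hC).1 (hCB _ _ _ hD'.1 hC').1
      rcases Sym2.eq_iff.1 h1 with h | h
      · exact h.1
      · rw [h.1, h.2] at hD
        exact absurd hD.2 (not_lt.2 hD'.2.le)
  let β : U → Option V' := fun u => if h : ∃ a, M a u then some h.choose else none
  have hβ : ∀ a u, M a u → β u = some a := by
    intro a u h
    have h' : ∃ a, M a u := ⟨a, h⟩
    simp only [β, dif_pos h']
    rw [hM _ _ _ h'.choose_spec h]
  have hβ' : ∀ a u, β u = some a → M a u := by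
    intro a u h
    by_cases h' : ∃ a, M a u
    · simp only [β, dif_pos h'] at h
      rw [← Option.some.inj h]
      exact h'.choose_spec
    · simp only [β, dif_neg h'] at h
      cases h
  have hE : ∀ a b, D a b → ∃ uv : U × U, M a uv.1 ∧ M b uv.2 ∧ Q.Adj uv.1 uv.2 := by
    intro a b hD
    obtain ⟨u, hu, hua⟩ := hm _ hD.1 a (Sym2.mem_mk_left _ _)
    obtain ⟨v, hv, hvb⟩ := hm _ hD.1 b (Sym2.mem_mk_right _ _)
    have hr := hB _ hD.1 u hu v hv
    have : ∀ w, Relation.ReflTransGen (stepIn Q (B s(a, b))) u w →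
        (∃ uv : U × U, M a uv.1 ∧ M b uv.2 ∧ Q.Adj uv.1 uv.2) ∨ w ∈ C a b := by
      intro w h
      induction h with
      | refl => exact Or.inr ⟨u, ⟨hua, hu⟩, .refl⟩
      | @tail x y h1 h2 ih =>
        rcases ih with ih | ih
        · exact Or.inl ih
        · by_cases hy : y ∈ A b
          · exact Or.inl ⟨(x, y), Or.inr ⟨b, hD, ih⟩, Or.inl hy, h2.1⟩
          · right
            have hx := hCB _ _ _ hD.1 ih
            obtain ⟨z, hz, hz2⟩ := ih
            exact ⟨z, hz, hz2.tail ⟨h2.1, hx, ⟨h2.2.2, hy⟩⟩⟩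
    rcases this v hr with h | h
    · exact h
    · exact absurd hvb (hCB _ _ _ hD.1 h).2
  choose! ε hε using hE
  refine hQ.minor β (fun x y => if D x y then (ε x y).1 else (ε y x).2) ?_ ?_
  · intro v w hvw hv
    obtain ⟨a, ha⟩ := Option.ne_none_iff_exists'.1 hv
    have key : ∀ v, M a v → ∃ v' ∈ A a, (innerG Q β).Reachable v v' := by
      rintro v (h | ⟨b, hD, v', hv', hr⟩)
      · exact ⟨v, h, .refl _⟩
      · refine ⟨v', hv'.1, SimpleGraph.Reachable.symm ?_⟩
        have : ∀ w, Relation.ReflTransGen (stepIn Q (B s(a, b) \ A b)) v' w →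
            (innerG Q β).Reachable v' w := by
          intro w hw
          induction hw with
          | refl => exact .refl _
          | @tail x y h1 h2 ih =>
            refine ih.trans (SimpleGraph.Adj.reachable ?_)
            have e1 := hβ a x (Or.inr ⟨b, hD, v', hv', h1⟩)
            have e2 := hβ a y (Or.inr ⟨b, hD, v', hv', h1.tail h2⟩)
            refine ⟨h2.1, ?_, ?_⟩
            · rw [e1, e2]
            · rw [e1]; simp
        exact this v hr
    obtain ⟨v', hv', rv⟩ := key v (hβ' _ _ ha)
    obtain ⟨w', hw', rw'⟩ := key w (hβ' _ _ (hvw ▸ ha))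
    exact (rv.trans (stepIn_inner (fun u hu => hβ a u (Or.inl hu)) (hA a v' hv' w' hw'))).trans
      rw'.symm
  · intro x y hxy
    rcases lt_trichotomy (φ x) (φ y) with h | h | h
    · have h1 : D x y := ⟨hxy, h⟩
      have h2 : ¬ D y x := fun h' => absurd h'.2 (not_lt.2 h.le)
      simp only [if_pos h1, if_neg h2]
      exact ⟨hβ _ _ (hε x y h1).1, (hε x y h1).2.2⟩
    · exact absurd (φ.injective h) hxy.ne
    · have h1 : D y x := ⟨hxy.symm, h⟩
      have h2 : ¬ D x y := fun h' => absurd h'.2 (not_lt.2 h.le)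
      simp only [if_pos h1, if_neg h2]
      exact ⟨hβ _ _ (hε y x h1).2.1, (hε y x h1).2.2.symm⟩

/-- projection to the torus -/
def pr (s : ℝ × ℝ) : AddCircle (1 : ℝ) × AddCircle (1 : ℝ) :=
  ((s.1 : AddCircle (1 : ℝ)), (s.2 : AddCircle (1 : ℝ)))

lemma pr_cont : Continuous pr :=
  ((AddCircle.continuous_mk' 1).comp continuous_fst).prodMk
    ((AddCircle.continuous_mk' 1).comp continuous_snd)

lemma pr_open : IsOpenMap pr :=
  IsOpenMap.prodMap QuotientAddGroup.isOpenMap_coe QuotientAddGroup.isOpenMap_coe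

lemma pr_surj : Function.Surjective pr := by
  rintro ⟨x, y⟩
  obtain ⟨s, rfl⟩ := QuotientAddGroup.mk_surjective x
  obtain ⟨t, rfl⟩ := QuotientAddGroup.mk_surjective y
  exact ⟨(s, t), rfl⟩

lemma coe_add_int (s : ℝ) (a : ℤ) : ((s + a : ℝ) : AddCircle (1 : ℝ)) = (s : AddCircle (1 : ℝ)) := by
  rw [AddCircle.coe_add, add_eq_left, AddCircle.coe_eq_zero_iff]
  exact ⟨a, by simp⟩

lemma pr_add_int (s : ℝ × ℝ) (a b : ℤ) : pr (s.1 + a, s.2 + b) = pr s := by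
  simp only [pr, coe_add_int]

lemma pr_dist (s t : ℝ × ℝ) : dist (pr s) (pr t) ≤ max |s.1 - t.1| |s.2 - t.2| := by
  have : ∀ x y : ℝ, dist (x : AddCircle (1 : ℝ)) (y : AddCircle (1 : ℝ)) ≤ |x - y| := by
    intro x y
    rw [dist_eq_norm, ← AddCircle.coe_sub]
    exact QuotientAddGroup.norm_mk_le_norm
  exact max_le_max (this _ _) (this _ _)

def nearZ (N : ℕ) (s : ℝ × ℝ) (p : ℤ × ℤ) : Prop :=
  |N * s.1 - p.1| ≤ 2 ∧ |N * s.2 - p.2| ≤ 2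

def RR (N : ℕ) (X : Set (AddCircle (1 : ℝ) × AddCircle (1 : ℝ))) : Set (ZMod N × ZMod N) :=
  {q | ∃ s p, pr s ∈ X ∧ nearZ N s p ∧ gc N p.1 p.2 = q}

lemma lstep_symm {N : ℕ} {W : Set (ZMod N × ZMod N)} {p q : ℤ × ℤ}
    (h : Relation.ReflTransGen (lstep N W) p q) : Relation.ReflTransGen (lstep N W) q p := by
  induction h with
  | refl => exact .refl
  | tail _ h2 ih =>
    refine .head ⟨h2.2.1, h2.1, ?_⟩ ih
    rcases h2.2.2 with h | h | h | h
    · exact Or.inr (Or.inl h)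
    · exact Or.inl h
    · exact Or.inr (Or.inr (Or.inr h))
    · exact Or.inr (Or.inr (Or.inl h))

/-- horizontal segments -/
lemma seg1 {N : ℕ} {W : Set (ZMod N × ZMod N)} (j : ℤ) (i : ℤ) (n : ℕ)
    (h : ∀ k, i ≤ k → k ≤ i + n → gc N k j ∈ W) :
    Relation.ReflTransGen (lstep N W) (i, j) (i + n, j) := by
  induction n with
  | zero => simpa using Relation.ReflTransGen.refl
  | succ n ih =>
    refine (ih fun k h1 h2 => h k h1 (by push_cast; omega)).tail
      ⟨h _ (by simp) (by simp), h _ (by simp; omega) (by simp), Or.inl ?_⟩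
    ext <;> simp; ring

lemma seg2 {N : ℕ} {W : Set (ZMod N × ZMod N)} (i : ℤ) (j : ℤ) (n : ℕ)
    (h : ∀ k, j ≤ k → k ≤ j + n → gc N i k ∈ W) :
    Relation.ReflTransGen (lstep N W) (i, j) (i, j + n) := by
  induction n with
  | zero => simpa using Relation.ReflTransGen.refl
  | succ n ih =>
    refine (ih fun k h1 h2 => h k h1 (by push_cast; omega)).tail
      ⟨h _ (by simp) (by simp), h _ (by simp; omega) (by simp), Or.inr (Or.inr (Or.inl ?_))⟩
    ext <;> simp; ring

lemma near_conn {N : ℕ} {W : Set (ZMod N × ZMod N)} {s : ℝ × ℝ} {p q : ℤ × ℤ}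
    (hW : ∀ p, nearZ N s p → gc N p.1 p.2 ∈ W) (hp : nearZ N s p) (hq : nearZ N s q) :
    Relation.ReflTransGen (lstep N W) p q := by
  have h1 : ∀ i i' j : ℤ, nearZ N s (i, j) → nearZ N s (i', j) → i ≤ i' →
      Relation.ReflTransGen (lstep N W) (i, j) (i', j) := by
    intro i i' j h h' hi
    obtain ⟨n, rfl⟩ := Int.le.dest hi
    refine seg1 j i n fun k k1 k2 => hW (k, j) ⟨?_, h.2⟩
    have e1 := abs_le.1 h.1
    have e2 := abs_le.1 h'.1
    have k1' : (i : ℝ) ≤ k := by exact_mod_cast k1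
    have k2' : (k : ℝ) ≤ ((i + n : ℤ) : ℝ) := by exact_mod_cast k2
    dsimp only at e1 e2 ⊢
    rw [abs_le]; constructor <;> linarith
  have h2 : ∀ i j j' : ℤ, nearZ N s (i, j) → nearZ N s (i, j') → j ≤ j' →
      Relation.ReflTransGen (lstep N W) (i, j) (i, j') := by
    intro i j j' h h' hj
    obtain ⟨n, rfl⟩ := Int.le.dest hj
    refine seg2 i j n fun k k1 k2 => hW (i, k) ⟨h.1, ?_⟩
    have e1 := abs_le.1 h.2
    have e2 := abs_le.1 h'.2
    have k1' : (j : ℝ) ≤ k := by exact_mod_cast k1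
    have k2' : (k : ℝ) ≤ ((j + n : ℤ) : ℝ) := by exact_mod_cast k2
    dsimp only at e1 e2 ⊢
    rw [abs_le]; constructor <;> linarith
  obtain ⟨i, j⟩ := p
  obtain ⟨i', j'⟩ := q
  have hm : nearZ N s (i', j) := ⟨hq.1, hp.2⟩
  refine Relation.ReflTransGen.trans (b := (i', j)) ?_ ?_
  · rcases le_total i i' with h | h
    · exact h1 _ _ _ hp hm h
    · exact lstep_symm (h1 _ _ _ hm hp h)
  · rcases le_total j j' with h | h
    · exact h2 _ _ _ hm hq h
    · exact lstep_symm (h2 _ _ _ hq hm h)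

lemma near_common {N : ℕ} (hN : 0 < N) {s t : ℝ × ℝ} (h1 : |s.1 - t.1| < 1 / N)
    (h2 : |s.2 - t.2| < 1 / N) : ∃ p, nearZ N s p ∧ nearZ N t p := by
  have hN' : (0 : ℝ) < N := by exact_mod_cast hN
  have key : ∀ x y : ℝ, |x - y| < 1 / N → |N * x - ⌊N * x⌋| ≤ 2 ∧ |N * y - ⌊N * x⌋| ≤ 2 := by
    intro x y h
    have a1 := Int.floor_le (N * x)
    have a2 := Int.lt_floor_add_one (N * x)
    rw [lt_div_iff₀ hN', ← abs_of_pos hN', ← abs_mul, abs_lt] at h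
    have b1 := h.1
    have b2 := h.2
    constructor
    · rw [abs_le]; constructor <;> linarith
    · rw [abs_le]; constructor <;> nlinarith
  exact ⟨(⌊N * s.1⌋, ⌊N * s.2⌋), ⟨(key _ _ h1).1, (key _ _ h2).1⟩, ⟨(key _ _ h1).2, (key _ _ h2).2⟩⟩

lemma box_nhds {ε : ℝ} (hε : 0 < ε) (s : ℝ × ℝ) :
    {t : ℝ × ℝ | |s.1 - t.1| < ε ∧ |s.2 - t.2| < ε} ∈ 𝓝 s := by
  have h1 : Continuous fun t : ℝ × ℝ => |s.1 - t.1| := by fun_prop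
  have h2 : Continuous fun t : ℝ × ℝ => |s.2 - t.2| := by fun_prop
  exact ((isOpen_lt h1 continuous_const).inter (isOpen_lt h2 continuous_const)).mem_nhds
    (by simpa using hε)

/-- neighbourhood of a point of the torus -/
lemma near_nhds {N : ℕ} (hN : 0 < N) (s : ℝ × ℝ) :
    ∀ᶠ y in 𝓝 (pr s), ∃ t, pr t = y ∧ |s.1 - t.1| < 1 / N ∧ |s.2 - t.2| < 1 / N := by
  have hN' : (0 : ℝ) < 1 / N := by positivity
  have : {t : ℝ × ℝ | |s.1 - t.1| < 1 / N ∧ |s.2 - t.2| < 1 / N} ∈ 𝓝 s := box_nhds hN' s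
  filter_upwards [pr_open.image_mem_nhds this]
  rintro _ ⟨t, ht, rfl⟩
  exact ⟨t, rfl, ht⟩

lemma pr_eq {s t : ℝ × ℝ} (h : pr s = pr t) : ∃ a b : ℤ, t = (s.1 + a, s.2 + b) := by
  have key : ∀ x y : ℝ, (x : AddCircle (1 : ℝ)) = y → ∃ a : ℤ, y = x + a := by
    intro x y h
    have h2 : ((y - x : ℝ) : AddCircle (1 : ℝ)) = 0 := by rw [AddCircle.coe_sub, h, sub_self]
    obtain ⟨n, hn⟩ := (AddCircle.coe_eq_zero_iff _).1 h2
    refine ⟨n, ?_⟩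
    rw [zsmul_one] at hn
    linarith
  obtain ⟨a, ha⟩ := key _ _ (Prod.ext_iff.1 h).1
  obtain ⟨b, hb⟩ := key _ _ (Prod.ext_iff.1 h).2
  exact ⟨a, b, Prod.ext ha hb⟩

lemma near_shift {N : ℕ} {s : ℝ × ℝ} {p : ℤ × ℤ} (h : nearZ N s p) (a b : ℤ) :
    nearZ N (s.1 + a, s.2 + b) (p.1 + a * N, p.2 + b * N) := by
  unfold nearZ at *
  push_cast
  constructor
  · convert h.1 using 2; ring
  · convert h.2 using 2; ring

lemma gc_shift {N : ℕ} (p : ℤ × ℤ) (a b : ℤ) : gc N (p.1 + a * N) (p.2 + b * N) = gc N p.1 p.2 := by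
  simp [gc]

lemma lstep_stepIn {N : ℕ} (hN : 3 ≤ N) {S W : Set (ZMod N × ZMod N)} (hSW : Disjoint S W)
    {p q : ℤ × ℤ} (h : Relation.ReflTransGen (lstep N S) p q) :
    Relation.ReflTransGen (stepIn (delG (grid N hN) W) S) (gc N p.1 p.2) (gc N q.1 q.2) := by
  induction h with
  | refl => exact .refl
  | @tail x y _ h2 ih =>
    refine ih.tail ⟨⟨?_, fun h => hSW.ne_of_mem h2.1 h rfl, fun h => hSW.ne_of_mem h2.2.1 h rfl⟩,
      h2.1, h2.2.1⟩
    rcases h2.2.2 with rfl | rfl | rfl | rfl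
    · left; ext <;> simp [gc, E1]
    · right; left; ext <;> simp [gc, E1]
    · right; right; left; ext <;> simp [gc, E2]
    · right; right; right; ext <;> simp [gc, E2]

lemma RR_conn {N : ℕ} (hN : 3 ≤ N) {X : Set (AddCircle (1 : ℝ) × AddCircle (1 : ℝ))}
    {W : Set (ZMod N × ZMod N)} (hX : IsPreconnected X) (hW : Disjoint (RR N X) W) :
    ∀ u ∈ RR N X, ∀ v ∈ RR N X,
      Relation.ReflTransGen (stepIn (delG (grid N hN) W) (RR N X)) u v := by
  have hne : ∀ s, ∃ p, nearZ N s p := fun s => by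
    obtain ⟨p, hp, _⟩ := near_common (N := N) (by omega) (s := s) (t := s)
      (by simp; omega) (by simp; omega)
    exact ⟨p, hp⟩
  have hin : ∀ s p, pr s ∈ X → nearZ N s p → gc N p.1 p.2 ∈ RR N X :=
    fun s p h h' => ⟨s, p, h, h', rfl⟩
  rintro _ ⟨s, p, hs, hp, rfl⟩ _ ⟨t, q, ht, hq, rfl⟩
  refine hX.induction₂ (fun x y => ∀ s t p q, pr s = x → pr t = y → nearZ N s p →
    nearZ N t q → Relation.ReflTransGen (stepIn (delG (grid N hN) W) (RR N X))
      (gc N p.1 p.2) (gc N q.1 q.2)) ?_ ?_ ?_ hs ht s t p q rfl rfl hp hq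
  all_goals clear hs ht hp hq s t p q
  · intro x hx
    obtain ⟨s0, rfl⟩ := pr_surj x
    filter_upwards [nhdsWithin_le_nhds (near_nhds (N := N) (by omega) s0), self_mem_nhdsWithin]
    rintro y ⟨t0, rfl, h1, h2⟩ hy s t p q hs ht hp hq
    obtain ⟨a, b, rfl⟩ := pr_eq hs
    obtain ⟨a', b', rfl⟩ := pr_eq ht
    obtain ⟨r, hr1, hr2⟩ := near_common (N := N) (by omega) h1 h2
    have e1 := near_shift hp a b
    have e2 := near_shift hq a' b'
    rw [← gc_shift p a b, ← gc_shift q a' b']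
    exact lstep_stepIn hN hW ((near_conn (fun p hp => hin _ p hx hp) e1 hr1).trans
      (near_conn (fun p hp => hin _ p hy hp) hr2 e2))
  · intro x y z _ _ _ h1 h2 s t p q hs ht hp hq
    obtain ⟨s', rfl⟩ := pr_surj y
    obtain ⟨r, hr⟩ := hne s'
    exact (h1 s s' p r hs rfl hp hr).trans (h2 s' t r q rfl ht hr hq)
  · intro x y _ _ h s t p q hs ht hp hq
    exact stepIn_symm (h t s q p ht hs hq hp)

lemma RR_disj {X Y : Set (AddCircle (1 : ℝ) × AddCircle (1 : ℝ))} (hX : IsCompact X)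
    (hY : IsCompact Y) (h : Disjoint X Y) :
    ∀ᶠ N : ℕ in Filter.atTop, Disjoint (RR N X) (RR N Y) := by
  obtain ⟨r, hr, hd⟩ := Metric.exists_pos_forall_lt_edist hX hY.isClosed h
  have hr' : (0 : ℝ) < r := hr
  obtain ⟨N0, hN0⟩ := exists_nat_gt (4 / (r : ℝ))
  filter_upwards [Filter.eventually_ge_atTop N0] with N hN
  have hNr : 4 / (r : ℝ) < N := hN0.trans_le (by exact_mod_cast hN)
  have hNp : (0 : ℝ) < N := lt_trans (by positivity) hNr
  rw [Set.disjoint_left]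
  rintro _ ⟨s, p, hs, hp, rfl⟩ ⟨t, q, ht, hq, e⟩
  obtain ⟨e1, e2⟩ := Prod.ext_iff.1 e
  obtain ⟨a, ha⟩ := (ZMod.intCast_eq_intCast_iff_dvd_sub _ _ _).1 e1
  obtain ⟨b, hb⟩ := (ZMod.intCast_eq_intCast_iff_dvd_sub _ _ _).1 e2
  have hq' := near_shift hq a b
  have := hd _ hs _ ht
  rw [← pr_add_int t a b, edist_dist, ENNReal.lt_ofReal_iff_toReal_lt ENNReal.coe_ne_top] at this
  have h1 := this.trans_le (pr_dist _ _)
  have h4 : 4 < (r : ℝ) * N := by rwa [div_lt_iff₀ hr', mul_comm] at hNr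
  have hqa : q.1 + a * N = p.1 := by linarith
  have hqb : q.2 + b * N = p.2 := by linarith
  rw [hqa, hqb] at hq'
  have key : ∀ x y m : ℝ, |N * x - m| ≤ 2 → |N * y - m| ≤ 2 → (r : ℝ) < |x - y| → False := by
    intro x y m i1 i2 i3
    have i4 : (r : ℝ) * N < |x - y| * N := mul_lt_mul_of_pos_right i3 hNp
    have i5 : |x - y| * N = |(N * x - m) - (N * y - m)| := by
      rw [← abs_of_pos hNp, ← abs_mul, abs_of_pos hNp]; congr 1; ring
    have i6 := abs_sub (N * x - m) (N * y - m)
    linarith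
  rcases lt_max_iff.1 h1 with h | h
  · exact key _ _ _ hp.1 hq'.1 h
  · exact key _ _ _ hp.2 hq'.2 h

/-- the discretization theorem -/
theorem discretize {V' : Type} [Fintype V'] (H : SimpleGraph V')
    (X : V' → Set (AddCircle (1 : ℝ) × AddCircle (1 : ℝ)))
    (K : Sym2 V' → Set (AddCircle (1 : ℝ) × AddCircle (1 : ℝ)))
    (hXc : ∀ x, IsCompact (X x)) (hXp : ∀ x, IsPreconnected (X x))
    (hXd : ∀ x y, x ≠ y → Disjoint (X x) (X y))
    (hKc : ∀ e ∈ H.edgeSet, IsCompact (K e)) (hKp : ∀ e ∈ H.edgeSet, IsPreconnected (K e))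
    (hKd : ∀ e ∈ H.edgeSet, ∀ e' ∈ H.edgeSet, e ≠ e' → Disjoint (K e) (K e'))
    (hKX : ∀ e ∈ H.edgeSet, ∀ z, z ∉ e → Disjoint (K e) (X z))
    (hKm : ∀ e ∈ H.edgeSet, ∀ z ∈ e, (K e ∩ X z).Nonempty)
    (Γ : ℝ → ℝ × ℝ) (hΓ : ContinuousOn Γ (Icc 0 1)) (a b : ℤ) (hab : a ≠ 0 ∨ b ≠ 0)
    (hΓ1 : Γ 1 = ((Γ 0).1 + a, (Γ 0).2 + b))
    (hΓX : ∀ x, ∀ t ∈ Icc (0 : ℝ) 1, pr (Γ t) ∉ X x)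
    (hΓK : ∀ e ∈ H.edgeSet, ∀ t ∈ Icc (0 : ℝ) 1, pr (Γ t) ∉ K e) : HasDual H := by
  set g : Set (AddCircle (1 : ℝ) × AddCircle (1 : ℝ)) := (fun t => pr (Γ t)) '' Icc 0 1 with hg
  have hgc : IsCompact g := isCompact_Icc.image_of_continuousOn (pr_cont.comp_continuousOn hΓ)
  have f1 : ∀ᶠ N : ℕ in Filter.atTop, ∀ x y, x ≠ y → Disjoint (RR N (X x)) (RR N (X y)) :=
    Filter.eventually_all.2 fun x => Filter.eventually_all.2 fun y => by
      by_cases h : x = y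
      · exact Filter.Eventually.of_forall fun N h' => absurd h h'
      · filter_upwards [RR_disj (hXc x) (hXc y) (hXd x y h)] with N hN _ using hN
  have f2 : ∀ᶠ N : ℕ in Filter.atTop, ∀ e e' : Sym2 V', e ∈ H.edgeSet → e' ∈ H.edgeSet → e ≠ e' →
      Disjoint (RR N (K e)) (RR N (K e')) :=
    Filter.eventually_all.2 fun e => Filter.eventually_all.2 fun e' => by
      by_cases h : e ∈ H.edgeSet ∧ e' ∈ H.edgeSet ∧ e ≠ e'
      · filter_upwards [RR_disj (hKc e h.1) (hKc e' h.2.1) (hKd e h.1 e' h.2.1 h.2.2)]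
          with N hN _ _ _ using hN
      · exact Filter.Eventually.of_forall fun N h1 h2 h3 => absurd ⟨h1, h2, h3⟩ h
  have f3 : ∀ᶠ N : ℕ in Filter.atTop, ∀ (e : Sym2 V') (z : V'), e ∈ H.edgeSet → z ∉ e →
      Disjoint (RR N (K e)) (RR N (X z)) :=
    Filter.eventually_all.2 fun e => Filter.eventually_all.2 fun z => by
      by_cases h : e ∈ H.edgeSet ∧ z ∉ e
      · filter_upwards [RR_disj (hKc e h.1) (hXc z) (hKX e h.1 z h.2)] with N hN _ _ using hN
      · exact Filter.Eventually.of_forall fun N h1 h2 => absurd ⟨h1, h2⟩ h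
  have f4 : ∀ᶠ N : ℕ in Filter.atTop, ∀ x, Disjoint (RR N (X x)) (RR N g) :=
    Filter.eventually_all.2 fun x => RR_disj (hXc x) hgc (by
      rw [Set.disjoint_left]
      rintro _ h ⟨t, ht, rfl⟩
      exact hΓX x t ht h)
  have f5 : ∀ᶠ N : ℕ in Filter.atTop, ∀ e : Sym2 V', e ∈ H.edgeSet →
      Disjoint (RR N (K e)) (RR N g) :=
    Filter.eventually_all.2 fun e => by
      by_cases h : e ∈ H.edgeSet
      · filter_upwards [RR_disj (hKc e h) hgc (by
          rw [Set.disjoint_left]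
          rintro _ h' ⟨t, ht, rfl⟩
          exact hΓK e h t ht h')] with N hN _ using hN
      · exact Filter.Eventually.of_forall fun N h1 => absurd h1 h
  obtain ⟨N, g1, g2, g3, g4, g5, hN⟩ :=
    (f1.and (f2.and (f3.and (f4.and (f5.and (Filter.eventually_ge_atTop 3)))))).exists
  haveI : NeZero N := ⟨by omega⟩
  have hne : ∀ s, ∃ p, nearZ N s p := fun s => by
    obtain ⟨p, hp, _⟩ := near_common (N := N) (by omega) (s := s) (t := s)
      (by simp; omega) (by simp; omega)
    exact ⟨p, hp⟩
  have hwalk := isPreconnected_Icc.induction₂ (s := Icc (0 : ℝ) 1) (fun t t' => ∀ p q,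
    nearZ N (Γ t) p → nearZ N (Γ t') q → Relation.ReflTransGen (lstep N (RR N g)) p q) ?_ ?_ ?_
    (x := 0) (y := 1) (by simp) (by simp)
  · obtain ⟨p0, hp0⟩ := hne (Γ 0)
    have hp1 := near_shift hp0 a b
    rw [← hΓ1] at hp1
    have hQ := host hN (RR N g) p0 a b hab (hwalk _ _ hp0 hp1)
    refine dual_of_sets hQ (fun x => RR N (X x)) (fun e => RR N (K e)) ?_ ?_ ?_ ?_ ?_ ?_
    · intro x
      exact RR_conn hN (hXp x) (g4 x)
    · intro x y u hx hy
      by_contra h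
      exact (g1 x y h).ne_of_mem hx hy rfl
    · intro e he
      exact RR_conn hN (hKp e he) (g5 e he)
    · intro e he e' he' u hx hy
      by_contra h
      exact (g2 e e' he he' h).ne_of_mem hx hy rfl
    · intro e he z u hx hy
      by_contra h
      exact (g3 e z he h).ne_of_mem hx hy rfl
    · intro e he z hz
      obtain ⟨y, h1, h2⟩ := hKm e he z hz
      obtain ⟨s, rfl⟩ := pr_surj y
      obtain ⟨p, hp⟩ := hne s
      exact ⟨_, ⟨s, p, h1, hp, rfl⟩, ⟨s, p, h2, hp, rfl⟩⟩
  · intro t ht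
    have hN' : (0 : ℝ) < 1 / N := by positivity
    have c1 := (hΓ t ht)
    have : {y : ℝ × ℝ | |(Γ t).1 - y.1| < 1 / N ∧ |(Γ t).2 - y.2| < 1 / N} ∈ 𝓝 (Γ t) :=
      box_nhds hN' _
    filter_upwards [c1 this, self_mem_nhdsWithin] with t' h1 h2 p q hp hq
    obtain ⟨r, hr1, hr2⟩ := near_common (N := N) (by omega) h1.1 h1.2
    exact (near_conn (W := RR N g) (fun p hp => ⟨_, p, ⟨t, ht, rfl⟩, hp, rfl⟩) hp hr1).trans
      (near_conn (W := RR N g) (fun p hp => ⟨_, p, ⟨t', h2, rfl⟩, hp, rfl⟩) hr2 hq)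
  · intro x y z _ _ _ h1 h2 p q hp hq
    obtain ⟨r, hr⟩ := hne (Γ y)
    exact (h1 p r hp hr).trans (h2 r q hr hq)
  · intro x y _ _ h p q hp hq
    exact lstep_symm (h q p hq hp)

end TorusThree

namespace TorusThree

open scoped Classical

/-! ### Part I: topology -/

lemma lift1 (f : C(unitInterval, Circle1)) : ∃ F : C(unitInterval, ℝ), ∀ t, (F t : Circle1) = f t := by
  obtain ⟨e, he⟩ := QuotientAddGroup.mk_surjective (f 0)
  obtain ⟨F, hF, _⟩ := (AddCircle.isCoveringMap_coe (1 : ℝ)).exists_path_lifts f e he.symm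
  exact ⟨F, fun t => congrFun hF t⟩

lemma exists_lift (γ : C(Circle1, Torus)) (hγ : ¬ NullHomotopic γ) (x0 : Circle1) :
    ∃ Γ : ℝ → ℝ × ℝ, Continuous Γ ∧ (∀ t ∈ Icc (0 : ℝ) 1, pr (Γ t) = γ (x0 + (t : Circle1))) ∧
      ∃ a b : ℤ, (a ≠ 0 ∨ b ≠ 0) ∧ Γ 1 = ((Γ 0).1 + a, (Γ 0).2 + b) := by
  have hc : Continuous fun t : unitInterval => γ (x0 + ((t : ℝ) : Circle1)) :=
    γ.continuous.comp (continuous_const.add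
      ((AddCircle.continuous_mk' 1).comp continuous_subtype_val))
  obtain ⟨F1, h1⟩ := lift1 ⟨fun t => (γ (x0 + ((t : ℝ) : Circle1))).1, hc.fst⟩
  obtain ⟨F2, h2⟩ := lift1 ⟨fun t => (γ (x0 + ((t : ℝ) : Circle1))).2, hc.snd⟩
  let Γ : ℝ → ℝ × ℝ := IccExtend (zero_le_one' ℝ) fun t => (F1 t, F2 t)
  have hΓc : Continuous Γ := (F1.continuous.prodMk F2.continuous).Icc_extend'
  have hΓ : ∀ t ∈ Icc (0 : ℝ) 1, pr (Γ t) = γ (x0 + (t : Circle1)) := by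
    intro t ht
    simp only [Γ, IccExtend_of_mem _ _ ht]
    exact Prod.ext (h1 ⟨t, ht⟩) (h2 ⟨t, ht⟩)
  have e01 : pr (Γ 0) = pr (Γ 1) := by
    rw [hΓ 0 (by simp), hΓ 1 (by simp), AddCircle.coe_period]
    simp
  obtain ⟨a, b, hab⟩ := pr_eq e01
  refine ⟨Γ, hΓc, hΓ, a, b, ?_, hab⟩
  by_contra! h0
  have h01 : Γ 0 = Γ 1 := by
    rw [hab, h0.1, h0.2]; simp
  apply hγ
  haveI : Fact ((0 : ℝ) < 1) := ⟨one_pos⟩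
  let δ : C(Circle1, ℝ × ℝ) := ⟨fun y => AddCircle.liftIco 1 0 Γ (y - x0),
    (AddCircle.liftIco_zero_continuous h01 hΓc.continuousOn).comp (continuous_id.sub continuous_const)⟩
  have hδ : γ = (ContinuousMap.mk pr pr_cont).comp δ := by
    ext1 y
    obtain ⟨t, ht, hy⟩ : ∃ t ∈ Ico (0 : ℝ) 1, ((t : ℝ) : Circle1) = y - x0 := by
      refine ⟨(AddCircle.equivIco 1 0 (y - x0) : ℝ), ?_, ?_⟩
      · simpa using (AddCircle.equivIco 1 0 (y - x0)).2
      · exact (AddCircle.equivIco 1 0).symm_apply_apply (y - x0)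
    change γ y = pr (AddCircle.liftIco 1 0 Γ (y - x0))
    rw [← hy, AddCircle.liftIco_zero_coe_apply ht, hΓ t ⟨ht.1, ht.2.le⟩, hy]
    simp
  have hn : ContinuousMap.Nullhomotopic γ := by
    rw [hδ]
    have : δ = (ContinuousMap.id _).comp δ := by ext1; rfl
    rw [this]
    exact ((id_nullhomotopic (ℝ × ℝ)).comp_left δ).comp_right _
  exact hn

/-- closed boxes in the torus -/
def bx (s : ℝ × ℝ) (ε : ℝ) : Set Torus := pr '' {t | |s.1 - t.1| ≤ ε ∧ |s.2 - t.2| ≤ ε}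

lemma bx_aux (s : ℝ × ℝ) (ε : ℝ) : {t : ℝ × ℝ | |s.1 - t.1| ≤ ε ∧ |s.2 - t.2| ≤ ε} =
    Icc (s.1 - ε) (s.1 + ε) ×ˢ Icc (s.2 - ε) (s.2 + ε) := by
  ext t
  simp only [Set.mem_ofPred_eq, mem_prod, mem_Icc, abs_le]
  constructor
  · rintro ⟨⟨h1, h2⟩, h3, h4⟩; refine ⟨⟨?_, ?_⟩, ?_, ?_⟩ <;> linarith
  · rintro ⟨⟨h1, h2⟩, h3, h4⟩; refine ⟨⟨?_, ?_⟩, ?_, ?_⟩ <;> linarith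

lemma bx_compact (s : ℝ × ℝ) (ε : ℝ) : IsCompact (bx s ε) := by
  unfold bx
  rw [bx_aux]
  exact (isCompact_Icc.prod isCompact_Icc).image pr_cont

lemma bx_conn (s : ℝ × ℝ) (ε : ℝ) : IsPreconnected (bx s ε) := by
  unfold bx
  rw [bx_aux]
  exact (isPreconnected_Icc.prod isPreconnected_Icc).image _ pr_cont.continuousOn

lemma bx_nhds (s : ℝ × ℝ) {ε : ℝ} (hε : 0 < ε) : bx s ε ∈ 𝓝 (pr s) := by
  refine Filter.mem_of_superset (pr_open.image_mem_nhds (box_nhds hε s)) ?_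
  exact image_mono fun t ht => ⟨ht.1.le, ht.2.le⟩

lemma bx_small (s : ℝ × ℝ) {U : Set Torus} (hU : U ∈ 𝓝 (pr s)) :
    ∀ᶠ ε in 𝓝[>] (0 : ℝ), bx s ε ⊆ U := by
  obtain ⟨r, hr, hrU⟩ := Metric.mem_nhds_iff.1 hU
  filter_upwards [Ioo_mem_nhdsGT hr] with ε hε
  rintro _ ⟨t, ht, rfl⟩
  apply hrU
  rw [Metric.mem_ball, dist_comm]
  exact (pr_dist s t).trans_lt ((max_le ht.1 ht.2).trans_lt hε.2)

lemma bx_avoid (s : ℝ × ℝ) {F : Set Torus} (hF : IsClosed F) (hs : pr s ∉ F) :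
    ∀ᶠ ε in 𝓝[>] (0 : ℝ), Disjoint (bx s ε) F := by
  filter_upwards [bx_small s (hF.isOpen_compl.mem_nhds hs)] with ε hε
  exact Set.disjoint_left.2 fun x hx => hε hx

lemma bx_disj (s t : ℝ × ℝ) (h : pr s ≠ pr t) :
    ∀ᶠ ε in 𝓝[>] (0 : ℝ), Disjoint (bx s ε) (bx t ε) := by
  obtain ⟨U, U', hU, hU', hs, ht, hd⟩ := t2_separation h
  filter_upwards [bx_small s (hU.mem_nhds hs), bx_small t (hU'.mem_nhds ht)] with ε h1 h2
  exact hd.mono h1 h2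

variable {V : Type} [Fintype V] {G : SimpleGraph V}

/-- parametrization of an edge -/
lemma edge_param (d : Drawing G Torus) (e : G.edgeSet) :
    ∃ φ : ℝ → Torus, ContinuousOn φ (Ioo 0 1) ∧ φ '' Ioo 0 1 = d.emap e := by
  obtain ⟨h⟩ := d.arc e
  refine ⟨fun t => if ht : t ∈ Ioo (0 : ℝ) 1 then (h ⟨t, ht⟩ : Torus) else 0, ?_, ?_⟩
  · rw [continuousOn_iff_continuous_domRestrict]
    convert continuous_subtype_val.comp h.continuous using 1
    ext1 ⟨t, ht⟩
    simp only [Set.domRestrict_apply, Function.comp, dif_pos ht]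
  · ext y
    constructor
    · rintro ⟨t, ht, rfl⟩
      simp only [dif_pos ht]
      exact (h ⟨t, ht⟩).2
    · intro hy
      obtain ⟨⟨t, ht⟩, e⟩ := h.surjective ⟨y, hy⟩
      refine ⟨t, ht, ?_⟩
      simp only [dif_pos ht, e]

lemma edge_closure (d : Drawing G Torus) (e : G.edgeSet) (v : V) :
    d.vmap v ∈ closure (d.emap e) ↔ v ∈ (e : Sym2 V) := by
  obtain ⟨e, he⟩ := e
  induction e using Sym2.ind with
  | _ u w =>
    rw [d.closure_emap ⟨s(u, w), he⟩ u w rfl]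
    simp only [mem_union, mem_insert_iff, mem_singleton_iff, d.vertex_notin, false_or, d.vinj.eq_iff,
      Sym2.mem_iff]

/-- sub-arc between neighbourhoods of the ends -/
lemma edge_near (d : Drawing G Torus) (e : G.edgeSet) {φ : ℝ → Torus}
    (hφ : φ '' Ioo 0 1 = d.emap e) {v : V} (hv : v ∈ (e : Sym2 V)) {U : Set Torus}
    (hU : U ∈ 𝓝 (d.vmap v)) : ∃ t ∈ Ioo (0 : ℝ) 1, φ t ∈ U := by
  obtain ⟨y, hy1, hy2⟩ := mem_closure_iff_nhds.1 ((edge_closure d e v).2 hv) U hU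
  rw [← hφ] at hy2
  obtain ⟨t, ht, rfl⟩ := hy2
  exact ⟨t, ht, hy1⟩

lemma sub_arc {φ : ℝ → Torus} (hφ : ContinuousOn φ (Ioo 0 1)) {s t : ℝ} (hs : s ∈ Ioo (0 : ℝ) 1)
    (ht : t ∈ Ioo (0 : ℝ) 1) : IsCompact (φ '' uIcc s t) ∧ IsPreconnected (φ '' uIcc s t) ∧
      φ '' uIcc s t ⊆ φ '' Ioo 0 1 := by
  have hsub : uIcc s t ⊆ Ioo (0 : ℝ) 1 := ordConnected_Ioo.uIcc_subset hs ht
  have hc := hφ.mono hsub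
  exact ⟨isCompact_uIcc.image_of_continuousOn hc, isPreconnected_uIcc.image _ hc, image_mono hsub⟩

/-- case 1: the curve avoids the vertices and the edges of `H` -/
theorem case_one (d : Drawing G Torus) (H : SimpleGraph V) (hH : H ≤ G) (Γ : ℝ → ℝ × ℝ)
    (hΓ : Continuous Γ) (a b : ℤ) (hab : a ≠ 0 ∨ b ≠ 0)
    (hΓ1 : Γ 1 = ((Γ 0).1 + a, (Γ 0).2 + b))
    (hV : ∀ t ∈ Icc (0 : ℝ) 1, ∀ v, pr (Γ t) ≠ d.vmap v)
    (hE : ∀ t ∈ Icc (0 : ℝ) 1, ∀ e : G.edgeSet, (e : Sym2 V) ∈ H.edgeSet → pr (Γ t) ∉ d.emap e) :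
    HasDual H := by
  choose σ hσ using fun v => pr_surj (d.vmap v)
  choose φ hφc hφ using edge_param d
  have hgc : IsCompact ((fun t => pr (Γ t)) '' Icc 0 1) :=
    isCompact_Icc.image (pr_cont.comp hΓ)
  have f1 : ∀ᶠ ε in 𝓝[>] (0 : ℝ), ∀ v w, v ≠ w → Disjoint (bx (σ v) ε) (bx (σ w) ε) :=
    Filter.eventually_all.2 fun v => Filter.eventually_all.2 fun w => by
      by_cases h : v = w
      · exact Filter.Eventually.of_forall fun N h' => absurd h h'
      · filter_upwards [bx_disj (σ v) (σ w) (by rw [hσ, hσ]; exact fun h' => h (d.vinj h'))]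
          with N hN _ using hN
  have f2 : ∀ᶠ ε in 𝓝[>] (0 : ℝ), ∀ (v : V) (e : G.edgeSet), v ∉ (e : Sym2 V) →
      Disjoint (bx (σ v) ε) (closure (d.emap e)) :=
    Filter.eventually_all.2 fun v => Filter.eventually_all.2 fun e => by
      by_cases h : v ∈ (e : Sym2 V)
      · exact Filter.Eventually.of_forall fun N h' => absurd h h'
      · filter_upwards [bx_avoid (σ v) isClosed_closure (by rwa [hσ, edge_closure])]
          with N hN _ using hN
  have f3 : ∀ᶠ ε in 𝓝[>] (0 : ℝ), ∀ v : V,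
      Disjoint (bx (σ v) ε) ((fun t => pr (Γ t)) '' Icc 0 1) :=
    Filter.eventually_all.2 fun v => bx_avoid (σ v) hgc.isClosed (by
      rw [hσ]; rintro ⟨t, ht, h⟩; exact hV t ht v h)
  obtain ⟨ε, g1, g2, g3, hε⟩ :=
    (f1.and (f2.and (f3.and (self_mem_nhdsWithin (a := (0 : ℝ)) (s := Ioi 0))))).exists
  have hnb : ∀ v, bx (σ v) ε ∈ 𝓝 (d.vmap v) := fun v => by
    rw [← hσ]; exact bx_nhds _ hε
  have hK : ∀ e : Sym2 V, ∃ K : Set Torus, ∀ he : e ∈ H.edgeSet, IsCompact K ∧ IsPreconnected K ∧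
      K ⊆ d.emap ⟨e, SimpleGraph.edgeSet_mono hH he⟩ ∧ ∀ z ∈ e, (K ∩ bx (σ z) ε).Nonempty := by
    intro e
    by_cases he : e ∈ H.edgeSet
    · set e' : G.edgeSet := ⟨e, SimpleGraph.edgeSet_mono hH he⟩ with he'
      induction e using Sym2.ind with
      | _ u w =>
        obtain ⟨s, hs, hsu⟩ := edge_near d e' (hφ e') (Sym2.mem_mk_left u w) (hnb u)
        obtain ⟨t, ht, htw⟩ := edge_near d e' (hφ e') (Sym2.mem_mk_right u w) (hnb w)
        obtain ⟨k1, k2, k3⟩ := sub_arc (hφc e') hs ht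
        refine ⟨φ e' '' uIcc s t, fun _ => ⟨k1, k2, k3.trans (hφ e').subset, ?_⟩⟩
        intro z hz
        rcases Sym2.mem_iff.1 hz with rfl | rfl
        · exact ⟨_, ⟨s, left_mem_uIcc, rfl⟩, hsu⟩
        · exact ⟨_, ⟨t, right_mem_uIcc, rfl⟩, htw⟩
    · exact ⟨∅, fun h => absurd h he⟩
  choose K hK using hK
  refine discretize H (fun v => bx (σ v) ε) K (fun v => bx_compact _ _) (fun v => bx_conn _ _) g1
    (fun e he => (hK e he).1) (fun e he => (hK e he).2.1) ?_ ?_ (fun e he => (hK e he).2.2.2)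
    Γ hΓ.continuousOn a b hab hΓ1 ?_ ?_
  · intro e he e' he' hne
    have h1 := (hK e he).2.2.1
    have h2 := (hK e' he').2.2.1
    refine Disjoint.mono h1 h2 (Set.disjoint_iff_inter_eq_empty.2 (d.edges_disj _ _ ?_))
    intro h
    exact hne (congrArg Subtype.val h)
  · intro e he z hz
    exact ((g2 z ⟨e, SimpleGraph.edgeSet_mono hH he⟩ hz).mono_right
      ((hK e he).2.2.1.trans subset_closure)).symm
  · intro v t ht h
    exact (g3 v).ne_of_mem h ⟨t, ht, rfl⟩ rfl
  · intro e he t ht h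
    exact hE t ht ⟨e, SimpleGraph.edgeSet_mono hH he⟩ he ((hK e he).2.2.1 h)

end TorusThree

namespace TorusThree

open scoped Classical

/-! ### Part J: a curve through a vertex -/

/-- polar coordinates around `c` -/
def pol (c : ℝ × ℝ) (ρ θ : ℝ) : ℝ × ℝ := (c.1 + ρ * Real.cos θ, c.2 + ρ * Real.sin θ)

lemma pol_cont (c : ℝ × ℝ) (ρ : ℝ) : Continuous (pol c ρ) := by
  unfold pol; fun_prop

/-- closed disks in the torus -/
def dk (c : ℝ × ℝ) (r : ℝ) : Set Torus :=
  pr '' {x | (x.1 - c.1) ^ 2 + (x.2 - c.2) ^ 2 ≤ r ^ 2}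

lemma sq_bd {x y r : ℝ} (hr : 0 ≤ r) (h : x ^ 2 + y ^ 2 ≤ r ^ 2) : |x| ≤ r ∧ |y| ≤ r :=
  ⟨abs_le_of_sq_le_sq (by nlinarith [sq_nonneg y]) hr,
    abs_le_of_sq_le_sq (by nlinarith [sq_nonneg x]) hr⟩

lemma dk_sub (c : ℝ × ℝ) {r : ℝ} (hr : 0 ≤ r) : dk c r ⊆ bx c r := by
  rintro _ ⟨x, hx, rfl⟩
  obtain ⟨h1, h2⟩ := sq_bd hr hx
  exact ⟨x, ⟨by rwa [abs_sub_comm], by rwa [abs_sub_comm]⟩, rfl⟩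

lemma dk_compact (c : ℝ × ℝ) {r : ℝ} (hr : 0 ≤ r) : IsCompact (dk c r) := by
  refine IsCompact.image ?_ pr_cont
  have hcl : IsClosed {x : ℝ × ℝ | (x.1 - c.1) ^ 2 + (x.2 - c.2) ^ 2 ≤ r ^ 2} :=
    isClosed_le (by fun_prop) continuous_const
  refine ((isCompact_Icc (a := c.1 - r) (b := c.1 + r)).prod
    (isCompact_Icc (a := c.2 - r) (b := c.2 + r))).of_isClosed_subset hcl ?_
  intro x hx
  obtain ⟨h1, h2⟩ := sq_bd hr hx
  rw [abs_le] at h1 h2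
  refine ⟨⟨?_, ?_⟩, ?_, ?_⟩ <;> linarith

lemma dk_nhds (c : ℝ × ℝ) {r : ℝ} {x : ℝ × ℝ} (h : (x.1 - c.1) ^ 2 + (x.2 - c.2) ^ 2 < r ^ 2) :
    dk c r ∈ 𝓝 (pr x) := by
  have ho : IsOpen {x : ℝ × ℝ | (x.1 - c.1) ^ 2 + (x.2 - c.2) ^ 2 < r ^ 2} :=
    isOpen_lt (by fun_prop) continuous_const
  refine Filter.mem_of_superset (pr_open.image_mem_nhds (ho.mem_nhds h)) ?_
  refine image_mono fun t ht => ?_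
  rw [Set.mem_ofPred_eq] at ht ⊢
  exact ht.le

lemma pol_ex (c : ℝ × ℝ) {r : ℝ} (hr : 0 < r) {x : ℝ × ℝ}
    (h : (x.1 - c.1) ^ 2 + (x.2 - c.2) ^ 2 = r ^ 2) : ∃ θ, x = pol c r θ := by
  let z : ℂ := ⟨x.1 - c.1, x.2 - c.2⟩
  have hz : ‖z‖ = r := by
    rw [Complex.norm_def, Complex.normSq_apply]
    rw [← Real.sqrt_sq hr.le, ← h]
    congr 1
    simp only [z]; ring
  refine ⟨z.arg, ?_⟩
  have h1 := Complex.norm_mul_cos_arg z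
  have h2 := Complex.norm_mul_sin_arg z
  rw [hz] at h1 h2
  ext
  · simp only [pol, h1, z]; ring
  · simp only [pol, h2, z]; ring

lemma dk_bdry (c : ℝ × ℝ) {r : ℝ} (hr : 0 < r) {y : Torus} (hy : y ∈ dk c r)
    (hn : dk c r ∉ 𝓝 y) : ∃ θ, y = pr (pol c r θ) := by
  obtain ⟨x, hx, rfl⟩ := hy
  rw [Set.mem_ofPred_eq] at hx
  rcases hx.lt_or_eq with h | h
  · exact absurd (dk_nhds c h) hn
  · obtain ⟨θ, hθ⟩ := pol_ex c hr h
    exact ⟨θ, by rw [hθ]⟩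

lemma pol_sq (c : ℝ × ℝ) (ρ θ : ℝ) :
    ((pol c ρ θ).1 - c.1) ^ 2 + ((pol c ρ θ).2 - c.2) ^ 2 = ρ ^ 2 := by
  simp only [pol, add_sub_cancel_left]
  rw [mul_pow, mul_pow, ← mul_add, Real.cos_sq_add_sin_sq, mul_one]

lemma pol_mem (c : ℝ × ℝ) {ρ r θ : ℝ} (h0 : 0 ≤ ρ) (h : ρ ≤ r) : pr (pol c ρ θ) ∈ dk c r :=
  ⟨_, by rw [Set.mem_ofPred_eq, pol_sq]; exact pow_le_pow_left₀ h0 h 2, rfl⟩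

lemma pr_inj_small {x y : ℝ × ℝ} (h : pr x = pr y) (h1 : |x.1 - y.1| < 1) (h2 : |x.2 - y.2| < 1) :
    x = y := by
  obtain ⟨a, b, rfl⟩ := pr_eq h
  have e1 : x.1 - (x.1 + a) = ((-a : ℤ) : ℝ) := by push_cast; ring
  have e2 : x.2 - (x.2 + b) = ((-b : ℤ) : ℝ) := by push_cast; ring
  dsimp only at h1 h2
  rw [e1, ← Int.cast_abs] at h1
  rw [e2, ← Int.cast_abs] at h2
  have a0 : |(-a)| < 1 := by exact_mod_cast h1
  have b0 : |(-b)| < 1 := by exact_mod_cast h2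
  rw [Int.abs_lt_one_iff] at a0 b0
  have : a = 0 := by omega
  have : b = 0 := by omega
  subst_vars
  simp

/-- injectivity of polar coordinates in the torus -/
lemma pol_inj (c : ℝ × ℝ) {r ρ θ θ' : ℝ} (hr : 0 < r) (hr' : r < 1 / 4) (h0 : 0 ≤ ρ) (h1 : ρ ≤ r)
    (h : pr (pol c ρ θ) = pr (pol c r θ')) : ∃ k : ℤ, θ - θ' = 2 * Real.pi * k := by
  have b1 := sq_bd h0 (pol_sq c ρ θ).le
  have b2 := sq_bd hr.le (pol_sq c r θ').le
  rw [abs_le, abs_le] at b1 b2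
  have e := pr_inj_small h (by rw [abs_lt]; constructor <;> linarith)
    (by rw [abs_lt]; constructor <;> linarith)
  have e1 := pol_sq c ρ θ
  rw [e, pol_sq] at e1
  have e2 : ρ = r := by
    rw [← abs_of_nonneg h0, ← abs_of_pos hr]
    exact (sq_eq_sq_iff_abs_eq_abs _ _).1 e1.symm
  subst e2
  have f1 := (Prod.ext_iff.1 e).1
  have f2 := (Prod.ext_iff.1 e).2
  simp only [pol, add_right_inj] at f1 f2
  exact Real.Angle.angle_eq_iff_two_pi_dvd_sub.1 (Real.Angle.cos_sin_inj
    (mul_left_cancel₀ hr.ne' f1) (mul_left_cancel₀ hr.ne' f2))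

lemma pol_period (c : ℝ × ℝ) (r θ : ℝ) (k : ℤ) : pol c r (θ + k * (2 * Real.pi)) = pol c r θ := by
  simp only [pol, Real.cos_add_int_mul_two_pi, Real.sin_add_int_mul_two_pi]

lemma pol_norm (c : ℝ × ℝ) (r θ θ1 : ℝ) :
    ∃ θ' ∈ Ico θ1 (θ1 + 2 * Real.pi), pol c r θ' = pol c r θ := by
  refine ⟨toIcoMod Real.two_pi_pos θ1 θ, toIcoMod_mem_Ico _ _ _, ?_⟩
  have := self_sub_toIcoDiv_zsmul Real.two_pi_pos θ1 θ
  rw [← this, zsmul_eq_mul, sub_eq_add_neg, ← neg_mul, ← Int.cast_neg, pol_period]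

/-- first hit of a closed set -/
lemma first_hit {D : Set Torus} (hD : IsClosed D) {f : ℝ → Torus} {s t : ℝ}
    (hf : ContinuousOn f (uIcc s t)) (hs : f s ∉ D) (ht : f t ∈ D) :
    ∃ τ ∈ uIcc s t, f τ ∈ D ∧ D ∉ 𝓝 (f τ) ∧ ∀ x ∈ uIcc s τ, x ≠ τ → f x ∉ D := by
  have hc : IsCompact (uIcc s t ∩ f ⁻¹' D) :=
    isCompact_uIcc.of_isClosed_subset (hf.preimage_isClosed_of_isClosed isClosed_Icc hD)
      inter_subset_left
  obtain ⟨τ, ⟨hτ, hτD⟩, hmin⟩ := hc.exists_isMinOn ⟨t, right_mem_uIcc, ht⟩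
    (f := fun x => |x - s|) (by fun_prop)
  have hsub : uIcc s τ ⊆ uIcc s t := uIcc_subset_uIcc_left hτ
  have hno : ∀ x ∈ uIcc s τ, x ≠ τ → f x ∉ D := by
    intro x hx hne hxD
    have h1 : |τ - s| ≤ |x - s| := hmin ⟨hsub hx, hxD⟩
    apply hne
    rcases le_total s τ with h | h
    · rw [uIcc_of_le h] at hx
      rw [abs_of_nonneg (by linarith), abs_of_nonneg (by linarith [hx.1])] at h1
      linarith [hx.2]
    · rw [uIcc_of_ge h] at hx
      rw [abs_of_nonpos (by linarith), abs_of_nonpos (by linarith [hx.2])] at h1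
      linarith [hx.1]
  refine ⟨τ, hτ, hτD, fun hn => ?_, hno⟩
  have hne : s ≠ τ := fun h => hs (h ▸ hτD)
  have hcont : ContinuousWithinAt f (uIcc s τ) τ := (hf τ hτ).mono hsub
  have hev : ∀ᶠ x in 𝓝[uIcc s τ] τ, f x ∈ D := hcont hn
  have htd : Filter.Tendsto (fun l : ℝ => τ + l * (s - τ)) (𝓝[>] 0) (𝓝[uIcc s τ] τ) := by
    refine tendsto_nhdsWithin_iff.2 ⟨?_, ?_⟩
    · have : Continuous fun l : ℝ => τ + l * (s - τ) := by fun_prop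
      have h0 := this.tendsto 0
      simp only [zero_mul, add_zero] at h0
      exact h0.mono_left nhdsWithin_le_nhds
    · filter_upwards [Ioo_mem_nhdsGT (show (0 : ℝ) < 1 by norm_num)] with l hl
      rw [mem_uIcc]
      rcases le_total s τ with h | h
      · left; constructor <;> nlinarith [hl.1, hl.2]
      · right; constructor <;> nlinarith [hl.1, hl.2]
  obtain ⟨l, hl1, hl2, hl3⟩ := ((htd.eventually hev).and ((htd.eventually
    self_mem_nhdsWithin).and (Ioo_mem_nhdsGT (show (0 : ℝ) < 1 by norm_num)))).exists
  refine hno _ hl2 ?_ hl1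
  intro h
  have : l * (s - τ) = 0 := by linarith
  rcases mul_eq_zero.1 this with h | h
  · exact hl3.1.ne' h
  · exact hne (by linarith)

/-- the curve leaves small disks -/
lemma exit (Γ : ℝ → ℝ × ℝ) (hΓ : Continuous Γ)
    (hne : ∀ t ∈ Ioc (0 : ℝ) (1 / 2), pr (Γ t) ≠ pr (Γ 0)) :
    ∀ᶠ r in 𝓝[>] (0 : ℝ), ∃ t1 ∈ Ioo (0 : ℝ) (1 / 2), (∃ θ, Γ t1 = pol (Γ 0) r θ) ∧
      ∀ t ∈ Ioc t1 (1 / 2), pr (Γ t) ∉ dk (Γ 0) r := by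
  set c := Γ 0 with hc
  let B : Set ℝ := Icc 0 (1 / 2) ∩ {t | 1 / 2 ≤ max |(Γ t).1 - c.1| |(Γ t).2 - c.2|}
  have hB : IsCompact B := isCompact_Icc.inter_right (isClosed_le continuous_const (by fun_prop))
  have hcB : pr c ∉ (fun t => pr (Γ t)) '' B := by
    rintro ⟨t, ⟨h1, h2⟩, h⟩
    rcases h1.1.eq_or_lt with h0 | h0
    · rw [← h0, Set.mem_ofPred_eq, ← hc] at h2
      norm_num at h2
    · exact hne t ⟨h0, h1.2⟩ h
  have k1 := bx_avoid c (hB.image (pr_cont.comp hΓ)).isClosed hcB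
  have k2 := bx_avoid c (isClosed_singleton (x := pr (Γ (1 / 2))))
    (fun h => hne (1 / 2) (by norm_num) h.symm)
  filter_upwards [k1, k2, Ioo_mem_nhdsGT (show (0 : ℝ) < 1 / 4 by norm_num)] with r h1 h2 hr
  have hD := dk_sub c hr.1.le
  obtain ⟨τ, hτ, hτD, hτn, hno⟩ := first_hit (dk_compact c hr.1.le).isClosed
    (f := fun t => pr (Γ t)) (s := 1 / 2) (t := 0) (pr_cont.comp hΓ).continuousOn
    (fun h => h2.ne_of_mem (hD h) rfl rfl)
    ⟨c, by simp; positivity, rfl⟩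
  rw [uIcc_of_ge (by norm_num)] at hτ
  rw [uIcc_of_ge hτ.2] at hno
  obtain ⟨θ, hθ⟩ := dk_bdry c hr.1 hτD hτn
  have hB' : τ ∉ B := fun h => h1.ne_of_mem (hD hτD) ⟨τ, h, rfl⟩ rfl
  have hB2 : max |(Γ τ).1 - c.1| |(Γ τ).2 - c.2| < 1 / 2 := by
    by_contra h
    exact hB' ⟨hτ, not_lt.1 h⟩
  obtain ⟨m1, m2⟩ := max_lt_iff.1 hB2
  have b2 := sq_bd hr.1.le (pol_sq c r θ).le
  rw [abs_le, abs_le] at b2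
  rw [abs_lt] at m1 m2
  have hr2 := hr.2
  have e : Γ τ = pol c r θ := pr_inj_small hθ (by rw [abs_lt]; constructor <;> linarith)
    (by rw [abs_lt]; constructor <;> linarith)
  refine ⟨τ, ⟨lt_of_le_of_ne hτ.1 ?_, lt_of_le_of_ne hτ.2 ?_⟩, ⟨θ, e⟩, ?_⟩
  · rintro rfl
    have := pol_sq c r θ
    rw [← e, ← hc] at this
    simp only [sub_self] at this
    nlinarith [hr.1]
  · rintro rfl
    exact h2.ne_of_mem (hD hτD) rfl rfl
  · intro t ht
    exact hno t ⟨ht.1.le, ht.2⟩ ht.1.ne'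

end TorusThree

namespace TorusThree

open scoped Classical

/-! ### Part K: splitting a vertex -/

/-- the projection collapsing the two copies of the split vertex -/
def spi {V : Type} (w0 : V) (x : Option V) : V := x.getD w0

def splitG {V : Type} (G : SimpleGraph V) (w0 : V) (side : Sym2 V → Prop) :
    SimpleGraph (Option V) where
  Adj x y := G.Adj (spi w0 x) (spi w0 y) ∧ (w0 ∈ s(spi w0 x, spi w0 y) →
    (side s(spi w0 x, spi w0 y) ↔ (x ≠ none ∧ y ≠ none)))
  symm := ⟨by
    rintro x y ⟨h1, h2⟩
    refine ⟨h1.symm, ?_⟩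
    rw [Sym2.eq_swap, and_comm]
    exact h2⟩
  loopless := ⟨fun x h => h.1.ne rfl⟩

section split
variable {V : Type} {G : SimpleGraph V} {w0 : V} {side : Sym2 V → Prop}

lemma split_map {e : Sym2 (Option V)} (he : e ∈ (splitG G w0 side).edgeSet) :
    Sym2.map (spi w0) e ∈ G.edgeSet := by
  induction e using Sym2.ind with
  | _ x y => exact he.1

lemma split_mem {e : Sym2 (Option V)} {v : V} (hv : v ≠ w0) :
    some v ∈ e ↔ v ∈ Sym2.map (spi w0) e := by
  induction e using Sym2.ind with
  | _ x y =>
    rw [Sym2.map_mk, Sym2.mem_iff, Sym2.mem_iff]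
    cases x <;> cases y <;> simp [spi, hv]

lemma split_none {e : Sym2 (Option V)} (he : e ∈ (splitG G w0 side).edgeSet) :
    none ∈ e ↔ w0 ∈ Sym2.map (spi w0) e ∧ ¬ side (Sym2.map (spi w0) e) := by
  induction e using Sym2.ind with
  | _ x y =>
    obtain ⟨h1, h2⟩ := he
    rw [Sym2.map_mk, Sym2.mem_iff]
    have h3 : x = none ∨ y = none → w0 ∈ s(spi w0 x, spi w0 y) := by
      rintro (rfl | rfl) <;> simp [spi]
    constructor
    · rintro h
      have h4 : none = x ∨ none = y → x = none ∨ y = none := by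
        rintro (h | h) <;> simp [← h]
      refine ⟨h3 (h4 h), fun hs => ?_⟩
      have := (h2 (h3 (h4 h))).1 hs
      rcases h4 h with h | h
      · exact this.1 h
      · exact this.2 h
    · rintro ⟨ha, hb⟩
      by_contra hcon
      push Not at hcon
      exact hb ((h2 ha).2 ⟨hcon.1.symm, hcon.2.symm⟩)

lemma split_some {e : Sym2 (Option V)} (he : e ∈ (splitG G w0 side).edgeSet) :
    some w0 ∈ e ↔ w0 ∈ Sym2.map (spi w0) e ∧ side (Sym2.map (spi w0) e) := by
  have hn := split_none he
  induction e using Sym2.ind with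
  | _ x y =>
    obtain ⟨h1, h2⟩ := he
    rw [Sym2.map_mk] at hn ⊢
    rw [Sym2.mem_iff] at hn ⊢
    have h3 := h1.ne
    have h4 := h1.ne.symm
    cases x <;> cases y <;> simp_all [spi]

lemma split_inj {e e' : Sym2 (Option V)} (he : e ∈ (splitG G w0 side).edgeSet)
    (he' : e' ∈ (splitG G w0 side).edgeSet)
    (h : Sym2.map (spi w0) e = Sym2.map (spi w0) e') : e = e' := by
  refine Sym2.ext fun x => ?_
  cases x with
  | none => rw [split_none he, split_none he', h]
  | some v =>
    by_cases hv : v = w0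
    · subst hv; rw [split_some he, split_some he', h]
    · rw [split_mem hv, split_mem hv, h]

lemma split_tf (h : TF G) : TF (splitG G w0 side) := fun _ _ _ ha hb hc => h _ _ _ ha.1 hb.1 hc.1

lemma split_nadj : ¬ (splitG G w0 side).Adj (some w0) none := fun h => h.1.ne rfl

lemma split_col (h : GoodCol (splitG G w0 side) (some w0) none) : G.Colorable 3 := by
  obtain ⟨c, h1, h2⟩ := h
  refine ⟨SimpleGraph.Coloring.mk (fun v => c (some v)) ?_⟩
  intro v w hvw
  by_cases hs : side s(v, w)
  · exact h1 (some v) (some w) ⟨hvw, fun _ => ⟨fun _ => by simp, fun _ => hs⟩⟩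
  by_cases hv : v = w0
  · subst hv
    change c (some v) ≠ _
    rw [h2]
    exact h1 none (some w) ⟨hvw, fun _ => ⟨fun h => absurd h hs, fun h => absurd rfl h.1⟩⟩
  by_cases hw : w = w0
  · subst hw
    change _ ≠ c (some w)
    rw [h2]
    exact h1 (some v) none ⟨hvw, fun _ => ⟨fun h => absurd h hs, fun h => absurd rfl h.2⟩⟩
  · refine h1 (some v) (some w) ⟨hvw, fun h => ?_⟩
    rcases Sym2.mem_iff.1 h with h | h
    · exact absurd h.symm hv
    · exact absurd h.symm hw

theorem split_host [Fintype V] (B : V → Set Torus) (Xp Xn : Set Torus) (K : Sym2 V → Set Torus)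
    (hBc : ∀ v, IsCompact (B v)) (hBp : ∀ v, IsPreconnected (B v))
    (hXc : IsCompact Xp) (hXp : IsPreconnected Xp) (hYc : IsCompact Xn) (hYp : IsPreconnected Xn)
    (hXY : Disjoint Xp Xn)
    (hBB : ∀ v w, v ≠ w → Disjoint (B v) (B w))
    (hBX : ∀ v, v ≠ w0 → Disjoint (B v) Xp) (hBY : ∀ v, v ≠ w0 → Disjoint (B v) Xn)
    (hKc : ∀ e ∈ G.edgeSet, IsCompact (K e)) (hKp : ∀ e ∈ G.edgeSet, IsPreconnected (K e))
    (hKd : ∀ e ∈ G.edgeSet, ∀ e' ∈ G.edgeSet, e ≠ e' → Disjoint (K e) (K e'))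
    (hKB : ∀ e ∈ G.edgeSet, ∀ v, v ≠ w0 → v ∉ e → Disjoint (K e) (B v))
    (hKm : ∀ e ∈ G.edgeSet, ∀ v, v ≠ w0 → v ∈ e → (K e ∩ B v).Nonempty)
    (hK0 : ∀ e ∈ G.edgeSet, w0 ∉ e → Disjoint (K e) Xp ∧ Disjoint (K e) Xn)
    (hK1 : ∀ e ∈ G.edgeSet, w0 ∈ e → side e → (K e ∩ Xp).Nonempty ∧ Disjoint (K e) Xn)
    (hK2 : ∀ e ∈ G.edgeSet, w0 ∈ e → ¬ side e → (K e ∩ Xn).Nonempty ∧ Disjoint (K e) Xp)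
    (Γ : ℝ → ℝ × ℝ) (hΓ : ContinuousOn Γ (Icc 0 1)) (a b : ℤ) (hab : a ≠ 0 ∨ b ≠ 0)
    (hΓ1 : Γ 1 = ((Γ 0).1 + a, (Γ 0).2 + b))
    (hΓB : ∀ v, v ≠ w0 → ∀ t ∈ Icc (0 : ℝ) 1, pr (Γ t) ∉ B v)
    (hΓX : ∀ t ∈ Icc (0 : ℝ) 1, pr (Γ t) ∉ Xp) (hΓY : ∀ t ∈ Icc (0 : ℝ) 1, pr (Γ t) ∉ Xn)
    (hΓK : ∀ e ∈ G.edgeSet, ∀ t ∈ Icc (0 : ℝ) 1, pr (Γ t) ∉ K e) :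
    HasDual (splitG G w0 side) := by
  let X : Option V → Set Torus := fun x => match x with
    | none => Xn
    | some v => if v = w0 then Xp else B v
  have x0 : X none = Xn := rfl
  have x1 : X (some w0) = Xp := if_pos rfl
  have x2 : ∀ v, v ≠ w0 → X (some v) = B v := fun v hv => if_neg hv
  have cases : ∀ P : Option V → Prop, P none → P (some w0) → (∀ v, v ≠ w0 → P (some v)) → ∀ x, P x := by
    intro P h0 h1 h2 x
    cases x with
    | none => exact h0
    | some v =>
      by_cases hv : v = w0
      · subst hv; exact h1
      · exact h2 v hv
  refine discretize (splitG G w0 side) X (fun e => K (Sym2.map (spi w0) e)) ?_ ?_ ?_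
    (fun e he => hKc _ (split_map he)) (fun e he => hKp _ (split_map he)) ?_ ?_ ?_
    Γ hΓ a b hab hΓ1 ?_ (fun e he => hΓK _ (split_map he))
  · refine cases _ hYc (by rw [x1]; exact hXc) (fun v hv => by rw [x2 v hv]; exact hBc v)
  · refine cases _ hYp (by rw [x1]; exact hXp) (fun v hv => by rw [x2 v hv]; exact hBp v)
  · refine cases _ ?_ ?_ ?_
    · refine cases _ (fun h => absurd rfl h) (fun _ => by rw [x1]; exact hXY.symm)
        (fun v hv _ => by rw [x2 v hv]; exact (hBY v hv).symm)
    · refine cases _ (fun _ => by rw [x1]; exact hXY) (fun h => absurd rfl h)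
        (fun v hv _ => by rw [x2 v hv, x1]; exact (hBX v hv).symm)
    · intro w hw
      refine cases _ (fun _ => by rw [x2 w hw]; exact hBY w hw)
        (fun h => by rw [x2 w hw, x1]; exact hBX w hw)
        (fun v hv h => by
          rw [x2 v hv, x2 w hw]; exact hBB _ _ (fun h' => h (by rw [h'])))
  · intro e he e' he' hne
    exact hKd _ (split_map he) _ (split_map he') (fun h => hne (split_inj he he' h))
  · intro e he
    have hm := split_map he
    refine cases _ ?_ ?_ ?_
    · rw [split_none he]
      intro h
      by_cases h0 : w0 ∈ Sym2.map (spi w0) e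
      · exact (hK1 _ hm h0 (by tauto)).2
      · exact (hK0 _ hm h0).2
    · rw [split_some he, x1]
      intro h
      by_cases h0 : w0 ∈ Sym2.map (spi w0) e
      · exact (hK2 _ hm h0 (by tauto)).2
      · exact (hK0 _ hm h0).1
    · intro v hv
      rw [split_mem hv, x2 v hv]
      exact hKB _ hm v hv
  · intro e he
    have hm := split_map he
    refine cases _ ?_ ?_ ?_
    · rw [split_none he]
      exact fun h => (hK2 _ hm h.1 h.2).1
    · rw [split_some he, x1]
      exact fun h => (hK1 _ hm h.1 h.2).1
    · intro v hv
      rw [split_mem hv, x2 v hv]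
      exact hKm _ hm v hv
  · refine cases _ hΓY (by rw [x1]; exact hΓX) (fun v hv => by rw [x2 v hv]; exact hΓB v hv)

end split

end TorusThree

namespace TorusThree

open scoped Classical

/-! ### Part L: straightening the curve near the vertex -/

lemma pol_cont2 (c : ℝ × ℝ) (θ : ℝ) : Continuous (fun ρ => pol c ρ θ) := by
  unfold pol; fun_prop

theorem curve_mod (Γ : ℝ → ℝ × ℝ) (hΓ : Continuous Γ) (a b : ℤ)
    (hΓ1 : Γ 1 = ((Γ 0).1 + a, (Γ 0).2 + b))
    (hne : ∀ t ∈ Ioo (0 : ℝ) 1, pr (Γ t) ≠ pr (Γ 0))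
    (hinj : ∀ s ∈ Ioo (0 : ℝ) 1, ∀ t ∈ Ioo (0 : ℝ) 1, pr (Γ s) = pr (Γ t) → s = t) :
    ∀ᶠ r in 𝓝[>] (0 : ℝ), ∃ θ1 θ2 τ1 τ2 : ℝ, ∃ Γ' : ℝ → ℝ × ℝ,
      θ1 < θ2 ∧ θ2 < θ1 + 2 * Real.pi ∧ τ1 ∈ Ioo (0 : ℝ) 1 ∧ τ2 ∈ Ioo (0 : ℝ) 1 ∧
      pr (pol (Γ 0) r θ1) = pr (Γ τ1) ∧ pr (pol (Γ 0) r θ2) = pr (Γ τ2) ∧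
      Continuous Γ' ∧ Γ' 1 = ((Γ' 0).1 + a, (Γ' 0).2 + b) ∧
      ∀ t ∈ Icc (0 : ℝ) 1, (∃ ρ ∈ Icc 0 r, pr (Γ' t) = pr (pol (Γ 0) ρ θ1)) ∨
        (∃ ρ ∈ Icc 0 r, pr (Γ' t) = pr (pol (Γ 0) ρ θ2)) ∨
        ∃ τ ∈ Ioo (0 : ℝ) 1, pr (Γ' t) = pr (Γ τ) ∧ pr (Γ' t) ∉ dk (Γ 0) r := by
  set c := Γ 0 with hc
  let R : ℝ → ℝ × ℝ := fun t => ((Γ (1 - t)).1 + ((-a : ℤ) : ℝ), (Γ (1 - t)).2 + ((-b : ℤ) : ℝ))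
  have hR : ∀ t, pr (R t) = pr (Γ (1 - t)) := fun t => pr_add_int _ _ _
  have hRc : Continuous R := by
    have : Continuous fun t : ℝ => Γ (1 - t) := by fun_prop
    fun_prop
  have hR0 : R 0 = c := by
    simp only [R, sub_zero, hΓ1]
    ext <;> simp
  have E1 := exit Γ hΓ (fun t ht => hne t ⟨ht.1, by linarith [ht.2]⟩)
  have E2 := exit R hRc (fun t ht => by
    rw [hR, hR0]; exact hne _ ⟨by linarith [ht.2], by linarith [ht.1]⟩)
  rw [hR0] at E2
  rw [← hc] at E1
  filter_upwards [E1, E2, self_mem_nhdsWithin] with r ⟨t1, ht1, ⟨θ1, h1⟩, o1⟩ ⟨u, hu, ⟨θ, h2⟩, o2⟩ hr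
  have hr : 0 < r := hr
  obtain ⟨θ2, hθ2, hp⟩ := pol_norm c r θ θ1
  have q1 : pr (pol c r θ1) = pr (Γ t1) := by rw [h1]
  have q2 : pr (pol c r θ2) = pr (Γ (1 - u)) := by rw [hp, ← h2, hR]
  have m1 : t1 ∈ Ioo (0 : ℝ) 1 := ⟨ht1.1, by linarith [ht1.2]⟩
  have m2 : 1 - u ∈ Ioo (0 : ℝ) 1 := ⟨by linarith [hu.2], by linarith [hu.1]⟩
  have hlt : θ1 < θ2 := by
    refine lt_of_le_of_ne hθ2.1 fun h => ?_
    rw [← h, q1] at q2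
    have := hinj _ m1 _ m2 q2
    linarith [ht1.2, hu.2]
  let P3 : ℝ → ℝ × ℝ := fun t => ((pol c ((1 - t) / u * r) θ2).1 + (a : ℝ),
    (pol c ((1 - t) / u * r) θ2).2 + (b : ℝ))
  let P1 : ℝ → ℝ × ℝ := fun t => pol c (t / t1 * r) θ1
  have c1 : Continuous P1 := (pol_cont2 c θ1).comp (by fun_prop)
  have c3 : Continuous P3 := by
    have : Continuous fun t : ℝ => pol c ((1 - t) / u * r) θ2 := (pol_cont2 c θ2).comp (by fun_prop)
    fun_prop
  have hu0 : u ≠ 0 := hu.1.ne'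
  have ht0 : t1 ≠ 0 := ht1.1.ne'
  have hlast : P3 (1 - u) = Γ (1 - u) := by
    simp only [P3, sub_sub_cancel, div_self hu0, one_mul, hp, ← h2, R]
    ext <;> simp
  have hfirst : P1 t1 = Γ t1 := by simp only [P1, div_self ht0, one_mul, h1]
  refine ⟨θ1, θ2, t1, 1 - u, fun t => if t ≤ t1 then P1 t else if t ≤ 1 - u then Γ t else P3 t,
    hlt, hθ2.2, m1, m2, q1, q2, ?_, ?_, ?_⟩
  · refine Continuous.if_le c1 (Continuous.if_le hΓ c3 continuous_id continuous_const ?_)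
      continuous_id continuous_const ?_
    · rintro x rfl; exact hlast.symm
    · rintro x rfl
      rw [if_pos (by linarith [ht1.2, hu.2]), hfirst]
  · beta_reduce
    rw [if_neg (by linarith [ht1.2]), if_neg (by linarith [hu.1]), if_pos ht1.1.le]
    simp [P1, P3, pol]
  · intro t ht
    beta_reduce
    by_cases k1 : t ≤ t1
    · rw [if_pos k1]
      left
      refine ⟨t / t1 * r, ⟨mul_nonneg (div_nonneg ht.1 ht1.1.le) hr.le, ?_⟩, rfl⟩
      have : t / t1 ≤ 1 := (div_le_one ht1.1).2 k1
      nlinarith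
    rw [if_neg k1]
    right
    push Not at k1
    by_cases k2 : t < 1 - u
    · rw [if_pos k2.le]
      right
      refine ⟨t, ⟨by linarith [ht1.1], by linarith [hu.1]⟩, rfl, ?_⟩
      by_cases k3 : t ≤ 1 / 2
      · exact o1 t ⟨k1, k3⟩
      · have := o2 (1 - t) ⟨by linarith, by linarith⟩
        rwa [hR, sub_sub_cancel] at this
    · left
      push Not at k2
      have k4 : (if t ≤ 1 - u then Γ t else P3 t) = P3 t := by
        split_ifs with k
        · rw [le_antisymm k k2, hlast]
        · rfl
      rw [k4]
      refine ⟨(1 - t) / u * r, ⟨mul_nonneg (div_nonneg (by linarith [ht.2]) hu.1.le) hr.le, ?_⟩, pr_add_int _ _ _⟩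
      have : (1 - t) / u ≤ 1 := (div_le_one hu.1).2 (by linarith)
      nlinarith

end TorusThree

namespace TorusThree

open scoped Classical

/-! ### Part M: the curve passes through a vertex -/

lemma ang_eq (c : ℝ × ℝ) {r ρ θ θ' θ1 : ℝ} (hr : 0 < r) (hr' : r < 1 / 4) (h0 : 0 ≤ ρ) (h1 : ρ ≤ r)
    (hθ : θ ∈ Ico θ1 (θ1 + 2 * Real.pi)) (hθ' : θ' ∈ Ico θ1 (θ1 + 2 * Real.pi))
    (h : pr (pol c ρ θ) = pr (pol c r θ')) : θ = θ' := by
  obtain ⟨k, hk⟩ := pol_inj c hr hr' h0 h1 h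
  have hp := Real.pi_pos
  have k1 : (k : ℝ) < 1 := by
    by_contra hcon
    push Not at hcon
    nlinarith [hθ.1, hθ.2, hθ'.1, hθ'.2]
  have k2 : (-1 : ℝ) < k := by
    by_contra hcon
    push Not at hcon
    nlinarith [hθ.1, hθ.2, hθ'.1, hθ'.2]
  have k3 : k < 1 := by exact_mod_cast k1
  have k4 : -1 < k := by exact_mod_cast k2
  have : k = 0 := by omega
  subst this
  simp at hk
  linarith

lemma ev_le {x : ℝ} (hx : 0 < x) : ∀ᶠ δ in 𝓝[>] (0 : ℝ), δ ≤ x :=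
  (eventually_le_nhds hx).filter_mono nhdsWithin_le_nhds

theorem case_two {V : Type} [Fintype V] {G : SimpleGraph V} (d : Drawing G Torus) (w0 : V)
    (Γ : ℝ → ℝ × ℝ) (hΓ : Continuous Γ) (a b : ℤ) (hab : a ≠ 0 ∨ b ≠ 0)
    (hΓ1 : Γ 1 = ((Γ 0).1 + a, (Γ 0).2 + b)) (h0 : pr (Γ 0) = d.vmap w0)
    (hI : ∀ t ∈ Ioo (0 : ℝ) 1, pr (Γ t) ∉ d.image)
    (hinj : ∀ s ∈ Ioo (0 : ℝ) 1, ∀ t ∈ Ioo (0 : ℝ) 1, pr (Γ s) = pr (Γ t) → s = t) :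
    ∃ side, HasDual (splitG G w0 side) := by
  have hIv : ∀ t ∈ Ioo (0 : ℝ) 1, ∀ v, pr (Γ t) ≠ d.vmap v := fun t ht v h =>
    hI t ht (Or.inl ⟨v, h.symm⟩)
  have hIe : ∀ t ∈ Ioo (0 : ℝ) 1, ∀ e, pr (Γ t) ∉ d.emap e := fun t ht e h =>
    hI t ht (Or.inr (mem_iUnion.2 ⟨e, h⟩))
  have F1 := curve_mod Γ hΓ a b hΓ1 (fun t ht => by rw [h0]; exact hIv t ht w0) hinj
  set c := Γ 0 with hc
  have F2 : ∀ᶠ r in 𝓝[>] (0 : ℝ), ∀ v, v ≠ w0 → Disjoint (bx c r) {d.vmap v} :=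
    Filter.eventually_all.2 fun v => by
      by_cases h : v = w0
      · exact Filter.Eventually.of_forall fun N h' => absurd h h'
      · filter_upwards [bx_avoid c (isClosed_singleton (x := d.vmap v)) (by
          rw [h0]; exact fun h' => h (d.vinj h').symm)] with N hN _ using hN
  have F3 : ∀ᶠ r in 𝓝[>] (0 : ℝ), ∀ e : G.edgeSet, w0 ∉ (e : Sym2 V) →
      Disjoint (bx c r) (closure (d.emap e)) :=
    Filter.eventually_all.2 fun e => by
      by_cases h : w0 ∈ (e : Sym2 V)
      · exact Filter.Eventually.of_forall fun N h' => absurd h h'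
      · filter_upwards [bx_avoid c isClosed_closure (by rwa [h0, edge_closure])]
          with N hN _ using hN
  obtain ⟨r, ⟨θ1, θ2, τ1, τ2, Γ', hlt, hlt2, hτ1, hτ2, q1, q2, hΓ'c, hΓ'1, hΓ'⟩, G2, G3, hr4, hr⟩ :=
    (F1.and (F2.and (F3.and ((ev_le (x := 1 / 8) (by norm_num)).and
      (self_mem_nhdsWithin (a := (0 : ℝ)) (s := Ioi 0)))))).exists
  have hr : 0 < r := hr
  have hr4 : r < 1 / 4 := by linarith
  have hdkv : ∀ v, v ≠ w0 → d.vmap v ∉ dk c r := fun v hv h =>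
    (G2 v hv).ne_of_mem (dk_sub c hr.le h) rfl rfl
  have hdke : ∀ e : G.edgeSet, w0 ∉ (e : Sym2 V) → ∀ x ∈ dk c r, x ∉ d.emap e := fun e he x hx h =>
    (G3 e he).ne_of_mem (dk_sub c hr.le hx) (subset_closure h) rfl
  have hdk0 : dk c r ∈ 𝓝 (d.vmap w0) := by
    rw [← h0]; exact dk_nhds c (by simp; positivity)
  have hdkc : IsCompact (dk c r) := dk_compact c hr.le
  have hgc : IsCompact ((fun t => pr (Γ' t)) '' Icc 0 1) :=
    isCompact_Icc.image (pr_cont.comp hΓ'c)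
  have hgv : ∀ v, v ≠ w0 → ∀ t ∈ Icc (0 : ℝ) 1, pr (Γ' t) ≠ d.vmap v := by
    intro v hv t ht h
    rcases hΓ' t ht with ⟨ρ, hρ, e⟩ | ⟨ρ, hρ, e⟩ | ⟨τ, hτ, e, _⟩
    · exact hdkv v hv (by rw [← h, e]; exact pol_mem c hρ.1 hρ.2)
    · exact hdkv v hv (by rw [← h, e]; exact pol_mem c hρ.1 hρ.2)
    · exact hIv τ hτ v (by rw [← e, h])
  choose σ hσ using fun v => pr_surj (d.vmap v)
  choose φ hφc hφ using edge_param d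
  have f1 : ∀ᶠ ε in 𝓝[>] (0 : ℝ), ∀ v w, v ≠ w → Disjoint (bx (σ v) ε) (bx (σ w) ε) :=
    Filter.eventually_all.2 fun v => Filter.eventually_all.2 fun w => by
      by_cases h : v = w
      · exact Filter.Eventually.of_forall fun N h' => absurd h h'
      · filter_upwards [bx_disj (σ v) (σ w) (by rw [hσ, hσ]; exact fun h' => h (d.vinj h'))]
          with N hN _ using hN
  have f2 : ∀ᶠ ε in 𝓝[>] (0 : ℝ), ∀ (v : V) (e : G.edgeSet), v ∉ (e : Sym2 V) →
      Disjoint (bx (σ v) ε) (closure (d.emap e)) :=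
    Filter.eventually_all.2 fun v => Filter.eventually_all.2 fun e => by
      by_cases h : v ∈ (e : Sym2 V)
      · exact Filter.Eventually.of_forall fun N h' => absurd h h'
      · filter_upwards [bx_avoid (σ v) isClosed_closure (by rwa [hσ, edge_closure])]
          with N hN _ using hN
  have f3 : ∀ᶠ ε in 𝓝[>] (0 : ℝ), ∀ v : V, v ≠ w0 →
      Disjoint (bx (σ v) ε) ((fun t => pr (Γ' t)) '' Icc 0 1) :=
    Filter.eventually_all.2 fun v => by
      by_cases h : v = w0
      · exact Filter.Eventually.of_forall fun N h' => absurd h h'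
      · filter_upwards [bx_avoid (σ v) hgc.isClosed (by
          rw [hσ]; rintro ⟨t, ht, h'⟩; exact hgv v h t ht h')] with N hN _ using hN
  have f4 : ∀ᶠ ε in 𝓝[>] (0 : ℝ), ∀ v : V, v ≠ w0 → Disjoint (bx (σ v) ε) (dk c r) :=
    Filter.eventually_all.2 fun v => by
      by_cases h : v = w0
      · exact Filter.Eventually.of_forall fun N h' => absurd h h'
      · filter_upwards [bx_avoid (σ v) hdkc.isClosed (by
          rw [hσ]; exact hdkv v h)] with N hN _ using hN
  obtain ⟨ε, g1, g2, g3, g4, hε⟩ :=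
    (f1.and (f2.and (f3.and (f4.and (self_mem_nhdsWithin (a := (0 : ℝ)) (s := Ioi 0)))))).exists
  have hnb : ∀ v, bx (σ v) ε ∈ 𝓝 (d.vmap v) := fun v => by
    rw [← hσ]; exact bx_nhds _ hε
  have hK : ∀ e : Sym2 V, ∃ K : Set Torus, ∃ θ : ℝ, ∀ he : e ∈ G.edgeSet,
      IsCompact K ∧ IsPreconnected K ∧ K ⊆ d.emap ⟨e, he⟩ ∧
      (∀ z ∈ e, z ≠ w0 → (K ∩ bx (σ z) ε).Nonempty) ∧
      (w0 ∈ e → θ ∈ Ioo θ1 (θ1 + 2 * Real.pi) ∧ θ ≠ θ2 ∧ pr (pol c r θ) ∈ K ∧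
        ∀ x ∈ K, x ∈ dk c r → x = pr (pol c r θ)) := by
    intro e
    by_cases he : e ∈ G.edgeSet
    swap
    · exact ⟨∅, 0, fun h => absurd h he⟩
    set e' : G.edgeSet := ⟨e, he⟩ with he'
    by_cases hw : w0 ∈ e
    · obtain ⟨y, hy⟩ := hw
      have hyne : y ≠ w0 := by
        rw [hy] at he
        exact (SimpleGraph.mem_edgeSet _).1 he |>.ne.symm
      have hw0e : w0 ∈ (e' : Sym2 V) := by rw [he']; simp only [hy]; exact Sym2.mem_mk_left _ _
      have hye : y ∈ (e' : Sym2 V) := by rw [he']; simp only [hy]; exact Sym2.mem_mk_right _ _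
      obtain ⟨s, hs, hsu⟩ := edge_near d e' (hφ e') hye (hnb y)
      obtain ⟨t, ht, htw⟩ := edge_near d e' (hφ e') hw0e hdk0
      have hsub : uIcc s t ⊆ Ioo 0 1 := ordConnected_Ioo.uIcc_subset hs ht
      obtain ⟨τ, hτ, hτD, hτn, hτf⟩ := first_hit hdkc.isClosed ((hφc e').mono hsub)
        (fun h => (g4 y hyne).ne_of_mem hsu h rfl) htw
      obtain ⟨k1, k2, k3⟩ := sub_arc (hφc e') hs (hsub hτ)
      obtain ⟨θ, hθ⟩ := dk_bdry c hr hτD hτn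
      obtain ⟨θ', hθ', hp⟩ := pol_norm c r θ θ1
      have hem : pr (pol c r θ') ∈ d.emap e' := by
        rw [hp, ← hθ, ← hφ e']; exact ⟨τ, hsub hτ, rfl⟩
      refine ⟨φ e' '' uIcc s τ, θ', fun _ => ⟨k1, k2, k3.trans (hφ e').subset, ?_, fun _ =>
        ⟨⟨lt_of_le_of_ne hθ'.1 ?_, hθ'.2⟩, ?_, ⟨τ, right_mem_uIcc, by rw [hp, hθ]⟩, ?_⟩⟩⟩
      · intro z hz hz0
        rw [hy] at hz
        rcases Sym2.mem_iff.1 hz with rfl | rfl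
        · exact absurd rfl hz0
        · exact ⟨_, ⟨s, left_mem_uIcc, rfl⟩, hsu⟩
      · intro h
        rw [← h, q1] at hem
        exact hIe _ hτ1 _ hem
      · intro h
        rw [h, q2] at hem
        exact hIe _ hτ2 _ hem
      · rintro _ ⟨x, hx, rfl⟩ hxD
        by_cases hxt : x = τ
        · rw [hxt, hp, hθ]
        · exact absurd hxD (hτf x hx hxt)
    · induction e using Sym2.ind with
      | _ u w =>
        obtain ⟨s, hs, hsu⟩ := edge_near d e' (hφ e') (Sym2.mem_mk_left u w) (hnb u)
        obtain ⟨t, ht, htw⟩ := edge_near d e' (hφ e') (Sym2.mem_mk_right u w) (hnb w)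
        obtain ⟨k1, k2, k3⟩ := sub_arc (hφc e') hs ht
        refine ⟨φ e' '' uIcc s t, 0, fun _ => ⟨k1, k2, k3.trans (hφ e').subset, ?_,
          fun h => absurd h hw⟩⟩
        intro z hz _
        rcases Sym2.mem_iff.1 hz with rfl | rfl
        · exact ⟨_, ⟨s, left_mem_uIcc, rfl⟩, hsu⟩
        · exact ⟨_, ⟨t, right_mem_uIcc, rfl⟩, htw⟩
  choose K θ hK using hK
  have d1 : ∀ᶠ δ in 𝓝[>] (0 : ℝ), ∀ e : Sym2 V, e ∈ G.edgeSet → w0 ∈ e →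
      θ1 + δ ≤ θ e ∧ θ e ≤ θ1 + 2 * Real.pi - δ ∧ (θ e < θ2 → θ e ≤ θ2 - δ) ∧
      (¬ θ e < θ2 → θ2 + δ ≤ θ e) :=
    Filter.eventually_all.2 fun e => by
      by_cases h : e ∈ G.edgeSet ∧ w0 ∈ e
      · obtain ⟨h1, h2, -⟩ := (hK e h.1).2.2.2.2 h.2
        filter_upwards [ev_le (x := θ e - θ1) (by linarith [h1.1]),
          ev_le (x := θ1 + 2 * Real.pi - θ e) (by linarith [h1.2]),
          ev_le (x := |θ e - θ2|) (abs_pos.2 (sub_ne_zero.2 h2))] with δ e1 e2 e3 _ _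
        refine ⟨by linarith, by linarith, fun h => ?_, fun h => ?_⟩
        · rw [abs_of_neg (by linarith)] at e3; linarith
        · rw [abs_of_nonneg (by linarith)] at e3; linarith
      · exact Filter.Eventually.of_forall fun N h1 h2 => absurd ⟨h1, h2⟩ h
  obtain ⟨δ, hδ, hδ0⟩ := (d1.and (self_mem_nhdsWithin (a := (0 : ℝ)) (s := Ioi 0))).exists
  have hδ0 : 0 < δ := hδ0
  set q : ℝ → Torus := fun x => pr (pol c r x) with hq
  have hqc : Continuous q := pr_cont.comp (pol_cont c r)
  have hqd : ∀ x, q x ∈ dk c r := fun x => pol_mem c hr.le le_rfl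
  have mP : ∀ x ∈ Icc (θ1 + δ) (θ2 - δ), x ∈ Ico θ1 (θ1 + 2 * Real.pi) := fun x hx =>
    ⟨by linarith [hx.1], by linarith [hx.2]⟩
  have mN : ∀ x ∈ Icc (θ2 + δ) (θ1 + 2 * Real.pi - δ), x ∈ Ico θ1 (θ1 + 2 * Real.pi) := fun x hx =>
    ⟨by linarith [hx.1], by linarith [hx.2]⟩
  have mθ1 : θ1 ∈ Ico θ1 (θ1 + 2 * Real.pi) := ⟨le_rfl, by linarith [Real.pi_pos]⟩
  have mθ2 : θ2 ∈ Ico θ1 (θ1 + 2 * Real.pi) := ⟨hlt.le, hlt2⟩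
  have hBd : ∀ v, v ≠ w0 → ∀ S : Set ℝ, Disjoint (bx (σ v) ε) (q '' S) := fun v hv S =>
    (g4 v hv).mono_right (by rintro _ ⟨x, -, rfl⟩; exact hqd x)
  have hKinc : ∀ e (he : e ∈ G.edgeSet), w0 ∈ e → ∀ x ∈ Ico θ1 (θ1 + 2 * Real.pi), ∀ ρ, 0 ≤ ρ → ρ ≤ r →
      pr (pol c ρ x) ∈ K e → x = θ e := by
    intro e he hw x hx ρ hρ0 hρ1 hxK
    obtain ⟨h1, h2, h3, h4⟩ := (hK e he).2.2.2.2 hw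
    exact ang_eq c hr hr4 hρ0 hρ1 hx ⟨h1.1.le, h1.2⟩ (h4 _ hxK (pol_mem c hρ0 hρ1))
  refine ⟨fun e => θ e < θ2, split_host (fun v => bx (σ v) ε) (q '' Icc (θ1 + δ) (θ2 - δ))
    (q '' Icc (θ2 + δ) (θ1 + 2 * Real.pi - δ)) K (fun v => bx_compact _ _) (fun v => bx_conn _ _)
    (isCompact_Icc.image hqc) (isPreconnected_Icc.image _ hqc.continuousOn)
    (isCompact_Icc.image hqc) (isPreconnected_Icc.image _ hqc.continuousOn) ?_ g1
    (fun v hv => hBd v hv _) (fun v hv => hBd v hv _)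
    (fun e he => (hK e he).1) (fun e he => (hK e he).2.1) ?_ ?_
    (fun e he v hv hve => (hK e he).2.2.2.1 v hve hv) ?_ ?_ ?_
    Γ' hΓ'c.continuousOn a b hab hΓ'1 ?_ ?_ ?_ ?_⟩
  · rw [Set.disjoint_left]
    rintro _ ⟨x, hx, rfl⟩ ⟨y, hy, hxy⟩
    have := ang_eq c hr hr4 hr.le le_rfl (mN y hy) (mP x hx) hxy
    linarith [hx.2, hy.1]
  · intro e he e' he' hne
    have h1 := (hK e he).2.2.1
    have h2 := (hK e' he').2.2.1
    refine Disjoint.mono h1 h2 (Set.disjoint_iff_inter_eq_empty.2 (d.edges_disj _ _ ?_))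
    intro h
    exact hne (congrArg Subtype.val h)
  · intro e he z _ hz
    exact ((g2 z ⟨e, he⟩ hz).mono_right ((hK e he).2.2.1.trans subset_closure)).symm
  · intro e he hw
    constructor
    · rw [Set.disjoint_left]
      rintro _ h ⟨x, hx, rfl⟩
      exact hdke ⟨e, he⟩ hw _ (hqd x) ((hK e he).2.2.1 h)
    · rw [Set.disjoint_left]
      rintro _ h ⟨x, hx, rfl⟩
      exact hdke ⟨e, he⟩ hw _ (hqd x) ((hK e he).2.2.1 h)
  · intro e he hw hs
    beta_reduce at hs
    obtain ⟨b1, b2, b3, b4⟩ := hδ e he hw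
    refine ⟨⟨q (θ e), ((hK e he).2.2.2.2 hw).2.2.1, θ e, ⟨b1, b3 hs⟩, rfl⟩, ?_⟩
    rw [Set.disjoint_left]
    rintro _ h ⟨x, hx, rfl⟩
    have := hKinc e he hw x (mN x hx) r hr.le le_rfl h
    linarith [hx.1]
  · intro e he hw hs
    beta_reduce at hs
    obtain ⟨b1, b2, b3, b4⟩ := hδ e he hw
    refine ⟨⟨q (θ e), ((hK e he).2.2.2.2 hw).2.2.1, θ e, ⟨b4 hs, b2⟩, rfl⟩, ?_⟩
    rw [Set.disjoint_left]
    rintro _ h ⟨x, hx, rfl⟩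
    have := hKinc e he hw x (mP x hx) r hr.le le_rfl h
    linarith [hx.2]
  · intro v hv t ht h
    exact (g3 v hv).ne_of_mem h ⟨t, ht, rfl⟩ rfl
  · rintro t ht ⟨x, hx, hxt⟩
    rcases hΓ' t ht with ⟨ρ, hρ, e⟩ | ⟨ρ, hρ, e⟩ | ⟨τ, hτ, e, hn⟩
    · have := ang_eq c hr hr4 hρ.1 hρ.2 mθ1 (mP x hx) (by rw [← e]; exact hxt.symm)
      linarith [hx.1]
    · have := ang_eq c hr hr4 hρ.1 hρ.2 mθ2 (mP x hx) (by rw [← e]; exact hxt.symm)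
      linarith [hx.2]
    · exact hn (by rw [← hxt]; exact hqd x)
  · rintro t ht ⟨x, hx, hxt⟩
    rcases hΓ' t ht with ⟨ρ, hρ, e⟩ | ⟨ρ, hρ, e⟩ | ⟨τ, hτ, e, hn⟩
    · have := ang_eq c hr hr4 hρ.1 hρ.2 mθ1 (mN x hx) (by rw [← e]; exact hxt.symm)
      linarith [hx.1]
    · have := ang_eq c hr hr4 hρ.1 hρ.2 mθ2 (mN x hx) (by rw [← e]; exact hxt.symm)
      linarith [hx.1]
    · exact hn (by rw [← hxt]; exact hqd x)
  · intro e he t ht h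
    rcases hΓ' t ht with ⟨ρ, hρ, e1⟩ | ⟨ρ, hρ, e1⟩ | ⟨τ, hτ, e1, hn⟩
    · rw [e1] at h
      by_cases hw : w0 ∈ e
      · have := hKinc e he hw θ1 mθ1 ρ hρ.1 hρ.2 h
        exact absurd this ((hK e he).2.2.2.2 hw).1.1.ne
      · exact hdke ⟨e, he⟩ hw _ (pol_mem c hρ.1 hρ.2) ((hK e he).2.2.1 h)
    · rw [e1] at h
      by_cases hw : w0 ∈ e
      · have := hKinc e he hw θ2 mθ2 ρ hρ.1 hρ.2 h
        exact absurd this.symm ((hK e he).2.2.2.2 hw).2.1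
      · exact hdke ⟨e, he⟩ hw _ (pol_mem c hρ.1 hρ.2) ((hK e he).2.2.1 h)
    · rw [e1] at h
      exact hIe τ hτ ⟨e, he⟩ ((hK e he).2.2.1 h)

end TorusThree

namespace TorusThree

open scoped Classical

/-! ### Part N: conclusion -/

variable {V : Type} [Fintype V] {G : SimpleGraph V}

lemma tf_of (h : TriangleFree G) : TF G := by
  intro a b c hab hbc hca
  obtain ⟨u, w, h1, h2⟩ := SimpleGraph.is3Clique_iff_exists_cycle_length_three.1
    ⟨{a, b, c}, SimpleGraph.is3Clique_triple_iff.2 ⟨hab, hca.symm, hbc⟩⟩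
  exact h u w h1 h2

lemma circ_inj (x0 : Circle1) {s t : ℝ} (hs : s ∈ Ico (0 : ℝ) 1) (ht : t ∈ Ico (0 : ℝ) 1)
    (h : x0 + (s : Circle1) = x0 + (t : Circle1)) : s = t := by
  have h2 := add_left_cancel h
  haveI : Fact (0 < (1 : ℝ)) := ⟨one_pos⟩
  exact (AddCircle.coe_eq_coe_iff_of_mem_Ico (a := 0) (by simpa using hs) (by simpa using ht)).1 h2

theorem final (d : Drawing G Torus) (htf : TriangleFree G)
    (hrep : ∃ γ : C(Circle1, Torus), Function.Injective γ ∧ ¬ NullHomotopic γ ∧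
      (Set.range γ ∩ d.image).Finite ∧ (Set.range γ ∩ d.image).ncard ≤ 1) :
    G.Colorable 3 := by
  have hT := tf_of htf
  obtain ⟨γ, hinj, hnull, hfin, hcard⟩ := hrep
  have huniq : ∀ x y, γ x ∈ d.image → γ y ∈ d.image → γ x = γ y := fun x y hx hy =>
    (Set.ncard_le_one hfin).1 hcard _ ⟨⟨x, rfl⟩, hx⟩ _ ⟨⟨y, rfl⟩, hy⟩
  by_cases hv : ∃ x0 w0, γ x0 = d.vmap w0
  · obtain ⟨x0, w0, hx0⟩ := hv
    obtain ⟨Γ, hΓ, hΓγ, a, b, hab, hΓ1⟩ := exists_lift γ hnull x0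
    have e0 : pr (Γ 0) = γ x0 := by
      rw [hΓγ 0 ⟨le_rfl, zero_le_one⟩]; simp
    have hm : ∀ t ∈ Ioo (0 : ℝ) 1, pr (Γ t) = γ (x0 + (t : Circle1)) := fun t ht =>
      hΓγ t ⟨ht.1.le, ht.2.le⟩
    obtain ⟨side, hD⟩ := case_two d w0 Γ hΓ a b hab hΓ1 (e0.trans hx0) (by
      intro t ht h
      rw [hm t ht] at h
      have h1 := hinj (huniq _ x0 h (Or.inl ⟨w0, hx0.symm⟩))
      have h2 : t = 0 := circ_inj x0 ⟨ht.1.le, ht.2⟩ ⟨le_rfl, one_pos⟩ (by rw [h1]; simp)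
      exact ht.1.ne' h2) (by
      intro s hs t ht h
      rw [hm s hs, hm t ht] at h
      exact circ_inj x0 ⟨hs.1.le, hs.2⟩ ⟨ht.1.le, ht.2⟩ (hinj h))
    exact split_col (thmT hD (split_tf hT) split_nadj)
  push Not at hv
  obtain ⟨Γ, hΓ, hΓγ, a, b, hab, hΓ1⟩ := exists_lift γ hnull 0
  have hV : ∀ t ∈ Icc (0 : ℝ) 1, ∀ v, pr (Γ t) ≠ d.vmap v := fun t ht v => by
    rw [hΓγ t ht]; exact hv _ _
  by_cases he : ∃ x0 e0, γ x0 ∈ d.emap e0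
  · obtain ⟨x0, ⟨e0, he0⟩, hx0⟩ := he
    induction e0 using Sym2.ind with
    | _ p q =>
    have hpq : G.Adj p q := he0
    have hD : HasDual (G.deleteEdges {s(p, q)}) := by
      refine case_one d _ (SimpleGraph.deleteEdges_le _) Γ hΓ a b hab hΓ1 hV ?_
      intro t ht e heH h
      rw [hΓγ t ht] at h
      have h1 := huniq _ x0 (Or.inr (mem_iUnion.2 ⟨e, h⟩)) (Or.inr (mem_iUnion.2 ⟨_, hx0⟩))
      rw [h1] at h
      rw [SimpleGraph.edgeSet_deleteEdges] at heH
      by_cases hee : e = ⟨s(p, q), he0⟩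
      · exact heH.2 (by rw [hee]; rfl)
      · exact (Set.disjoint_iff_inter_eq_empty.2 (d.edges_disj _ _ hee)).ne_of_mem h hx0 rfl
    have hle : ∀ x y, (G.deleteEdges {s(p, q)}).Adj x y → G.Adj x y := fun x y h =>
      SimpleGraph.deleteEdges_le _ h
    obtain ⟨c, hc, hce⟩ := thmT (hD.pend q) (u := some p) (v := none) (by
      rintro (_ | x) (_ | y) (_ | z) h1 h2 h3
      · exact h1
      · exact h1
      · exact h3
      · have h1 : y = q := h1
        have h3 : z = q := h3
        subst h1; subst h3
        exact G.loopless.irrefl _ (hle _ _ h2)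
      · exact h2
      · have h1 : x = q := h1
        have h2 : z = q := h2
        subst h1; subst h2
        exact G.loopless.irrefl _ (hle _ _ h3)
      · have h3 : x = q := h3
        have h2 : y = q := h2
        subst h3; subst h2
        exact G.loopless.irrefl _ (hle _ _ h1)
      · exact hT x y z (hle _ _ h1) (hle _ _ h2) (hle _ _ h3)) (fun h => hpq.ne h)
    have hne : c (some p) ≠ c (some q) := by
      rw [hce]; exact hc none (some q) rfl
    refine ⟨SimpleGraph.Coloring.mk (fun v => c (some v)) ?_⟩
    intro v w hvw
    by_cases h : s(v, w) = s(p, q)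
    · rcases Sym2.eq_iff.1 h with ⟨rfl, rfl⟩ | ⟨rfl, rfl⟩
      · exact hne
      · exact hne.symm
    · refine hc (some v) (some w) ?_
      change (G.deleteEdges {s(p, q)}).Adj v w
      rw [SimpleGraph.deleteEdges_adj]
      exact ⟨hvw, h⟩
  · push Not at he
    have hD : HasDual G := case_one d G le_rfl Γ hΓ a b hab hΓ1 hV (fun t ht e _ => by
      rw [hΓγ t ht]; exact he _ _)
    rcases isEmpty_or_nonempty V with hem | ⟨⟨u⟩⟩
    · exact ⟨SimpleGraph.Coloring.mk (fun v => 0) (fun {v} => (hem.false v).elim)⟩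
    · obtain ⟨c, hc, -⟩ := thmT hD hT (u := u) (v := u) (G.loopless.irrefl u)
      exact ⟨SimpleGraph.Coloring.mk c (fun {v w} h => hc v w h)⟩

end TorusThree

/-- Every triangle-free graph drawn in the torus with
representativity at most 1 is 3-colorable. -/
theorem low_representativity_three_colorable {V : Type} [Fintype V]
    {G : SimpleGraph V} (d : Drawing G Torus) (htf : TriangleFree G)
    (hrep : ∃ γ : C(Circle1, Torus), Function.Injective γ ∧ ¬ NullHomotopic γ ∧
      (Set.range γ ∩ d.image).Finite ∧ (Set.range γ ∩ d.image).ncard ≤ 1) :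
    G.Colorable 3 := by
  exact TorusThree.final d htf hrep
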